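/- Let {u_j}_{j ≥ 1} be a sequence of ω-subharmonic functions on Ω that is uniformly bounded above. Suppose u is ω-subharmonic on Ω and u_j → u in the sense of distributions, i.e., ∫_Ω u_j φ dλ → ∫_Ω u φ dλ for every smooth compactly supported φ on Ω. Then u_j → u in L¹ on every compact subset of Ω, limsup_{j→∞} u_j(z) ≤ u(z) for every z ∈ Ω, and limsup_{j→∞} u_j = u Lebesgue-almost everywhere on Ω. -/

import Mathlib

open scoped BigOperators ComplexOrder
open MeasureTheory Filter Topology

noncomputable section

/-- `ℂ^n`. -/
abbrev Cz (n : ℕ) := Fin n → ℂ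

/-- Wirtinger derivative `∂f/∂z_i`. -/
def wder {n : ℕ} (i : Fin n) (f : Cz n → ℂ) (z : Cz n) : ℂ :=
  (fderiv ℝ f z (Pi.single i 1) - Complex.I * fderiv ℝ f z (Pi.single i Complex.I)) / 2

/-- Conjugate Wirtinger derivative `∂f/∂z̄_i`. -/
def wderBar {n : ℕ} (i : Fin n) (f : Cz n → ℂ) (z : Cz n) : ℂ :=
  (fderiv ℝ f z (Pi.single i 1) + Complex.I * fderiv ℝ f z (Pi.single i Complex.I)) / 2

/-- `∂²f/∂z_i ∂z̄_j` of a complex-valued function. -/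
def cHessC {n : ℕ} (f : Cz n → ℂ) (i j : Fin n) (z : Cz n) : ℂ :=
  wder i (wderBar j f) z

/-- `∂²u/∂z_i ∂z̄_j` of a real-valued function. -/
def cHess {n : ℕ} (u : Cz n → ℝ) (i j : Fin n) (z : Cz n) : ℂ :=
  cHessC (fun w => (u w : ℂ)) i j z

/-- `Δ_ω h = Σ_{i,j} ω^{j̄ i} ∂²h/∂z_i ∂z̄_j`. -/
def wLap {n : ℕ} (ω : Cz n → Matrix (Fin n) (Fin n) ℂ) (h : Cz n → ℝ) (z : Cz n) : ℂ :=
  ∑ i, ∑ j, (ω z)⁻¹ i j * cHess h i j z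

/-- `ω` is a smooth Hermitian metric on `S`. -/
def IsHermitianMetricOn {n : ℕ} (ω : Cz n → Matrix (Fin n) (Fin n) ℂ) (S : Set (Cz n)) : Prop :=
  (∀ i j, ContDiffOn ℝ ((⊤ : ℕ∞) : WithTop ℕ∞) (fun z => ω z i j) S) ∧ ∀ z ∈ S, (ω z).PosDef

/-- `u : W → [-∞, +∞)` is `ω`-subharmonic on `W`: it is upper semicontinuous and
locally integrable on `W`, and it satisfies the comparison principle against continuous
`Δ_ω`-harmonic functions on relatively compact open subsets of `W`. -/
structure OmegaSH {n : ℕ} (ω : Cz n → Matrix (Fin n) (Fin n) ℂ) (W : Set (Cz n))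
    (u : Cz n → EReal) : Prop where
  ne_top : ∀ z ∈ W, u z ≠ ⊤
  usc : UpperSemicontinuousOn u W
  locInt : LocallyIntegrableOn (fun z => (u z).toReal) W volume
  ae_ne_bot : ∀ᵐ z ∂(volume.restrict W), u z ≠ ⊥
  maxPrinciple : ∀ D : Set (Cz n), IsOpen D → IsCompact (closure D) → closure D ⊆ W →
    ∀ h : Cz n → ℝ, ContinuousOn h (closure D) → ContDiffOn ℝ 2 h D →
      (∀ z ∈ D, wLap ω h z = 0) →
      (∀ z ∈ frontier D, u z ≤ (h z : EReal)) →
      ∀ z ∈ closure D, u z ≤ (h z : EReal)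

section WienerNorm
open scoped FourierTransform

variable {E : Type*} [NormedAddCommGroup E] [InnerProductSpace ℝ E] [FiniteDimensional ℝ E]
  [MeasurableSpace E] [BorelSpace E]

theorem exists_uniform_iteratedFDeriv_le {B : ℝ → E → ℂ}
    (hB : ContDiff ℝ ((⊤ : ℕ∞) : WithTop ℕ∞) (fun q : ℝ × E => B q.1 q.2)) {R : ℝ}
    (hR : ∀ r x, R < ‖x‖ → B r x = 0) (h0 : ∀ x, B 0 x = 0) (p : ℕ) {η : ℝ} (hη : 0 < η) :
    ∀ᶠ r in 𝓝 (0 : ℝ), ∀ x, ‖iteratedFDeriv ℝ p (B r) x‖ ≤ η := by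
  have key : ∀ r x, iteratedFDeriv ℝ p (B r) x =
      (iteratedFDeriv ℝ p (fun q : ℝ × E => B q.1 q.2) (r, x)).compContinuousLinearMap
        (fun _ => ContinuousLinearMap.inr ℝ ℝ E) := by
    intro r x
    have e1 : B r = (fun z : ℝ × E => (fun q : ℝ × E => B q.1 q.2) ((r, 0) + z)) ∘
        (ContinuousLinearMap.inr ℝ ℝ E) := by
      ext y; simp
    rw [e1, ContinuousLinearMap.iteratedFDeriv_comp_right (n := ((⊤ : ℕ∞) : WithTop ℕ∞))]
    · have h2 := iteratedFDeriv_comp_add_left (𝕜 := ℝ) (f := fun q : ℝ × E => B q.1 q.2) p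
        ((r, 0) : ℝ × E) (ContinuousLinearMap.inr ℝ ℝ E x)
      simp only at h2 ⊢
      rw [h2]; simp
    · exact hB.comp (contDiff_const.add contDiff_id)
    · exact_mod_cast le_top
  have hcont : Continuous (fun q : ℝ × E => iteratedFDeriv ℝ p (B q.1) q.2) := by
    simp_rw [key]
    have := hB.continuous_iteratedFDeriv (m := p) (by exact_mod_cast le_top)
    exact (ContinuousMultilinearMap.compContinuousLinearMapL
      (fun _ => ContinuousLinearMap.inr ℝ ℝ E)).continuous.comp this
  have hz : B 0 = fun _ => 0 := funext h0
  have hopen : IsOpen {q : ℝ × E | ‖iteratedFDeriv ℝ p (B q.1) q.2‖ < η} :=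
    isOpen_lt hcont.norm continuous_const
  obtain ⟨U, V, hU, hV, hU0, hVK, hUV⟩ :=
    generalized_tube_lemma (isCompact_singleton (x := (0 : ℝ)))
    (isCompact_closedBall (0 : E) R) hopen (by
      rintro ⟨r, x⟩ ⟨hr, hx⟩
      simp only [Set.mem_singleton_iff] at hr
      subst hr
      have : iteratedFDeriv ℝ p (B 0) x = 0 := by
        rw [hz]
        simp
      simp only [Set.mem_ofPred_eq, this, norm_zero, hη])
  filter_upwards [hU.mem_nhds (hU0 rfl)] with r hr x
  by_cases hx : x ∈ Metric.closedBall (0 : E) R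
  · exact (hUV (Set.mk_mem_prod hr (hVK hx))).le
  · have : iteratedFDeriv ℝ p (B r) x = 0 := by
      by_contra hne
      apply hx
      have h1 := support_iteratedFDeriv_subset (𝕜 := ℝ) (f := B r) p hne
      have h2 : tsupport (B r) ⊆ Metric.closedBall (0 : E) R := by
        refine closure_minimal (fun y hy => ?_) Metric.isClosed_closedBall
        by_contra hy'
        exact hy (hR r y (by simpa using hy'))
      exact h2 h1
    rw [this, norm_zero]; exact hη.le

theorem eventually_integral_norm_fourier_le {B : ℝ → E → ℂ}
    (hB : ContDiff ℝ ((⊤ : ℕ∞) : WithTop ℕ∞) (fun q : ℝ × E => B q.1 q.2)) {R : ℝ}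
    (hR : ∀ r x, R < ‖x‖ → B r x = 0) (h0 : ∀ x, B 0 x = 0) {ε : ℝ} (hε : 0 < ε) :
    ∀ᶠ r in 𝓝 (0 : ℝ), Integrable (𝓕 (B r)) ∧ ∫ ξ, ‖𝓕 (B r) ξ‖ ≤ ε := by
  set N := Module.finrank ℝ E + 1 with hN
  set I := ∫ ξ : E, (1 + ‖ξ‖) ^ (-(N : ℝ)) with hI
  have hIint : Integrable (fun ξ : E => (1 + ‖ξ‖) ^ (-(N : ℝ))) :=
    integrable_one_add_norm (by rw [hN]; push_cast; linarith)
  have hI0 : 0 ≤ I := integral_nonneg fun ξ => by positivity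
  set v := (volume : Measure E).real (Metric.closedBall 0 R) with hv
  have hv0 : 0 ≤ v := measureReal_nonneg
  obtain ⟨η, hη, hηε⟩ : ∃ η > 0, 2 ^ N * (1 * (v * η) + 2 ^ N * ((N + 1) * (v * η))) * I ≤ ε := by
    refine ⟨ε / (2 ^ N * (v + 2 ^ N * ((N + 1) * v)) * I + 1), by positivity, ?_⟩
    have : 0 < 2 ^ N * (v + 2 ^ N * ((N + 1) * v)) * I + 1 := by positivity
    rw [show 2 ^ N * (1 * (v * (ε / (2 ^ N * (v + 2 ^ N * ((N + 1) * v)) * I + 1))) + 2 ^ N *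
      ((N + 1) * (v * (ε / (2 ^ N * (v + 2 ^ N * ((N + 1) * v)) * I + 1))))) * I =
      ε * ((2 ^ N * (v + 2 ^ N * ((N + 1) * v)) * I) /
        (2 ^ N * (v + 2 ^ N * ((N + 1) * v)) * I + 1)) by ring]
    exact mul_le_of_le_one_right hε.le (by rw [div_le_one this]; linarith)
  have hall : ∀ᶠ r in 𝓝 (0 : ℝ), ∀ p ∈ Finset.range (N + 1), ∀ x,
      ‖iteratedFDeriv ℝ p (B r) x‖ ≤ η :=
    (Finset.eventually_all _).2 fun p _ => exists_uniform_iteratedFDeriv_le hB hR h0 p hη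
  filter_upwards [hall] with r hr
  have hBr : ContDiff ℝ ((⊤ : ℕ∞) : WithTop ℕ∞) (B r) :=
    hB.comp (contDiff_const.prodMk contDiff_id)
  have hts : tsupport (B r) ⊆ Metric.closedBall (0 : E) R := by
    refine closure_minimal (fun y hy => ?_) Metric.isClosed_closedBall
    by_contra hy'
    exact hy (hR r y (by simpa using hy'))
  have hcs : HasCompactSupport (B r) :=
    (isCompact_closedBall (0 : E) R).of_isClosed_subset (isClosed_tsupport _) hts
  have hint : ∀ (k n : ℕ), Integrable (fun v : E => ‖v‖ ^ k * ‖iteratedFDeriv ℝ n (B r) v‖) := by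
    intro k n
    refine Continuous.integrable_of_hasCompactSupport ?_ ?_
    · have := hBr.continuous_iteratedFDeriv (m := n) (by exact_mod_cast le_top)
      fun_prop
    · exact ((hcs.iteratedFDeriv (𝕜 := ℝ) n).norm).mul_left
  have hJ : ∀ p ∈ Finset.range (N + 1), ∫ x, ‖iteratedFDeriv ℝ p (B r) x‖ ≤ v * η := by
    intro p hp
    have : ∫ x, ‖iteratedFDeriv ℝ p (B r) x‖ =
        ∫ x in Metric.closedBall (0 : E) R, ‖iteratedFDeriv ℝ p (B r) x‖ := by
      refine (setIntegral_eq_integral_of_forall_compl_eq_zero fun x hx => ?_).symm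
      by_contra hne
      exact hx (hts (support_iteratedFDeriv_subset (𝕜 := ℝ) (f := B r) p
        (fun h => hne (by simp [h]))))
    rw [this]
    have := norm_setIntegral_le_of_norm_le_const (μ := (volume : Measure E))
      (f := fun x => ‖iteratedFDeriv ℝ p (B r) x‖) (s := Metric.closedBall (0 : E) R) (C := η)
      (isCompact_closedBall (0 : E) R).measure_lt_top (fun x _ => by simpa using hr p hp x)
    rw [mul_comm]
    exact (le_abs_self _).trans this
  have hpw : ∀ n ≤ N, ∀ ξ, ‖ξ‖ ^ n * ‖𝓕 (B r) ξ‖ ≤ 2 ^ n * ((n + 1) * (v * η)) := by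
    intro n hn ξ
    have h := Real.pow_mul_norm_iteratedFDeriv_fourier_le (f := B r) (K := ⊤) (N := ⊤) hBr
      (fun k n _ _ => hint k n) (k := 0) (n := n) (by simp) (by simp) ξ
    simp only [norm_iteratedFDeriv_zero] at h
    refine h.trans ?_
    have hs : ∑ p ∈ Finset.range (0 + 1) ×ˢ Finset.range (n + 1),
        ∫ v : E, ‖v‖ ^ p.1 * ‖iteratedFDeriv ℝ p.2 (B r) v‖ ≤ (n + 1) * (v * η) := by
      rw [Finset.sum_product]
      simp only [zero_add, Finset.range_one, Finset.sum_singleton, pow_zero, one_mul]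
      calc _ ≤ ∑ p ∈ Finset.range (n + 1), v * η := Finset.sum_le_sum fun p hp => hJ p (by
              simp only [Finset.mem_range] at hp ⊢; omega)
        _ = _ := by simp
    calc _ = (2 : ℝ) ^ n * ∑ p ∈ Finset.range (0 + 1) ×ˢ Finset.range (n + 1),
        ∫ v : E, ‖v‖ ^ p.1 * ‖iteratedFDeriv ℝ p.2 (B r) v‖ := by norm_num
      _ ≤ _ := by gcongr
  have hbound : ∀ ξ, ‖𝓕 (B r) ξ‖ ≤
      2 ^ N * (1 * (v * η) + 2 ^ N * ((N + 1) * (v * η))) * (1 + ‖ξ‖) ^ (-(N : ℝ)) := by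
    intro ξ
    have hp : (0 : ℝ) < 1 + ‖ξ‖ := by positivity
    rw [Real.rpow_neg hp.le, Real.rpow_natCast, ← div_eq_mul_inv, le_div_iff₀ (by positivity)]
    have h1 := hpw 0 (Nat.zero_le _) ξ
    have h2 := hpw N le_rfl ξ
    have h3 : (1 + ‖ξ‖) ^ N ≤ 2 ^ N * (1 + ‖ξ‖ ^ N) := by
      have := add_pow_le (zero_le_one) (norm_nonneg ξ) N
      rw [one_pow] at this
      refine this.trans ?_
      gcongr
      · norm_num
      · omega
    calc ‖𝓕 (B r) ξ‖ * (1 + ‖ξ‖) ^ N ≤ ‖𝓕 (B r) ξ‖ * (2 ^ N * (1 + ‖ξ‖ ^ N)) := by gcongr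
      _ = 2 ^ N * (‖ξ‖ ^ 0 * ‖𝓕 (B r) ξ‖ + ‖ξ‖ ^ N * ‖𝓕 (B r) ξ‖) := by ring
      _ ≤ 2 ^ N * (2 ^ 0 * (((0 : ℕ) + 1) * (v * η)) + 2 ^ N * ((N + 1) * (v * η))) := by gcongr
      _ = _ := by simp
  have hBint : Integrable (B r) := hBr.continuous.integrable_of_hasCompactSupport hcs
  have hFc : Continuous (𝓕 (B r)) := by
    have := Real.contDiff_fourier (f := B r) (N := 0) (fun n hn => by
      have h := hint n 0
      simpa using h)
    exact this.continuous
  have hFi : Integrable (𝓕 (B r)) := by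
    refine (hIint.const_mul
      (2 ^ N * (1 * (v * η) + 2 ^ N * ((N + 1) * (v * η))))).mono' hFc.aestronglyMeasurable ?_
    exact Eventually.of_forall hbound
  refine ⟨hFi, ?_⟩
  calc ∫ ξ, ‖𝓕 (B r) ξ‖ ≤ ∫ ξ : E,
      2 ^ N * (1 * (v * η) + 2 ^ N * ((N + 1) * (v * η))) * (1 + ‖ξ‖) ^ (-(N : ℝ)) :=
        integral_mono hFi.norm (hIint.const_mul _) hbound
    _ = 2 ^ N * (1 * (v * η) + 2 ^ N * ((N + 1) * (v * η))) * I := by rw [integral_const_mul]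
    _ ≤ ε := hηε

end WienerNorm

section Neumann
open scoped FourierTransform Convolution

variable {E : Type*} [NormedAddCommGroup E] [InnerProductSpace ℝ E] [FiniteDimensional ℝ E]
  [MeasurableSpace E] [BorelSpace E]

theorem integral_norm_convolution_le {f g : E → ℂ} (hf : Integrable f) (hg : Integrable g) :
    ∫ x, ‖(f ⋆[ContinuousLinearMap.mul ℂ ℂ] g) x‖ ≤ (∫ x, ‖f x‖) * ∫ x, ‖g x‖ := by
  have h1 := integral_convolution (ContinuousLinearMap.mul ℝ ℝ) (μ := (volume : Measure E))
    (ν := volume) hf.norm hg.norm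
  simp only [ContinuousLinearMap.mul_apply'] at h1
  rw [← h1]
  refine integral_mono (hf.integrable_convolution _ hg).norm
    (hf.norm.integrable_convolution _ hg.norm) fun x => ?_
  refine (norm_integral_le_integral_norm _).trans (le_of_eq ?_)
  simp [convolution]

theorem exists_fourier_neumann {κ : Type*} [Fintype κ] {B : κ → E → ℂ} {m : κ → E → ℝ}
    {G : E → ℂ} (hB : ∀ k, Integrable (B k)) (hm : ∀ k, Measurable (m k)) {C : ℝ}
    (hmC : ∀ k ξ, |m k ξ| ≤ C) (hG : Integrable G)
    (hsmall : C * ∑ k, ∫ ξ, ‖B k ξ‖ ≤ 1 / 2) :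
    ∃ F : E → ℂ, Integrable F ∧ ∫ ξ, ‖F ξ‖ ≤ 2 * ∫ ξ, ‖G ξ‖ ∧
      ∀ x, 𝓕 F x + ∑ k, 𝓕 (B k) x * 𝓕 (fun ξ => (m k ξ : ℂ) * F ξ) x = 𝓕 G x := by
  have hmF : ∀ k {F : E → ℂ}, Integrable F → Integrable (fun ξ => (m k ξ : ℂ) * F ξ) := by
    intro k F hF
    exact hF.bdd_mul (c := C) (Complex.measurable_ofReal.comp (hm k)).aestronglyMeasurable
      (Eventually.of_forall fun ξ => by simpa using hmC k ξ)
  have hmn : ∀ k {F : E → ℂ}, Integrable F →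
      ∫ ξ, ‖(m k ξ : ℂ) * F ξ‖ ≤ C * ∫ ξ, ‖F ξ‖ := by
    intro k F hF
    rw [← integral_const_mul]
    refine integral_mono (hmF k hF).norm (hF.norm.const_mul C) fun ξ => ?_
    simp only [norm_mul, Complex.norm_real, Real.norm_eq_abs]
    exact mul_le_mul_of_nonneg_right (hmC k ξ) (norm_nonneg _)
  let S : (E → ℂ) → E → ℂ := fun F ξ =>
    ∑ k, (B k ⋆[ContinuousLinearMap.mul ℂ ℂ] (fun ξ => (m k ξ : ℂ) * F ξ)) ξ
  have hS : ∀ {F : E → ℂ}, Integrable F → Integrable (S F) := fun hF =>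
    integrable_finsetSum _ fun k _ => (hB k).integrable_convolution _ (hmF k hF)
  have hSn : ∀ {F : E → ℂ}, Integrable F → ∫ ξ, ‖S F ξ‖ ≤ 1 / 2 * ∫ ξ, ‖F ξ‖ := by
    intro F hF
    have hF0 : 0 ≤ ∫ ξ, ‖F ξ‖ := integral_nonneg fun _ => norm_nonneg _
    calc ∫ ξ, ‖S F ξ‖ ≤ ∫ ξ, ∑ k,
          ‖(B k ⋆[ContinuousLinearMap.mul ℂ ℂ] (fun ξ => (m k ξ : ℂ) * F ξ)) ξ‖ :=
          integral_mono (hS hF).norm (integrable_finsetSum _ fun k _ =>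
            ((hB k).integrable_convolution _ (hmF k hF)).norm) fun ξ => norm_sum_le _ _
      _ = ∑ k, ∫ ξ, ‖(B k ⋆[ContinuousLinearMap.mul ℂ ℂ] (fun ξ => (m k ξ : ℂ) * F ξ)) ξ‖ :=
          integral_finsetSum _ fun k _ => ((hB k).integrable_convolution _ (hmF k hF)).norm
      _ ≤ ∑ k, (∫ ξ, ‖B k ξ‖) * (C * ∫ ξ, ‖F ξ‖) := by
          refine Finset.sum_le_sum fun k _ => ?_
          refine (integral_norm_convolution_le (hB k) (hmF k hF)).trans ?_
          exact mul_le_mul_of_nonneg_left (hmn k hF) (integral_nonneg fun _ => norm_nonneg _)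
      _ = (C * ∑ k, ∫ ξ, ‖B k ξ‖) * ∫ ξ, ‖F ξ‖ := by
          rw [← Finset.sum_mul]; ring
      _ ≤ _ := mul_le_mul_of_nonneg_right hsmall hF0
  have hSsub : ∀ {F H : E → ℂ}, Integrable F → Integrable H →
      (fun ξ => S F ξ - S H ξ) =ᵐ[volume] S (fun ξ => F ξ - H ξ) := by
    intro F H hF hH
    have h1 : ∀ k, ∀ᵐ x, ConvolutionExistsAt (B k) (fun ξ => (m k ξ : ℂ) * F ξ) x
        (ContinuousLinearMap.mul ℂ ℂ) := fun k => (hB k).ae_convolution_exists _ (hmF k hF)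
    have h2 : ∀ k, ∀ᵐ x, ConvolutionExistsAt (B k) (fun ξ => (m k ξ : ℂ) * H ξ) x
        (ContinuousLinearMap.mul ℂ ℂ) := fun k => (hB k).ae_convolution_exists _ (hmF k hH)
    filter_upwards [ae_all_iff.2 h1, ae_all_iff.2 h2] with x hx1 hx2
    simp only [S]
    rw [← Finset.sum_sub_distrib]
    refine Finset.sum_congr rfl fun k _ => ?_
    simp only [convolution]
    rw [← integral_sub (hx1 k) (hx2 k)]
    congr 1; ext t
    simp; ring
  let Φ : (E →₁[volume] ℂ) → (E →₁[volume] ℂ) := fun F =>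
    hG.toL1 G - (hS (L1.integrable_coeFn F)).toL1 _
  have hΦ : ContractingWith (1 / 2 : NNReal) Φ := by
    refine ⟨by rw [← NNReal.coe_lt_coe]; norm_num, LipschitzWith.of_dist_le_mul fun F H => ?_⟩
    have hFi := L1.integrable_coeFn F
    have hHi := L1.integrable_coeFn H
    rw [dist_eq_norm, dist_eq_norm]
    have e : Φ F - Φ H = (hS (hHi.sub hFi)).toL1 _ := by
      have : Φ F - Φ H = (hS hHi).toL1 _ - (hS hFi).toL1 _ := by simp only [Φ]; abel
      rw [this, ← Integrable.toL1_sub]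
      exact (Integrable.toL1_eq_toL1_iff _ _ _ _).2 (hSsub hHi hFi)
    rw [e, L1.norm_of_fun_eq_integral_norm, norm_sub_rev, L1.norm_eq_integral_norm]
    refine (hSn (hHi.sub hFi)).trans (le_of_eq ?_)
    push_cast
    congr 1
    refine integral_congr_ae ?_
    filter_upwards [Lp.coeFn_sub H F] with x hx
    exact congrArg norm hx.symm
  obtain ⟨F, hfix⟩ : ∃ F, Φ F = F := ⟨_, hΦ.fixedPoint_isFixedPt⟩
  have hFi : Integrable F := L1.integrable_coeFn F
  have hae : (fun ξ => G ξ - S F ξ) =ᵐ[volume] F := by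
    have h1 : (hG.sub (hS hFi)).toL1 _ = F := by
      rw [Integrable.toL1_sub]; exact hfix
    have h2 := Integrable.coeFn_toL1 (hG.sub (hS hFi))
    rw [h1] at h2
    exact h2.symm
  refine ⟨F, hFi, ?_, fun x => ?_⟩
  · have : ∫ ξ, ‖F ξ‖ ≤ (∫ ξ, ‖G ξ‖) + ∫ ξ, ‖S F ξ‖ := by
      rw [← integral_add hG.norm (hS hFi).norm]
      refine integral_mono_ae hFi.norm (hG.norm.add (hS hFi).norm) ?_
      filter_upwards [hae] with ξ hξ
      simp only [← hξ]
      exact norm_sub_le _ _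
    linarith [hSn hFi]
  · have h1 : 𝓕 (F : E → ℂ) x = 𝓕 G x - 𝓕 (S F) x := by
      simp only [Real.fourier_eq]
      rw [← integral_sub ((Real.fourierIntegral_convergent_iff x).2 hG)
        ((Real.fourierIntegral_convergent_iff x).2 (hS hFi))]
      refine integral_congr_ae ?_
      filter_upwards [hae] with ξ hξ
      rw [← hξ, smul_sub]
    have h2 : 𝓕 (S F) x = ∑ k, 𝓕 (B k) x * 𝓕 (fun ξ => (m k ξ : ℂ) * F ξ) x := by
      simp_rw [← Real.fourier_mul_convolution_eq (hB _) (hmF _ hFi) x]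
      simp only [Real.fourier_eq, S]
      rw [← integral_finsetSum _ fun k _ => (Real.fourierIntegral_convergent_iff x).2
        ((hB k).integrable_convolution _ (hmF k hFi))]
      simp_rw [Finset.smul_sum]
    rw [h1, h2]; ring

end Neumann

section SecondPrimitive
open scoped FourierTransform RealInnerProductSpace

/-- The second primitive of the character `t ↦ e^{-2πit}` vanishing to second order at `0`. -/
noncomputable def charPrimTwo (t : ℝ) : ℂ :=
  (Complex.exp (-(2 * Real.pi * t * Complex.I)) - 1 + 2 * Real.pi * t * Complex.I) /
    (-(4 * Real.pi ^ 2))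

/-- The primitive of the character `t ↦ e^{-2πit}` vanishing at `0`. -/
noncomputable def charPrimOne (t : ℝ) : ℂ :=
  (1 - Complex.exp (-(2 * Real.pi * t * Complex.I))) / (2 * Real.pi * Complex.I)

/-- The character `t ↦ e^{-2πit}`. -/
noncomputable def charZero (t : ℝ) : ℂ := Complex.exp (-(2 * Real.pi * t * Complex.I))

theorem hasDerivAt_charZero_aux (t : ℝ) :
    HasDerivAt (fun t : ℝ => Complex.exp (-(2 * Real.pi * t * Complex.I)))
      (Complex.exp (-(2 * Real.pi * t * Complex.I)) * (-(2 * Real.pi * Complex.I))) t := by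
  have h1 : HasDerivAt (fun t : ℝ => -(2 * Real.pi * (t : ℂ) * Complex.I))
      (-(2 * Real.pi * Complex.I)) t := by
    have := (((hasDerivAt_id t).ofReal_comp).const_mul (2 * Real.pi : ℂ)).mul_const Complex.I
    rw [Complex.ofReal_one, mul_one] at this
    exact this.neg
  exact h1.cexp

theorem hasDerivAt_charPrimOne (t : ℝ) : HasDerivAt charPrimOne (charZero t) t := by
  have hp : (Real.pi : ℂ) ≠ 0 := by exact_mod_cast Real.pi_ne_zero
  have := ((hasDerivAt_charZero_aux t).const_sub 1).div_const (2 * Real.pi * Complex.I)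
  have e : -(Complex.exp (-(2 * Real.pi * t * Complex.I)) * (-(2 * Real.pi * Complex.I))) /
      (2 * Real.pi * Complex.I) = charZero t := by
    unfold charZero
    field_simp [Complex.I_ne_zero]
  rw [e] at this
  exact this

theorem hasDerivAt_charPrimTwo (t : ℝ) : HasDerivAt charPrimTwo (charPrimOne t) t := by
  have hp : (Real.pi : ℂ) ≠ 0 := by exact_mod_cast Real.pi_ne_zero
  have h2 := (((hasDerivAt_id t).ofReal_comp).const_mul (2 * Real.pi : ℂ)).mul_const Complex.I
  have := (((hasDerivAt_charZero_aux t).sub_const 1).add h2).div_const (-(4 * Real.pi ^ 2 : ℂ))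
  have e : (Complex.exp (-(2 * Real.pi * t * Complex.I)) * (-(2 * Real.pi * Complex.I)) +
      2 * Real.pi * ((1 : ℝ) : ℂ) * Complex.I) / (-(4 * Real.pi ^ 2)) = charPrimOne t := by
    unfold charPrimOne
    rw [div_eq_div_iff (by simp [hp]) (by simp [hp])]
    push_cast
    ring_nf
    simp [Complex.I_sq]
  rw [e] at this
  exact this

theorem norm_charZero (t : ℝ) : ‖charZero t‖ = 1 := by
  unfold charZero
  rw [show -(2 * Real.pi * t * Complex.I) = ((-(2 * Real.pi * t) : ℝ) : ℂ) * Complex.I by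
    push_cast; ring]
  exact Complex.norm_exp_ofReal_mul_I _

theorem norm_charPrimOne_le (t : ℝ) : ‖charPrimOne t‖ ≤ |t| := by
  have := Convex.norm_image_sub_le_of_norm_hasDerivWithin_le (f := charPrimOne) (C := 1)
    (s := Set.univ) (x := 0) (y := t)
    (fun x _ => (hasDerivAt_charPrimOne x).hasDerivWithinAt) (fun x _ => (norm_charZero x).le)
    convex_univ trivial trivial
  simpa [charPrimOne] using this

theorem norm_charPrimTwo_le (t : ℝ) : ‖charPrimTwo t‖ ≤ t ^ 2 := by
  have := Convex.norm_image_sub_le_of_norm_hasDerivWithin_le (f := charPrimTwo) (C := |t|)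
    (s := Set.uIcc 0 t) (x := 0) (y := t)
    (fun x _ => (hasDerivAt_charPrimTwo x).hasDerivWithinAt) (fun x hx =>
      (norm_charPrimOne_le x).trans (by simpa using Set.abs_sub_left_of_mem_uIcc hx))
    (convex_uIcc 0 t) Set.left_mem_uIcc Set.right_mem_uIcc
  simpa [charPrimTwo, ← sq] using this

theorem continuous_charZero : Continuous charZero := by unfold charZero; fun_prop
theorem continuous_charPrimOne : Continuous charPrimOne := by unfold charPrimOne; fun_prop
theorem continuous_charPrimTwo : Continuous charPrimTwo := by unfold charPrimTwo; fun_prop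

variable {E : Type*} [NormedAddCommGroup E] [InnerProductSpace ℝ E] [FiniteDimensional ℝ E]
  [MeasurableSpace E] [BorelSpace E]

set_option maxSynthPendingDepth 3 in
theorem exists_fourier_second_primitive {F : E → ℂ} (hF : Integrable F) {A : E → ℝ}
    (hA : Continuous A) {l : ℝ} (hl : 0 < l) (hAl : ∀ ξ, l * ‖ξ‖ ^ 2 ≤ A ξ) :
    ∃ w : E → ℝ, ContDiff ℝ 2 w ∧ (∀ x, |w x| ≤ ‖x‖ ^ 2 / l * ∫ ξ, ‖F ξ‖) ∧
      ∀ x v v', fderiv ℝ (fderiv ℝ w) x v v' =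
        (𝓕 (fun ξ => ((⟪ξ, v⟫ * ⟪ξ, v'⟫ / A ξ : ℝ) : ℂ) * F ξ) x).re := by
  have hA0 : ∀ ξ, 0 ≤ A ξ := fun ξ => (by positivity : 0 ≤ l * ‖ξ‖ ^ 2).trans (hAl ξ)
  have hAinv : ∀ ξ, ‖ξ‖ ^ 2 / A ξ ≤ 1 / l := by
    intro ξ
    rcases (hA0 ξ).eq_or_lt with h | h
    · rw [← h]; simp [hl.le]
    · rw [div_le_div_iff₀ h hl]; linarith [hAl ξ]
  have hmeas : ∀ (φ : ℝ → ℂ), Continuous φ → ∀ x : E, AEStronglyMeasurable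
      (fun ξ => (F ξ * φ ⟪ξ, x⟫).re / A ξ) volume := by
    intro φ hφ x
    have h1 : AEStronglyMeasurable (fun ξ => (F ξ * φ ⟪ξ, x⟫).re) volume := by
      refine Complex.continuous_re.comp_aestronglyMeasurable (hF.aestronglyMeasurable.mul ?_)
      exact (hφ.comp (by fun_prop)).aestronglyMeasurable
    have h2 : AEMeasurable (fun ξ => (F ξ * φ ⟪ξ, x⟫).re / A ξ) volume :=
      h1.aemeasurable.div hA.measurable.aemeasurable
    exact h2.aestronglyMeasurable
  let k0 : E → E → ℝ := fun x ξ => (F ξ * charPrimTwo ⟪ξ, x⟫).re / A ξ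
  let k1 : E → E → (E →L[ℝ] ℝ) := fun x ξ => ((F ξ * charPrimOne ⟪ξ, x⟫).re / A ξ) • innerSL ℝ ξ
  let k2 : E → E → (E →L[ℝ] E →L[ℝ] ℝ) := fun x ξ =>
    ((F ξ * charZero ⟪ξ, x⟫).re / A ξ) • (innerSL ℝ ξ).smulRight (innerSL ℝ ξ)
  have hm0 : ∀ x, AEStronglyMeasurable (k0 x) volume := hmeas _ continuous_charPrimTwo
  have hm1 : ∀ x, AEStronglyMeasurable (k1 x) volume := fun x =>
    (hmeas _ continuous_charPrimOne x).smul (innerSL ℝ).continuous.aestronglyMeasurable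
  have hc2 : Continuous (fun ξ : E => (innerSL ℝ ξ).smulRight (innerSL ℝ ξ)) := by
    have : Continuous (fun ξ : E => innerSL ℝ ξ) := (innerSL ℝ).continuous
    exact ((ContinuousLinearMap.smulRightL ℝ E (E →L[ℝ] ℝ)).continuous.comp this).clm_apply this
  have hm2 : ∀ x, AEStronglyMeasurable (k2 x) volume := fun x =>
    (hmeas _ continuous_charZero x).smul hc2.aestronglyMeasurable
  have hb0 : ∀ x ξ, ‖k0 x ξ‖ ≤ ‖x‖ ^ 2 / l * ‖F ξ‖ := by
    intro x ξ
    simp only [k0, norm_div, Real.norm_eq_abs, abs_of_nonneg (hA0 ξ)]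
    have h1 : |(F ξ * charPrimTwo ⟪ξ, x⟫).re| ≤ ‖F ξ‖ * (‖ξ‖ ^ 2 * ‖x‖ ^ 2) := by
      refine (Complex.abs_re_le_norm _).trans ?_
      rw [norm_mul]
      refine mul_le_mul_of_nonneg_left ((norm_charPrimTwo_le _).trans ?_) (norm_nonneg _)
      rw [← mul_pow, ← sq_abs]
      exact pow_le_pow_left₀ (abs_nonneg _) (abs_real_inner_le_norm _ _) 2
    calc _ ≤ ‖F ξ‖ * (‖ξ‖ ^ 2 * ‖x‖ ^ 2) / A ξ := div_le_div_of_nonneg_right h1 (hA0 ξ)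
      _ = ‖F ξ‖ * ‖x‖ ^ 2 * (‖ξ‖ ^ 2 / A ξ) := by ring
      _ ≤ ‖F ξ‖ * ‖x‖ ^ 2 * (1 / l) := mul_le_mul_of_nonneg_left (hAinv ξ) (by positivity)
      _ = _ := by ring
  have hb1 : ∀ x ξ, ‖k1 x ξ‖ ≤ ‖x‖ / l * ‖F ξ‖ := by
    intro x ξ
    simp only [k1, norm_smul, norm_div, Real.norm_eq_abs, abs_of_nonneg (hA0 ξ), innerSL_apply_norm]
    have h1 : |(F ξ * charPrimOne ⟪ξ, x⟫).re| ≤ ‖F ξ‖ * (‖ξ‖ * ‖x‖) := by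
      refine (Complex.abs_re_le_norm _).trans ?_
      rw [norm_mul]
      exact mul_le_mul_of_nonneg_left ((norm_charPrimOne_le _).trans
        (abs_real_inner_le_norm _ _)) (norm_nonneg _)
    calc _ ≤ ‖F ξ‖ * (‖ξ‖ * ‖x‖) / A ξ * ‖ξ‖ := mul_le_mul_of_nonneg_right
          (div_le_div_of_nonneg_right h1 (hA0 ξ)) (norm_nonneg _)
      _ = ‖F ξ‖ * ‖x‖ * (‖ξ‖ ^ 2 / A ξ) := by ring
      _ ≤ ‖F ξ‖ * ‖x‖ * (1 / l) := mul_le_mul_of_nonneg_left (hAinv ξ) (by positivity)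
      _ = _ := by ring
  have hb2 : ∀ x ξ, ‖k2 x ξ‖ ≤ 1 / l * ‖F ξ‖ := by
    intro x ξ
    simp only [k2, norm_smul, norm_div, Real.norm_eq_abs, abs_of_nonneg (hA0 ξ),
      ContinuousLinearMap.norm_smulRight_apply, innerSL_apply_norm]
    have h1 : |(F ξ * charZero ⟪ξ, x⟫).re| ≤ ‖F ξ‖ := by
      refine (Complex.abs_re_le_norm _).trans ?_
      rw [norm_mul, norm_charZero, mul_one]
    calc _ ≤ ‖F ξ‖ / A ξ * (‖ξ‖ * ‖ξ‖) := mul_le_mul_of_nonneg_right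
          (div_le_div_of_nonneg_right h1 (hA0 ξ)) (by positivity)
      _ = ‖F ξ‖ * (‖ξ‖ ^ 2 / A ξ) := by ring
      _ ≤ ‖F ξ‖ * (1 / l) := mul_le_mul_of_nonneg_left (hAinv ξ) (by positivity)
      _ = _ := by ring
  have hi0 : ∀ x, Integrable (k0 x) := fun x =>
    (hF.norm.const_mul _).mono' (hm0 x) (Eventually.of_forall (hb0 x))
  have hi1 : ∀ x, Integrable (k1 x) := fun x =>
    (hF.norm.const_mul _).mono' (hm1 x) (Eventually.of_forall (hb1 x))
  have hi2 : ∀ x, Integrable (k2 x) := fun x =>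
    (hF.norm.const_mul _).mono' (hm2 x) (Eventually.of_forall (hb2 x))
  have hinner : ∀ ξ x : E, HasFDerivAt (fun x : E => ⟪ξ, x⟫) (innerSL ℝ ξ) x := fun ξ x =>
    (innerSL ℝ ξ).hasFDerivAt
  have hre : ∀ {φ : ℝ → ℂ} {φ' : ℂ} (c : ℂ) (t : ℝ), HasDerivAt φ φ' t →
      HasDerivAt (fun t => (c * φ t).re) (c * φ').re t := by
    intro φ φ' c t h
    exact (Complex.reCLM.hasFDerivAt.comp_hasDerivAt t (h.const_mul c))
  have hd0 : ∀ ξ x, HasFDerivAt (fun x => k0 x ξ) (k1 x ξ) x := by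
    intro ξ x
    have h1 := ((hre (F ξ) _ (hasDerivAt_charPrimTwo ⟪ξ, x⟫)).div_const (A ξ)).comp_hasFDerivAt x
      (hinner ξ x)
    exact h1
  have hd1 : ∀ ξ x, HasFDerivAt (fun x => k1 x ξ) (k2 x ξ) x := by
    intro ξ x
    have h1 := ((hre (F ξ) _ (hasDerivAt_charPrimOne ⟪ξ, x⟫)).div_const (A ξ)).comp_hasFDerivAt x
      (hinner ξ x)
    have h2 := h1.smul_const (innerSL ℝ ξ)
    refine h2.congr_fderiv ?_
    ext v v'
    simp [k2, mul_assoc]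
  let w : E → ℝ := fun x => ∫ ξ, k0 x ξ
  have hw : ∀ x, HasFDerivAt w (∫ ξ, k1 x ξ) x := by
    intro x
    refine hasFDerivAt_integral_of_dominated_of_fderiv_le (F' := k1)
      (bound := fun ξ => (‖x‖ + 1) / l * ‖F ξ‖)
      (Metric.ball_mem_nhds x one_pos) (Eventually.of_forall hm0) (hi0 x) (hm1 x)
      (Eventually.of_forall fun ξ y hy => (hb1 y ξ).trans ?_) (hF.norm.const_mul _)
      (Eventually.of_forall fun ξ y _ => hd0 ξ y)
    have : ‖y‖ ≤ ‖x‖ + 1 := by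
      have := norm_add_le x (y - x)
      rw [mem_ball_iff_norm] at hy
      simp only [add_sub_cancel] at this
      linarith
    gcongr
  have hw' : ∀ x, HasFDerivAt (fun x => ∫ ξ, k1 x ξ) (∫ ξ, k2 x ξ) x := by
    intro x
    exact hasFDerivAt_integral_of_dominated_of_fderiv_le (F' := k2)
      (bound := fun ξ => 1 / l * ‖F ξ‖)
      (Metric.ball_mem_nhds x one_pos) (Eventually.of_forall hm1) (hi1 x) (hm2 x)
      (Eventually.of_forall fun ξ y hy => (hb2 y ξ)) (hF.norm.const_mul _)
      (Eventually.of_forall fun ξ y _ => hd1 ξ y)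
  have hcont : Continuous (fun x => ∫ ξ, k2 x ξ) := by
    refine continuous_of_dominated hm2 (fun x => Eventually.of_forall (hb2 x))
      (hF.norm.const_mul _) (Eventually.of_forall fun ξ => ?_)
    refine Continuous.smul (M := ℝ) (f := fun x => (F ξ * charZero ⟪ξ, x⟫).re / A ξ) ?_
      continuous_const
    refine Continuous.div_const (Complex.continuous_re.comp (continuous_const.mul ?_)) _
    exact continuous_charZero.comp (by fun_prop)
  have e1 : fderiv ℝ w = fun x => ∫ ξ, k1 x ξ := funext fun x => (hw x).fderiv
  have e2 : fderiv ℝ (fderiv ℝ w) = fun x => ∫ ξ, k2 x ξ := by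
    rw [e1]; exact funext fun x => (hw' x).fderiv
  refine ⟨w, ?_, fun x => ?_, fun x v v' => ?_⟩
  · have h1 : ContDiff ℝ 1 (fderiv ℝ w) := by
      rw [contDiff_one_iff_fderiv]
      refine ⟨fun x => ?_, by rw [e2]; exact hcont⟩
      rw [e1]; exact (hw' x).differentiableAt
    exact (contDiff_succ_iff_fderiv (n := 1)).2
      ⟨fun x => (hw x).differentiableAt, by simp, h1⟩
  · rw [← integral_const_mul]
    exact norm_integral_le_of_norm_le (hF.norm.const_mul _) (Eventually.of_forall (hb0 x))
  · rw [e2]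
    simp only
    rw [ContinuousLinearMap.integral_apply (hi2 x),
      ContinuousLinearMap.integral_apply ((hi2 x).apply_continuousLinearMap v), Real.fourier_eq]
    have hint : Integrable (fun ξ => ((⟪ξ, v⟫ * ⟪ξ, v'⟫ / A ξ : ℝ) : ℂ) * F ξ) := by
      refine (hF.norm.const_mul (‖v‖ * ‖v'‖ * (1 / l))).mono' ?_ (Eventually.of_forall fun ξ => ?_)
      · have : Measurable (fun ξ => ((⟪ξ, v⟫ * ⟪ξ, v'⟫ / A ξ : ℝ) : ℂ)) := by
          refine Complex.measurable_ofReal.comp (Measurable.div ?_ hA.measurable)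
          exact Continuous.measurable (by fun_prop)
        exact this.aestronglyMeasurable.mul hF.aestronglyMeasurable
      · rw [norm_mul, Complex.norm_real, norm_div, norm_mul, Real.norm_of_nonneg (hA0 ξ)]
        refine mul_le_mul_of_nonneg_right ?_ (norm_nonneg _)
        calc _ ≤ (‖ξ‖ * ‖v‖) * (‖ξ‖ * ‖v'‖) / A ξ := by
              have := hA0 ξ
              gcongr <;> exact norm_inner_le_norm _ _
          _ = ‖v‖ * ‖v'‖ * (‖ξ‖ ^ 2 / A ξ) := by ring
          _ ≤ _ := mul_le_mul_of_nonneg_left (hAinv ξ) (by positivity)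
    have h3 := integral_re ((Real.fourierIntegral_convergent_iff x).2 hint)
    simp only [RCLike.re_to_complex] at h3
    rw [← h3]
    congr 1; ext ξ
    simp only [k2, _root_.smul_apply, ContinuousLinearMap.smulRight_apply,
      innerSL_apply_apply, smul_eq_mul]
    rw [Circle.smul_def, smul_eq_mul, Real.fourierChar_apply]
    have : Complex.exp (↑(2 * Real.pi * -⟪ξ, x⟫) * Complex.I) = charZero ⟪ξ, x⟫ := by
      unfold charZero; congr 1; push_cast; ring
    rw [this, show charZero ⟪ξ, x⟫ * (((⟪ξ, v⟫ * ⟪ξ, v'⟫ / A ξ : ℝ) : ℂ) * F ξ) =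
      ((⟪ξ, v⟫ * ⟪ξ, v'⟫ / A ξ : ℝ) : ℂ) * (F ξ * charZero ⟪ξ, x⟫) by ring, Complex.re_ofReal_mul]
    ring

end SecondPrimitive

section LocalSolution
open scoped FourierTransform RealInnerProductSpace

variable {E : Type*} [NormedAddCommGroup E] [InnerProductSpace ℝ E] [FiniteDimensional ℝ E]
  [MeasurableSpace E] [BorelSpace E]

theorem eventually_exists_perturbed_solution {ι : Type*} [Fintype ι] (e : ι → E)
    {a : ι → ι → E → ℝ} (ha : ∀ k l, ContDiff ℝ ((⊤ : ℕ∞) : WithTop ℕ∞) (a k l)) {c : ℝ}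
    (hc : 0 < c) (hell : ∀ ξ, c * ‖ξ‖ ^ 2 ≤ ∑ k, ∑ l, a k l 0 * (⟪ξ, e k⟫ * ⟪ξ, e l⟫))
    {Q : ι → ι → ℝ} (hQ : ∑ k, ∑ l, a k l 0 * Q k l = 0) {ρ ε : ℝ} (hρ : 0 < ρ) (hε : 0 < ε) :
    ∀ᶠ r in 𝓝 (0 : ℝ), ∃ w : E → ℝ, ContDiff ℝ 2 w ∧ (∀ x, ‖x‖ ≤ ρ → |w x| ≤ ε) ∧
      ∀ x, ‖x‖ ≤ ρ →
        ∑ k, ∑ l, a k l (r • x) * (Q k l + fderiv ℝ (fderiv ℝ w) x (e k) (e l)) = 0 := by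
  rcases subsingleton_or_nontrivial E with hE | hE
  · refine Eventually.of_forall fun r => ⟨fun _ => 0, contDiff_const, by simp [hε.le],
      fun x _ => ?_⟩
    simp only [Subsingleton.elim (r • x) 0, fderiv_fun_const, Pi.zero_def]
    simpa using hQ
  let A : E → ℝ := fun ξ => ∑ k, ∑ l, a k l 0 * (⟪ξ, e k⟫ * ⟪ξ, e l⟫)
  have hA : Continuous A := by fun_prop
  let m : ι × ι → E → ℝ := fun p ξ => ⟪ξ, e p.1⟫ * ⟪ξ, e p.2⟫ / A ξ
  have hA0 : ∀ ξ, 0 ≤ A ξ := fun ξ => (by positivity : 0 ≤ c * ‖ξ‖ ^ 2).trans (hell ξ)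
  let S : ℝ := ∑ p : ι × ι, ‖e p.1‖ * ‖e p.2‖ / c
  have hS0 : 0 ≤ S := Finset.sum_nonneg fun p _ => by positivity
  have hmS : ∀ p ξ, |m p ξ| ≤ S := by
    intro p ξ
    have h1 : |m p ξ| ≤ ‖e p.1‖ * ‖e p.2‖ / c := by
      simp only [m, abs_div, abs_of_nonneg (hA0 ξ)]
      rcases (hA0 ξ).eq_or_lt with h | h
      · rw [← h]; simp only [div_zero]; positivity
      · rw [div_le_div_iff₀ h hc]
        have h2 : |⟪ξ, e p.1⟫ * ⟪ξ, e p.2⟫| ≤ (‖ξ‖ * ‖e p.1‖) * (‖ξ‖ * ‖e p.2‖) := by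
          rw [abs_mul]
          gcongr <;> exact abs_real_inner_le_norm _ _
        calc _ ≤ (‖ξ‖ * ‖e p.1‖) * (‖ξ‖ * ‖e p.2‖) * c := by gcongr
          _ = ‖e p.1‖ * ‖e p.2‖ * (c * ‖ξ‖ ^ 2) := by ring
          _ ≤ _ := by gcongr; exact hell ξ
    exact h1.trans (Finset.single_le_sum (f := fun p : ι × ι => ‖e p.1‖ * ‖e p.2‖ / c)
      (fun p _ => by positivity) (Finset.mem_univ p))
  have hm : ∀ p, Measurable (m p) := fun p =>
    (Continuous.measurable (by fun_prop)).div hA.measurable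
  let χ : ContDiffBump (0 : E) := ⟨ρ, ρ + 1, hρ, by linarith⟩
  let b : ι × ι → ℝ → E → ℂ := fun p r x => ((χ x * (a p.1 p.2 (r • x) - a p.1 p.2 0) : ℝ) : ℂ)
  have hb : ∀ p, ContDiff ℝ ((⊤ : ℕ∞) : WithTop ℕ∞) (fun q : ℝ × E => b p q.1 q.2) := by
    intro p
    refine Complex.ofRealCLM.contDiff.comp ?_
    refine (χ.contDiff.comp contDiff_snd).mul (ContDiff.sub ?_ contDiff_const)
    exact (ha p.1 p.2).comp (contDiff_fst.smul contDiff_snd)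
  have hbR : ∀ p r x, ρ + 1 < ‖x‖ → b p r x = 0 := by
    intro p r x hx
    have : χ x = 0 := χ.zero_of_le_dist (by simpa using hx.le)
    simp [b, this]
  have hb0 : ∀ p x, b p 0 x = 0 := by intro p x; simp [b]
  let N : ℝ := Fintype.card (ι × ι)
  let QS : ℝ := ∑ p : ι × ι, |Q p.1 p.2|
  have hQS : 0 ≤ QS := Finset.sum_nonneg fun p _ => abs_nonneg _
  have hN : 0 ≤ N := Nat.cast_nonneg _
  obtain ⟨η, hη, hη1, hη2⟩ : ∃ η > 0, S * (N * η) ≤ 1 / 2 ∧ ρ ^ 2 / c * (2 * (QS * η)) ≤ ε := by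
    have h1 : ∀ᶠ η in 𝓝 (0 : ℝ), S * (N * η) < 1 / 2 :=
      (by fun_prop : Continuous fun η : ℝ => S * (N * η)).continuousAt.eventually_lt_const
        (by simp)
    have h2 : ∀ᶠ η in 𝓝 (0 : ℝ), ρ ^ 2 / c * (2 * (QS * η)) < ε :=
      (by fun_prop : Continuous fun η : ℝ => ρ ^ 2 / c * (2 * (QS * η))).continuousAt.eventually_lt_const
        (by simpa using hε)
    obtain ⟨η, ⟨h1, h2⟩, h3⟩ := (((h1.and h2).filter_mono nhdsWithin_le_nhds).and
      (self_mem_nhdsWithin (s := Set.Ioi (0 : ℝ)))).exists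
    exact ⟨η, h3, h1.le, h2.le⟩
  filter_upwards [eventually_all.2 fun p =>
    eventually_integral_norm_fourier_le (hb p) (hbR p) (hb0 p) hη] with r hr
  have hbc : ∀ p, Continuous (b p r) := fun p =>
    (hb p).continuous.comp (continuous_const.prodMk continuous_id)
  have hbi : ∀ p, Integrable (b p r) := fun p => by
    refine (hbc p).integrable_of_hasCompactSupport
      (HasCompactSupport.intro (isCompact_closedBall (0 : E) (ρ + 1)) fun x hx => ?_)
    exact hbR p r x (by simpa using hx)
  let B : ι × ι → E → ℂ := fun p => 𝓕⁻ (b p r)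
  have hBneg : ∀ p, B p = fun ξ => 𝓕 (b p r) (-ξ) := fun p =>
    funext fun ξ => Real.fourierInv_eq_fourier_neg _ _
  have hBi : ∀ p, Integrable (B p) := fun p => by
    rw [hBneg]; exact (hr p).1.comp_neg
  have hBn : ∀ p, ∫ ξ, ‖B p ξ‖ ≤ η := fun p => by
    rw [hBneg]
    rw [integral_neg_eq_self (fun ξ => ‖𝓕 (b p r) ξ‖)]
    exact (hr p).2
  have hFB : ∀ p, 𝓕 (B p) = b p r := fun p =>
    (hbc p).fourier_fourierInv_eq (hbi p) (hr p).1
  let G : E → ℂ := fun ξ => ∑ p : ι × ι, (-(Q p.1 p.2 : ℂ)) * B p ξ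
  have hGi : Integrable G := integrable_finsetSum _ fun p _ => (hBi p).const_mul _
  have hGn : ∫ ξ, ‖G ξ‖ ≤ QS * η := by
    calc ∫ ξ, ‖G ξ‖ ≤ ∫ ξ, ∑ p : ι × ι, |Q p.1 p.2| * ‖B p ξ‖ := by
          refine integral_mono hGi.norm
            (integrable_finsetSum _ fun p _ => (hBi p).norm.const_mul _) fun ξ => ?_
          refine (norm_sum_le _ _).trans (le_of_eq (Finset.sum_congr rfl fun p _ => ?_))
          simp
      _ = ∑ p : ι × ι, |Q p.1 p.2| * ∫ ξ, ‖B p ξ‖ := by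
          rw [integral_finsetSum _ fun p _ => (hBi p).norm.const_mul _]
          simp_rw [integral_const_mul]
      _ ≤ ∑ p : ι × ι, |Q p.1 p.2| * η :=
          Finset.sum_le_sum fun p _ => mul_le_mul_of_nonneg_left (hBn p) (abs_nonneg _)
      _ = _ := by rw [← Finset.sum_mul]
  have hsm : S * ∑ p, ∫ ξ, ‖B p ξ‖ ≤ 1 / 2 := by
    refine le_trans (mul_le_mul_of_nonneg_left ?_ hS0) hη1
    refine (Finset.sum_le_sum fun p _ => hBn p).trans (le_of_eq ?_)
    simp [N]
  obtain ⟨F, hF, hFn, hFeq⟩ := exists_fourier_neumann hBi hm hmS hGi hsm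
  obtain ⟨w, hw, hwn, hwD⟩ := exists_fourier_second_primitive hF hA hc hell
  refine ⟨w, hw, fun x hx => ?_, fun x hx => ?_⟩
  · refine (hwn x).trans (le_trans ?_ hη2)
    have h0 : 0 ≤ ∫ ξ, ‖F ξ‖ := integral_nonneg fun _ => norm_nonneg _
    have h1 : ∫ ξ, ‖F ξ‖ ≤ 2 * (QS * η) := by linarith
    gcongr
  · have hmF : ∀ p, Integrable (fun ξ => (m p ξ : ℂ) * F ξ) := fun p =>
      hF.bdd_mul (c := S) (Complex.measurable_ofReal.comp (hm p)).aestronglyMeasurable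
        (Eventually.of_forall fun ξ => by simpa using hmS p ξ)
    have h1 : ∑ p : ι × ι, (a p.1 p.2 0 : ℂ) * 𝓕 (fun ξ => (m p ξ : ℂ) * F ξ) x = 𝓕 F x := by
      simp only [Real.fourier_eq]
      simp_rw [← integral_const_mul]
      rw [← integral_finsetSum _ fun p _ =>
        ((Real.fourierIntegral_convergent_iff x).2 (hmF p)).const_mul _]
      refine integral_congr_ae ?_
      have hne : ∀ᵐ ξ : E, ξ ≠ 0 := by
        simp [ae_iff]
      filter_upwards [hne] with ξ hξ
      have hAp : 0 < A ξ := lt_of_lt_of_le (by positivity) (hell ξ)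
      have : ∑ p : ι × ι, (a p.1 p.2 0) * m p ξ = 1 := by
        rw [Fintype.sum_prod_type]
        simp only [m, ← mul_div_assoc, ← Finset.sum_div]
        exact div_self hAp.ne'
      have h2 : ∑ p : ι × ι, ((a p.1 p.2 0 : ℝ) : ℂ) * (m p ξ : ℂ) = 1 := by
        exact_mod_cast this
      calc _ = (∑ p : ι × ι, ((a p.1 p.2 0 : ℝ) : ℂ) * (m p ξ : ℂ)) *
            (Real.fourierChar (-⟪ξ, x⟫) • F ξ) := by
            rw [Finset.sum_mul]
            refine Finset.sum_congr rfl fun p _ => ?_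
            simp only [Circle.smul_def, smul_eq_mul]; ring
        _ = _ := by rw [h2, one_mul]
    have hG : 𝓕 G x = ∑ p : ι × ι, (-(Q p.1 p.2 : ℂ)) * b p r x := by
      simp_rw [← hFB]
      simp only [Real.fourier_eq, G, Finset.smul_sum]
      rw [integral_finsetSum _ fun p _ =>
        (Real.fourierIntegral_convergent_iff x).2 ((hBi p).const_mul _)]
      refine Finset.sum_congr rfl fun p _ => ?_
      rw [← integral_const_mul]
      congr 1; ext ξ
      simp only [Circle.smul_def, smul_eq_mul]; ring
    have hχ : χ x = 1 := χ.one_of_mem_closedBall (by simpa using hx)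
    have hbx : ∀ p, b p r x = ((a p.1 p.2 (r • x) - a p.1 p.2 0 : ℝ) : ℂ) := by
      intro p; simp [b, hχ]
    have h3 := hFeq x
    rw [hG, ← h1] at h3
    simp only [hFB, hbx] at h3
    have h4 := congrArg Complex.re h3
    simp only [Complex.add_re, Complex.re_sum, Complex.re_ofReal_mul, ← Complex.ofReal_neg,
      Complex.ofReal_re] at h4
    have h5 : ∀ p : ι × ι, fderiv ℝ (fderiv ℝ w) x (e p.1) (e p.2) =
        (𝓕 (fun ξ => (m p ξ : ℂ) * F ξ) x).re := fun p => hwD x _ _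
    simp only [← h5] at h4
    rw [← Fintype.sum_prod_type'] at hQ ⊢
    have h6 : ∑ p : ι × ι, a p.1 p.2 (r • x) *
        (Q p.1 p.2 + fderiv ℝ (fderiv ℝ w) x (e p.1) (e p.2)) =
        (∑ p : ι × ι, a p.1 p.2 0 * Q p.1 p.2) +
        ((∑ p : ι × ι, a p.1 p.2 0 * fderiv ℝ (fderiv ℝ w) x (e p.1) (e p.2)) +
          ∑ p : ι × ι, (a p.1 p.2 (r • x) - a p.1 p.2 0) *
            fderiv ℝ (fderiv ℝ w) x (e p.1) (e p.2)) -
        ∑ p : ι × ι, -Q p.1 p.2 * (a p.1 p.2 (r • x) - a p.1 p.2 0) := by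
      rw [← Finset.sum_add_distrib, ← Finset.sum_add_distrib, ← Finset.sum_sub_distrib]
      refine Finset.sum_congr rfl fun p _ => ?_
      ring
    rw [h6, h4, hQ]
    simp

end LocalSolution

section Viscosity
open scoped RealInnerProductSpace

set_option maxSynthPendingDepth 3 in
theorem eventually_abs_sub_taylor_two_le {E : Type*} [NormedAddCommGroup E] [NormedSpace ℝ E]
    {ψ : E → ℝ} (hψ : ContDiff ℝ 2 ψ) (p : E) {ε : ℝ} (hε : 0 < ε) :
    ∀ᶠ x in 𝓝 p, |ψ x - (ψ p + fderiv ℝ ψ p (x - p) +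
      2⁻¹ * fderiv ℝ (fderiv ℝ ψ) p (x - p) (x - p))| ≤ ε * ‖x - p‖ ^ 2 := by
  have hd1 : ContDiff ℝ 1 (fderiv ℝ ψ) := hψ.fderiv_right (by norm_num)
  have hdd : HasFDerivAt (fderiv ℝ ψ) (fderiv ℝ (fderiv ℝ ψ) p) p :=
    (hd1.differentiable (by norm_num) p).hasFDerivAt
  have hsym : IsSymmSndFDerivAt ℝ ψ p :=
    hψ.contDiffAt.isSymmSndFDerivAt (by simp)
  set S := fderiv ℝ (fderiv ℝ ψ) p with hS
  have hg : ∀ x, HasFDerivAt (fun x => ψ x - (ψ p + fderiv ℝ ψ p (x - p) +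
      2⁻¹ * S (x - p) (x - p))) (fderiv ℝ ψ x - fderiv ℝ ψ p - S (x - p)) x := by
    intro x
    have h0 : HasFDerivAt ψ (fderiv ℝ ψ x) x :=
      (hψ.differentiable (by norm_num) x).hasFDerivAt
    have hs : HasFDerivAt (fun x : E => x - p) (ContinuousLinearMap.id ℝ E) x :=
      (hasFDerivAt_id x).sub_const p
    have h1 : HasFDerivAt (fun x => fderiv ℝ ψ p (x - p)) _ x :=
      (fderiv ℝ ψ p).hasFDerivAt.comp x hs
    have h2 : HasFDerivAt (fun x => S (x - p)) _ x := S.hasFDerivAt.comp x hs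
    have h3 := (h2.clm_apply hs).const_mul (2⁻¹ : ℝ)
    refine (h0.sub ((h1.const_add (ψ p)).add h3)).congr_fderiv ?_
    ext v
    have : S v (x - p) = S (x - p) v := hsym v (x - p)
    simp only [map_sub, sub_apply] at this
    simp
    linarith
  have hlit := hdd.isLittleO.def hε
  obtain ⟨δ, hδ, hδb⟩ := Metric.eventually_nhds_iff_ball.1 hlit
  refine Metric.eventually_nhds_iff_ball.2 ⟨δ, hδ, fun x hx => ?_⟩
  have hsub : Metric.closedBall p ‖x - p‖ ⊆ Metric.ball p δ := by
    rw [← dist_eq_norm]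
    exact Metric.closedBall_subset_ball (Metric.mem_ball.1 hx)
  have := Convex.norm_image_sub_le_of_norm_hasFDerivWithin_le (C := ε * ‖x - p‖)
    (s := Metric.closedBall p ‖x - p‖) (x := p) (y := x)
    (fun y _ => (hg y).hasFDerivWithinAt) (fun y hy => (hδb y (hsub hy)).trans ?_)
    (convex_closedBall _ _) (by simp) (by simp [dist_eq_norm])
  · simpa [sq, mul_assoc] using this
  · have : ‖y - p‖ ≤ ‖x - p‖ := by simpa [dist_eq_norm] using hy
    gcongr

set_option maxSynthPendingDepth 3 in
theorem fderiv_fderiv_quadratic_add_rescale {E : Type*} [NormedAddCommGroup E] [NormedSpace ℝ E]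
    (p : E) (C : ℝ) (ℓ : E →L[ℝ] ℝ) (S : E →L[ℝ] E →L[ℝ] ℝ) {w : E → ℝ} (hw : ContDiff ℝ 2 w)
    {r : ℝ} (hr : r ≠ 0) (x v v' : E) :
    fderiv ℝ (fderiv ℝ (fun x => C + ℓ (x - p) + S (x - p) (x - p) +
      r ^ 2 * w (r⁻¹ • (x - p)))) x v v' =
      S v v' + S v' v + fderiv ℝ (fderiv ℝ w) (r⁻¹ • (x - p)) v v' := by
  have hd1 : ContDiff ℝ 1 (fderiv ℝ w) := hw.fderiv_right (by norm_num)
  have hs : ∀ x, HasFDerivAt (fun x : E => x - p) (ContinuousLinearMap.id ℝ E) x := fun x =>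
    (hasFDerivAt_id x).sub_const p
  have hsr : ∀ x, HasFDerivAt (fun x : E => r⁻¹ • (x - p)) (r⁻¹ • ContinuousLinearMap.id ℝ E) x :=
    fun x => (hs x).const_smul r⁻¹
  have h1 : fderiv ℝ (fun x => C + ℓ (x - p) + S (x - p) (x - p) + r ^ 2 * w (r⁻¹ • (x - p))) =
      fun x => ℓ + S (x - p) + S.flip (x - p) + r • fderiv ℝ w (r⁻¹ • (x - p)) := by
    ext1 x
    have a1 : HasFDerivAt (fun x => ℓ (x - p)) _ x := ℓ.hasFDerivAt.comp x (hs x)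
    have a2 : HasFDerivAt (fun x => S (x - p)) _ x := S.hasFDerivAt.comp x (hs x)
    have a3 := a2.clm_apply (hs x)
    have a4 : HasFDerivAt (fun x => w (r⁻¹ • (x - p))) _ x :=
      ((hw.differentiable (by norm_num) (r⁻¹ • (x - p))).hasFDerivAt).comp x (hsr x)
    refine HasFDerivAt.fderiv ((((a1.const_add C).add a3).add
      (a4.const_mul (r ^ 2))).congr_fderiv ?_)
    ext v
    simp
    field_simp
    ring
  rw [h1]
  have b2 : HasFDerivAt (fun x => S (x - p)) _ x := S.hasFDerivAt.comp x (hs x)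
  have b3 : HasFDerivAt (fun x => S.flip (x - p)) _ x := S.flip.hasFDerivAt.comp x (hs x)
  have b4 : HasFDerivAt (fun x => fderiv ℝ w (r⁻¹ • (x - p))) _ x :=
    ((hd1.differentiable (by norm_num) (r⁻¹ • (x - p))).hasFDerivAt).comp x (hsr x)
  have b5 : HasFDerivAt (fun x => ℓ + S (x - p) + S.flip (x - p) +
      r • fderiv ℝ w (r⁻¹ • (x - p))) _ x := ((b2.const_add ℓ).add b3).add (b4.const_smul r)
  rw [HasFDerivAt.fderiv b5]
  simp
  field_simp

variable {ι : Type*} [Fintype ι] [DecidableEq ι]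

/-- The second order operator `h ↦ ∑ a_kl ∂_k ∂_l h` on Euclidean space. -/
noncomputable def nondivOp (a : ι → ι → EuclideanSpace ℝ ι → ℝ) (h : EuclideanSpace ℝ ι → ℝ)
    (x : EuclideanSpace ℝ ι) : ℝ :=
  ∑ k, ∑ l, a k l x * fderiv ℝ (fderiv ℝ h) x (EuclideanSpace.single k 1)
    (EuclideanSpace.single l 1)

theorem nondivOp_nonneg_of_touching {a : ι → ι → EuclideanSpace ℝ ι → ℝ}
    (ha : ∀ k l, ContDiff ℝ ((⊤ : ℕ∞) : WithTop ℕ∞) (a k l)) {c : ℝ} (hc : 0 < c)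
    {W : Set (EuclideanSpace ℝ ι)} (hW : IsOpen W) {u : EuclideanSpace ℝ ι → EReal}
    (hmax : ∀ p r, 0 < r → Metric.closedBall p r ⊆ W → ∀ h : EuclideanSpace ℝ ι → ℝ,
      ContDiff ℝ 2 h → (∀ x ∈ Metric.ball p r, nondivOp a h x = 0) →
      (∀ x ∈ Metric.sphere p r, u x ≤ h x) → u p ≤ h p)
    {p : EuclideanSpace ℝ ι} (hp : p ∈ W)
    (hell : ∀ ξ : EuclideanSpace ℝ ι, c * ‖ξ‖ ^ 2 ≤ ∑ k, ∑ l, a k l p * (ξ k * ξ l))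
    {ψ : EuclideanSpace ℝ ι → ℝ} (hψ : ContDiff ℝ 2 ψ) (hpψ : u p = ψ p)
    (hle : ∀ᶠ x in 𝓝 p, u x ≤ ψ x) : 0 ≤ nondivOp a ψ p := by
  by_contra! hneg
  have hakk : ∀ k, c ≤ a k k p := by
    intro k
    have := hell (EuclideanSpace.single k 1)
    simpa [Pi.single_apply, ite_and] using this
  have hne : Nonempty ι := by
    by_contra hemp
    rw [not_nonempty_iff] at hemp
    simp [nondivOp] at hneg
  set t := ∑ k, a k k p with ht
  have ht0 : 0 < t := Finset.sum_pos (fun k _ => hc.trans_le (hakk k)) Finset.univ_nonempty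
  set κ := -nondivOp a ψ p / (2 * t) with hκ
  have hκ0 : 0 < κ := div_pos (by linarith) (by linarith)
  have hsym : IsSymmSndFDerivAt ℝ ψ p :=
    hψ.contDiffAt.isSymmSndFDerivAt (by simp)
  let S : EuclideanSpace ℝ ι →L[ℝ] EuclideanSpace ℝ ι →L[ℝ] ℝ :=
    (2⁻¹ : ℝ) • fderiv ℝ (fderiv ℝ ψ) p +
      κ • ∑ k, (EuclideanSpace.proj k : EuclideanSpace ℝ ι →L[ℝ] ℝ).smulRight
        (EuclideanSpace.proj k : EuclideanSpace ℝ ι →L[ℝ] ℝ)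
  have hSv : ∀ x y, S x y = 2⁻¹ * fderiv ℝ (fderiv ℝ ψ) p x y + κ * ∑ k, x k * y k := by
    intro x y
    simp [S]
  let Q : ι → ι → ℝ := fun k l => S (EuclideanSpace.single k 1) (EuclideanSpace.single l 1) +
    S (EuclideanSpace.single l 1) (EuclideanSpace.single k 1)
  have hQv : ∀ k l, Q k l = fderiv ℝ (fderiv ℝ ψ) p (EuclideanSpace.single k 1)
      (EuclideanSpace.single l 1) + if k = l then 2 * κ else 0 := by
    intro k l
    have h1 := hsym (EuclideanSpace.single k 1) (EuclideanSpace.single l 1)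
    simp only [Q, hSv, ← h1]
    by_cases h : k = l
    · subst h; simp; ring
    · simp [h, Ne.symm h]; ring
  have hQ : ∑ k, ∑ l, a k l (p + 0) * Q k l = 0 := by
    simp only [hQv, mul_add, Finset.sum_add_distrib, add_zero]
    have : ∑ k, ∑ l, a k l p * (if k = l then 2 * κ else 0) = 2 * κ * t := by
      simp [ht, ← Finset.sum_mul, mul_comm]
    rw [this]
    change nondivOp a ψ p + _ = 0
    rw [hκ]; field_simp; ring
  have hev := eventually_exists_perturbed_solution (fun k => EuclideanSpace.single k (1 : ℝ))
    (a := fun k l y => a k l (p + y)) (fun k l => (ha k l).comp (contDiff_const.add contDiff_id))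
    hc (by simpa [EuclideanSpace.inner_single_right] using hell) hQ (ρ := 1) (ε := κ / 4)
      one_pos (by positivity)
  have htay := eventually_abs_sub_taylor_two_le hψ p (ε := κ / 4) (by positivity)
  obtain ⟨δ, hδ, hδb⟩ := Metric.eventually_nhds_iff_ball.1
    ((htay.and hle).and (hW.mem_nhds hp))
  have hrev : ∀ᶠ r in 𝓝[>] (0 : ℝ), r < δ := nhdsWithin_le_nhds (gt_mem_nhds hδ)
  obtain ⟨r, ⟨⟨w, hw, hwb, hweq⟩, hrδ⟩, hr0⟩ :=
    (((hev.filter_mono nhdsWithin_le_nhds).and hrev).and self_mem_nhdsWithin).exists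
  replace hr0 : 0 < r := hr0
  have hballsub : Metric.closedBall p r ⊆ Metric.ball p δ := Metric.closedBall_subset_ball hrδ
  let H : EuclideanSpace ℝ ι → ℝ := fun x => (ψ p - κ / 2 * r ^ 2) + fderiv ℝ ψ p (x - p) +
    S (x - p) (x - p) + r ^ 2 * w (r⁻¹ • (x - p))
  have hH : ContDiff ℝ 2 H := by
    have hs : ContDiff ℝ 2 (fun x : EuclideanSpace ℝ ι => x - p) := contDiff_id.sub contDiff_const
    refine ((contDiff_const.add ((fderiv ℝ ψ p).contDiff.comp hs)).add ?_).add
      (contDiff_const.mul (hw.comp (hs.const_smul r⁻¹)))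
    exact (S.contDiff.comp hs).clm_apply hs
  have hfin := hmax p r hr0 (fun x hx => (hδb x (hballsub hx)).2) H hH ?_ ?_
  · rw [hpψ] at hfin
    have h1 : ψ p ≤ H p := by exact_mod_cast hfin
    have h2 := hwb 0 (by simp)
    simp only [H, sub_self, map_zero, smul_zero, add_zero] at h1
    have h3 := (abs_le.1 h2).2
    have : 0 < κ * r ^ 2 := by positivity
    nlinarith [sq_nonneg r]
  · intro x hx
    have hx' : ‖r⁻¹ • (x - p)‖ ≤ 1 := by
      rw [norm_smul, norm_inv, Real.norm_of_nonneg hr0.le, inv_mul_le_iff₀ hr0, mul_one]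
      rw [Metric.mem_ball, dist_eq_norm] at hx
      exact hx.le
    have := hweq _ hx'
    simp only [smul_smul, mul_inv_cancel₀ hr0.ne', one_smul, add_sub_cancel] at this
    rw [← this]
    refine Finset.sum_congr rfl fun k _ => Finset.sum_congr rfl fun l _ => ?_
    rw [fderiv_fderiv_quadratic_add_rescale p _ _ S hw hr0.ne']
  · intro x hx
    have hxr : ‖x - p‖ = r := by simpa [dist_eq_norm] using hx
    obtain ⟨⟨h1, h2⟩, -⟩ := hδb x (hballsub (Metric.sphere_subset_closedBall hx))
    refine h2.trans ?_
    have hx' : ‖r⁻¹ • (x - p)‖ ≤ 1 := by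
      rw [norm_smul, norm_inv, Real.norm_of_nonneg hr0.le, hxr, inv_mul_cancel₀ hr0.ne']
    have h3 := (abs_le.1 (hwb _ hx')).1
    have h4 := (abs_le.1 h1).2
    have h5 : S (x - p) (x - p) = 2⁻¹ * fderiv ℝ (fderiv ℝ ψ) p (x - p) (x - p) + κ * r ^ 2 := by
      rw [hSv, ← hxr, EuclideanSpace.real_norm_sq_eq]
      simp only [sq]
    rw [hxr] at h4
    have : ψ x ≤ H x := by
      simp only [H, h5]
      nlinarith [sq_nonneg r]
    exact_mod_cast this

end Viscosity

section Truncation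

/-- `Ψ` is a nonnegative convex `C²` function vanishing below the level `θ` and within `2θ` of the
identity; `Ψ₁` and `Ψ₂` are its first two derivatives. -/
structure IsConvexTruncation (θ : ℝ) (Ψ Ψ₁ Ψ₂ : ℝ → ℝ) : Prop where
  hasDerivAt : ∀ t, HasDerivAt Ψ (Ψ₁ t) t
  hasDerivAt_deriv : ∀ t, HasDerivAt Ψ₁ (Ψ₂ t) t
  continuous_snd : Continuous Ψ₂
  fst_nonneg : ∀ t, 0 ≤ Ψ₁ t
  snd_nonneg : ∀ t, 0 ≤ Ψ₂ t
  eq_zero : ∀ t, t ≤ θ → Ψ t = 0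
  fst_eq_zero : ∀ t, t ≤ θ → Ψ₁ t = 0
  nonneg : ∀ t, 0 ≤ Ψ t
  le_self : ∀ t, 0 ≤ t → Ψ t ≤ t
  sub_le : ∀ t, t - 2 * θ ≤ Ψ t

theorem exists_isConvexTruncation {θ : ℝ} (hθ : 0 < θ) :
    ∃ Ψ Ψ₁ Ψ₂ : ℝ → ℝ, IsConvexTruncation θ Ψ Ψ₁ Ψ₂ := by
  have hsT : ContDiff ℝ 1 Real.smoothTransition := Real.smoothTransition.contDiff (n := 1)
  set Φ : ℝ → ℝ := fun s => ∫ r in (0:ℝ)..s, Real.smoothTransition r with hΦ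
  have hint : ∀ a b : ℝ, IntervalIntegrable Real.smoothTransition volume a b := fun a b =>
    Real.smoothTransition.continuous.intervalIntegrable a b
  have hΦd : ∀ s, HasDerivAt Φ (Real.smoothTransition s) s := fun s =>
    intervalIntegral.integral_hasDerivAt_right (hint _ _)
      (Real.smoothTransition.continuous.stronglyMeasurableAtFilter _ _)
      Real.smoothTransition.continuous.continuousAt
  have hΦd2 : ∀ s, HasDerivAt Real.smoothTransition (deriv Real.smoothTransition s) s := fun s =>
    (hsT.differentiable (by norm_num) s).hasDerivAt
  have hΦ0 : ∀ s, s ≤ 0 → Φ s = 0 := by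
    intro s hs
    rw [hΦ]
    dsimp only
    rw [intervalIntegral.integral_symm, neg_eq_zero]
    apply intervalIntegral.integral_zero_ae
    refine Eventually.of_forall fun x hx => ?_
    rw [Set.uIoc_of_le hs] at hx
    exact Real.smoothTransition.zero_of_nonpos hx.2
  have hΦle : ∀ s, 0 ≤ s → Φ s ≤ s := by
    intro s hs
    have := intervalIntegral.integral_mono_on hs (hint 0 s)
      (intervalIntegrable_const (c := (1:ℝ))) (fun x _ => Real.smoothTransition.le_one x)
    simpa using this
  have hΦnn : ∀ s, 0 ≤ Φ s := by
    intro s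
    rcases le_total s 0 with h | h
    · rw [hΦ0 s h]
    · exact intervalIntegral.integral_nonneg h fun x _ => Real.smoothTransition.nonneg x
  have hΦge : ∀ s, s - 1 ≤ Φ s := by
    intro s
    rcases le_total s 1 with h | h
    · linarith [hΦnn s]
    · have h1 : Φ 1 + ∫ r in (1:ℝ)..s, Real.smoothTransition r = Φ s :=
        intervalIntegral.integral_add_adjacent_intervals (hint _ _) (hint _ _)
      have h2 : ∫ r in (1:ℝ)..s, Real.smoothTransition r = ∫ r in (1:ℝ)..s, (1:ℝ) := by
        apply intervalIntegral.integral_congr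
        intro x hx
        rw [Set.uIcc_of_le h] at hx
        exact Real.smoothTransition.one_of_one_le hx.1
      rw [h2] at h1
      simp at h1
      linarith [hΦnn 1]
  have hin : ∀ t : ℝ, HasDerivAt (fun t : ℝ => (t - θ) / θ) (1 / θ) t := fun t =>
    ((hasDerivAt_id t).sub_const θ).div_const θ
  have hneg : ∀ t, t ≤ θ → (t - θ) / θ ≤ 0 := fun t ht =>
    div_nonpos_of_nonpos_of_nonneg (by linarith) hθ.le
  refine ⟨fun t => θ * Φ ((t - θ) / θ), fun t => Real.smoothTransition ((t - θ) / θ),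
    fun t => deriv Real.smoothTransition ((t - θ) / θ) * (1 / θ), ?_, ?_, ?_, ?_, ?_, ?_, ?_, ?_,
    ?_, ?_⟩
  · intro t
    have h := ((hΦd ((t - θ) / θ)).comp t (hin t)).const_mul θ
    refine h.congr_deriv ?_
    field_simp
  · intro t
    exact (hΦd2 ((t - θ) / θ)).comp t (hin t)
  · have : Continuous (deriv Real.smoothTransition) := hsT.continuous_deriv (by norm_num)
    fun_prop
  · exact fun t => Real.smoothTransition.nonneg _
  · exact fun t => mul_nonneg (Real.smoothTransition.monotone.deriv_nonneg) (by positivity)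
  · intro t ht
    simp only [hΦ0 _ (hneg t ht), mul_zero]
  · exact fun t ht => Real.smoothTransition.zero_of_nonpos (hneg t ht)
  · exact fun t => mul_nonneg hθ.le (hΦnn _)
  · intro t ht
    rcases le_total t θ with h | h
    · simp only [hΦ0 _ (hneg t h), mul_zero]
      exact ht
    · have h1 := mul_le_mul_of_nonneg_left
        (hΦle ((t - θ) / θ) (div_nonneg (by linarith) hθ.le)) hθ.le
      have h2 : θ * ((t - θ) / θ) = t - θ := by field_simp
      linarith
  · intro t
    have h1 := mul_le_mul_of_nonneg_left (hΦge ((t - θ) / θ)) hθ.le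
    have h2 : θ * ((t - θ) / θ - 1) = t - 2 * θ := by field_simp; ring
    linarith

end Truncation

section ParametricIntegral

variable {X Y F : Type*} [NormedAddCommGroup F] [NormedSpace ℝ F]
  [TopologicalSpace Y] [MeasurableSpace Y] [OpensMeasurableSpace Y]
  {μ : Measure Y} [IsFiniteMeasureOnCompacts μ]

theorem integral_smul_eq_setIntegral_tsupport {g : Y → ℝ} (Φ : Y → F) :
    ∫ y, g y • Φ y ∂μ = ∫ y in tsupport g, g y • Φ y ∂μ := by
  refine (setIntegral_eq_integral_of_forall_compl_eq_zero fun y hy => ?_).symm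
  rw [image_eq_zero_of_notMem_tsupport hy, zero_smul]

theorem continuous_integral_smul [TopologicalSpace X] [FirstCountableTopology X]
    [LocallyCompactSpace X] [SecondCountableTopology Y] [IsLocallyFiniteMeasure μ]
    {g : Y → ℝ} (hg : Continuous g)
    (hgc : HasCompactSupport g) {Φ : X → Y → F} (hΦ : Continuous (Function.uncurry Φ)) :
    Continuous fun x => ∫ y, g y • Φ x y ∂μ := by
  simp_rw [integral_smul_eq_setIntegral_tsupport (μ := μ)]
  refine continuous_parametric_integral_of_continuous (f := fun x y => g y • Φ x y) ?_ hgc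
  exact (hg.comp continuous_snd).smul hΦ

theorem hasFDerivAt_integral_smul [NormedAddCommGroup X] [NormedSpace ℝ X] [ProperSpace X]
    [SecondCountableTopology Y] [T2Space Y]
    {g : Y → ℝ} (hg : Continuous g)
    (hgc : HasCompactSupport g) {Φ : X → Y → F} (hΦ : Continuous (Function.uncurry Φ))
    {Φ' : X → Y → X →L[ℝ] F} (hΦ' : Continuous (Function.uncurry Φ'))
    (hd : ∀ x y, HasFDerivAt (fun x => Φ x y) (Φ' x y) x) (x₀ : X) :
    HasFDerivAt (fun x => ∫ y, g y • Φ x y ∂μ) (∫ y, g y • Φ' x₀ y ∂μ) x₀ := by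
  obtain ⟨C, hC⟩ := ((isCompact_closedBall x₀ 1).prod hgc).bddAbove_image
    hΦ'.norm.continuousOn
  have hcont : ∀ x, Continuous fun y => g y • Φ x y := fun x =>
    hg.smul (hΦ.comp (Continuous.prodMk_right x))
  have hcont' : ∀ x, Continuous fun y => g y • Φ' x y := fun x =>
    hg.smul (hΦ'.comp (Continuous.prodMk_right x))
  refine hasFDerivAt_integral_of_dominated_of_fderiv_le (s := Metric.closedBall x₀ 1)
    (bound := fun y => ‖g y‖ * C) (F' := fun x y => g y • Φ' x y)
    (Metric.closedBall_mem_nhds _ one_pos) ?_ ?_ ?_ ?_ ?_ ?_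
  · exact Eventually.of_forall fun x => (hcont x).aestronglyMeasurable
  · exact (hcont x₀).integrable_of_hasCompactSupport hgc.smul_right
  · exact (hcont' x₀).aestronglyMeasurable
  · refine Eventually.of_forall fun y x hx => ?_
    rw [norm_smul]
    by_cases hy : y ∈ tsupport g
    · exact mul_le_mul_of_nonneg_left (hC ⟨(x, y), ⟨hx, hy⟩, rfl⟩) (norm_nonneg _)
    · simp [image_eq_zero_of_notMem_tsupport hy]
  · exact ((hg.norm).integrable_of_hasCompactSupport hgc.norm).mul_const C
  · exact Eventually.of_forall fun y x _ => (hd x y).const_smul (g y)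

end ParametricIntegral

section Kernel

variable {E : Type*} [NormedAddCommGroup E] [NormedSpace ℝ E]

/-- A Gaussian of covariance comparable to `exp (4 s)`, with frozen quadratic form `β y`, damped by
the factor `exp (-A exp s)`; `d` is the dimension. -/
noncomputable def gaussKernel (β : E → E →L[ℝ] E →L[ℝ] ℝ) (d A s : ℝ) (x y : E) : ℝ :=
  Real.exp (-(2 * d * s) - A * Real.exp s - Real.exp (-(4 * s)) * β y (x - y) (x - y))

theorem gaussKernel_pos (β : E → E →L[ℝ] E →L[ℝ] ℝ) (d A s : ℝ) (x y : E) :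
    0 < gaussKernel β d A s x y := Real.exp_pos _

set_option maxSynthPendingDepth 3 in
theorem continuous_gaussKernel {β : E → E →L[ℝ] E →L[ℝ] ℝ} (hβ : Continuous β) (d A : ℝ) :
    Continuous fun p : ℝ × E × E => gaussKernel β d A p.1 p.2.1 p.2.2 := by
  unfold gaussKernel
  have h : Continuous fun p : ℝ × E × E => β p.2.2 (p.2.1 - p.2.2) (p.2.1 - p.2.2) := by
    fun_prop
  fun_prop

theorem hasDerivAt_gaussKernel (β : E → E →L[ℝ] E →L[ℝ] ℝ) (d A s : ℝ) (x y : E) :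
    HasDerivAt (fun s => gaussKernel β d A s x y)
      (gaussKernel β d A s x y * (-(2 * d) - A * Real.exp s
        + 4 * Real.exp (-(4 * s)) * β y (x - y) (x - y))) s := by
  unfold gaussKernel
  refine HasDerivAt.exp ?_
  have h1 : HasDerivAt (fun s : ℝ => -(2 * d * s)) (-(2 * d)) s := 
    ((hasDerivAt_id s).const_mul (2 * d)).neg.congr_deriv (by simp)
  have h2 : HasDerivAt (fun s : ℝ => A * Real.exp s) (A * Real.exp s) s :=
    (Real.hasDerivAt_exp s).const_mul A
  have h3 : HasDerivAt (fun s : ℝ => -(4 * s)) (-4) s := 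
    ((hasDerivAt_id s).const_mul (4:ℝ)).neg.congr_deriv (by simp)
  refine ((h1.sub h2).sub (h3.exp.mul_const _)).congr_deriv ?_
  ring

set_option maxSynthPendingDepth 3 in
theorem hasFDerivAt_gaussKernel {β : E → E →L[ℝ] E →L[ℝ] ℝ} (hs : ∀ y v w, β y v w = β y w v)
    (d A s : ℝ) (x y : E) :
    HasFDerivAt (fun x => gaussKernel β d A s x y)
      ((gaussKernel β d A s x y * (-2 * Real.exp (-(4 * s)))) • β y (x - y)) x := by
  unfold gaussKernel
  have h0 : HasFDerivAt (fun x => x - y) (ContinuousLinearMap.id ℝ E) x :=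
    (hasFDerivAt_id x).sub_const y
  have h1 : HasFDerivAt (fun x => β y (x - y)) (β y) x :=
    ((β y).hasFDerivAt.comp x h0).congr_fderiv (by ext; rfl)
  have h2 := (h1.clm_apply h0).const_mul (Real.exp (-(4 * s)))
  have h3 := (h2.const_sub (-(2 * d * s) - A * Real.exp s)).exp
  refine h3.congr_fderiv ?_
  ext v
  simp [hs y v]
  ring

/-- The truncated kernel `Ψ ∘ gaussKernel`. -/
noncomputable def truncKernel (Ψ : ℝ → ℝ) (β : E → E →L[ℝ] E →L[ℝ] ℝ) (d A s : ℝ) (x y : E) : ℝ :=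
  Ψ (gaussKernel β d A s x y)

/-- The first spatial derivative of `truncKernel Ψ β d A s x y`, in terms of the derivative
`Ψ₁` of `Ψ`. -/
noncomputable def truncKernelFst (Ψ₁ : ℝ → ℝ) (β : E → E →L[ℝ] E →L[ℝ] ℝ) (d A s : ℝ) (x y : E) :
    E →L[ℝ] ℝ :=
  (Ψ₁ (gaussKernel β d A s x y) * (gaussKernel β d A s x y * (-2 * Real.exp (-(4 * s))))) •
    β y (x - y)

/-- The second spatial derivative of `truncKernel Ψ β d A s x y`, in terms of the
derivatives `Ψ₁` and `Ψ₂` of `Ψ`. -/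
noncomputable def truncKernelSnd (Ψ₁ Ψ₂ : ℝ → ℝ) (β : E → E →L[ℝ] E →L[ℝ] ℝ) (d A s : ℝ)
    (x y : E) : E →L[ℝ] E →L[ℝ] ℝ :=
  (Ψ₁ (gaussKernel β d A s x y) * (gaussKernel β d A s x y * (-2 * Real.exp (-(4 * s))))) • β y +
  (β y (x - y)).smulRight
    (((Ψ₂ (gaussKernel β d A s x y) * gaussKernel β d A s x y + Ψ₁ (gaussKernel β d A s x y)) *
      gaussKernel β d A s x y * (-2 * Real.exp (-(4 * s))) ^ 2) • β y (x - y))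

/-- The derivative of `truncKernel Ψ β d A s x y` in `s`, in terms of the derivative `Ψ₁` of `Ψ`. -/
noncomputable def truncKernelTime (Ψ₁ : ℝ → ℝ) (β : E → E →L[ℝ] E →L[ℝ] ℝ) (d A s : ℝ)
    (x y : E) : ℝ :=
  Ψ₁ (gaussKernel β d A s x y) * (gaussKernel β d A s x y * (-(2 * d) - A * Real.exp s
        + 4 * Real.exp (-(4 * s)) * β y (x - y) (x - y)))

variable {θ : ℝ} {Ψ Ψ₁ Ψ₂ : ℝ → ℝ}

theorem IsConvexTruncation.continuous (hΨ : IsConvexTruncation θ Ψ Ψ₁ Ψ₂) : Continuous Ψ :=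
  continuous_iff_continuousAt.2 fun t => (hΨ.hasDerivAt t).continuousAt

theorem IsConvexTruncation.continuous_fst (hΨ : IsConvexTruncation θ Ψ Ψ₁ Ψ₂) : Continuous Ψ₁ :=
  continuous_iff_continuousAt.2 fun t => (hΨ.hasDerivAt_deriv t).continuousAt

theorem continuous_truncKernel (hΨ : IsConvexTruncation θ Ψ Ψ₁ Ψ₂)
    {β : E → E →L[ℝ] E →L[ℝ] ℝ} (hβ : Continuous β) (d A : ℝ) :
    Continuous fun p : ℝ × E × E => truncKernel Ψ β d A p.1 p.2.1 p.2.2 :=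
  hΨ.continuous.comp (continuous_gaussKernel hβ d A)

set_option maxSynthPendingDepth 3 in
theorem continuous_truncKernelFst (hΨ : IsConvexTruncation θ Ψ Ψ₁ Ψ₂)
    {β : E → E →L[ℝ] E →L[ℝ] ℝ} (hβ : Continuous β) (d A : ℝ) :
    Continuous fun p : ℝ × E × E => truncKernelFst Ψ₁ β d A p.1 p.2.1 p.2.2 := by
  have hK := continuous_gaussKernel hβ d A
  have h1 := hΨ.continuous_fst.comp hK
  have h : Continuous fun p : ℝ × E × E => β p.2.2 (p.2.1 - p.2.2) := by fun_prop
  have he : Continuous fun p : ℝ × E × E => (-2 * Real.exp (-(4 * p.1))) := by fun_prop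
  exact (h1.mul (hK.mul he)).smul h

set_option maxSynthPendingDepth 3 in
theorem continuous_truncKernelSnd (hΨ : IsConvexTruncation θ Ψ Ψ₁ Ψ₂)
    {β : E → E →L[ℝ] E →L[ℝ] ℝ} (hβ : Continuous β) (d A : ℝ) :
    Continuous fun p : ℝ × E × E => truncKernelSnd Ψ₁ Ψ₂ β d A p.1 p.2.1 p.2.2 := by
  have hK := continuous_gaussKernel hβ d A
  have h1 := hΨ.continuous_fst.comp hK
  have h2 := hΨ.continuous_snd.comp hK
  have h : Continuous fun p : ℝ × E × E => β p.2.2 (p.2.1 - p.2.2) := by fun_prop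
  have hb : Continuous fun p : ℝ × E × E => β p.2.2 := by fun_prop
  have he : Continuous fun p : ℝ × E × E => (-2 * Real.exp (-(4 * p.1))) := by fun_prop
  have hr := ((((h2.mul hK).add h1).mul hK).mul (he.pow 2)).smul h
  refine ((h1.mul (hK.mul he)).smul hb).add ?_
  exact ((ContinuousLinearMap.smulRightL ℝ E (E →L[ℝ] ℝ)).continuous.comp h).clm_apply hr

set_option maxSynthPendingDepth 3 in
theorem continuous_uncurry_truncKernelFst (hΨ : IsConvexTruncation θ Ψ Ψ₁ Ψ₂)
    {β : E → E →L[ℝ] E →L[ℝ] ℝ} (hβ : Continuous β) (d A s : ℝ) :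
    Continuous (Function.uncurry fun x y => truncKernelFst Ψ₁ β d A s x y) :=
  (continuous_truncKernelFst hΨ hβ d A).comp (f := fun p : E × E => (s, p)) (by fun_prop)

set_option maxSynthPendingDepth 3 in
theorem continuous_uncurry_truncKernelSnd (hΨ : IsConvexTruncation θ Ψ Ψ₁ Ψ₂)
    {β : E → E →L[ℝ] E →L[ℝ] ℝ} (hβ : Continuous β) (d A s : ℝ) :
    Continuous (Function.uncurry fun x y => truncKernelSnd Ψ₁ Ψ₂ β d A s x y) :=
  (continuous_truncKernelSnd hΨ hβ d A).comp (f := fun p : E × E => (s, p)) (by fun_prop)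

theorem continuous_truncKernelTime (hΨ : IsConvexTruncation θ Ψ Ψ₁ Ψ₂)
    {β : E → E →L[ℝ] E →L[ℝ] ℝ} (hβ : Continuous β) (d A : ℝ) :
    Continuous fun p : ℝ × E × E => truncKernelTime Ψ₁ β d A p.1 p.2.1 p.2.2 := by
  have hK := continuous_gaussKernel hβ d A
  have h1 := hΨ.continuous_fst.comp hK
  have h : Continuous fun p : ℝ × E × E => β p.2.2 (p.2.1 - p.2.2) (p.2.1 - p.2.2) := by
    fun_prop
  refine h1.mul (hK.mul ?_)
  fun_prop

theorem hasDerivAt_truncKernel (hΨ : IsConvexTruncation θ Ψ Ψ₁ Ψ₂)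
    (β : E → E →L[ℝ] E →L[ℝ] ℝ) (d A s : ℝ) (x y : E) :
    HasDerivAt (fun s => truncKernel Ψ β d A s x y) (truncKernelTime Ψ₁ β d A s x y) s :=
  (hΨ.hasDerivAt _).comp s (hasDerivAt_gaussKernel β d A s x y)

theorem hasFDerivAt_truncKernel (hΨ : IsConvexTruncation θ Ψ Ψ₁ Ψ₂)
    {β : E → E →L[ℝ] E →L[ℝ] ℝ} (hs : ∀ y v w, β y v w = β y w v) (d A s : ℝ) (x y : E) :
    HasFDerivAt (fun x => truncKernel Ψ β d A s x y) (truncKernelFst Ψ₁ β d A s x y) x := by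
  refine ((hΨ.hasDerivAt _).comp_hasFDerivAt x
    (hasFDerivAt_gaussKernel hs d A s x y)).congr_fderiv ?_
  rw [truncKernelFst, smul_smul]

set_option maxSynthPendingDepth 3 in
theorem hasFDerivAt_truncKernelFst (hΨ : IsConvexTruncation θ Ψ Ψ₁ Ψ₂)
    {β : E → E →L[ℝ] E →L[ℝ] ℝ} (hs : ∀ y v w, β y v w = β y w v) (d A s : ℝ) (x y : E) :
    HasFDerivAt (fun x => truncKernelFst Ψ₁ β d A s x y)
      (truncKernelSnd Ψ₁ Ψ₂ β d A s x y) x := by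
  have hK := hasFDerivAt_gaussKernel hs d A s x y
  have h0 : HasFDerivAt (fun x => x - y) (ContinuousLinearMap.id ℝ E) x :=
    (hasFDerivAt_id x).sub_const y
  have h1 : HasFDerivAt (fun x => β y (x - y)) (β y) x :=
    ((β y).hasFDerivAt.comp x h0).congr_fderiv (by ext; rfl)
  have h2 := (((hΨ.hasDerivAt_deriv _).comp_hasFDerivAt x hK).mul
    (hK.mul_const (-2 * Real.exp (-(4 * s))))).smul h1
  refine h2.congr_fderiv ?_
  unfold truncKernelSnd
  ext v w
  simp
  ring

end Kernel

section EllipticPair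

variable {ι : Type*} [Fintype ι] [DecidableEq ι]

/-- `a` is a uniformly elliptic Lipschitz coefficient field and `β y` is the bilinear form with
matrix `a(y)⁻¹`. -/
structure EllipticPair (a : ι → ι → EuclideanSpace ℝ ι → ℝ)
    (β : EuclideanSpace ℝ ι → EuclideanSpace ℝ ι →L[ℝ] EuclideanSpace ℝ ι →L[ℝ] ℝ)
    (c L B : ℝ) : Prop where
  c_pos : 0 < c
  L_nonneg : 0 ≤ L
  B_nonneg : 0 ≤ B
  continuous : Continuous β
  symm : ∀ y v w, β y v w = β y w v
  elliptic : ∀ x (ξ : EuclideanSpace ℝ ι), c * ‖ξ‖ ^ 2 ≤ ∑ k, ∑ l, a k l x * (ξ k * ξ l)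
  lipschitz : ∀ k l x y, |a k l x - a k l y| ≤ L * ‖x - y‖
  lower : ∀ y w, c * ‖w‖ ^ 2 ≤ β y w w
  bdd : ∀ y k l, |β y (EuclideanSpace.single k 1) (EuclideanSpace.single l 1)| ≤ B
  inv_apply : ∀ y w, ∑ k, ∑ l, a k l y *
    (β y w (EuclideanSpace.single k 1) * β y w (EuclideanSpace.single l 1)) = β y w w
  trace : ∀ y, ∑ k, ∑ l, a k l y *
    β y (EuclideanSpace.single k 1) (EuclideanSpace.single l 1) = Fintype.card ι

variable {a : ι → ι → EuclideanSpace ℝ ι → ℝ}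
  {β : EuclideanSpace ℝ ι → EuclideanSpace ℝ ι →L[ℝ] EuclideanSpace ℝ ι →L[ℝ] ℝ}
  {c L B θ A : ℝ} {Ψ Ψ₁ Ψ₂ : ℝ → ℝ}

theorem EllipticPair.sum_mul_ge (h : EllipticPair a β c L B) (x y w : EuclideanSpace ℝ ι) {τ : ℝ}
    (hτ : ‖x - y‖ ≤ τ) :
    (1 - L * Fintype.card ι / c * τ) * β y w w ≤ ∑ k, ∑ l, a k l x *
      (β y w (EuclideanSpace.single k 1) * β y w (EuclideanSpace.single l 1)) := by
  have hc := h.c_pos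
  set p : EuclideanSpace ℝ ι := WithLp.toLp 2 fun k => β y w (EuclideanSpace.single k 1) with hp
  have hq := h.inv_apply y w
  have hcp : c * ‖p‖ ^ 2 ≤ β y w w := by
    rw [← hq]
    exact h.elliptic y p
  have hn : ‖p‖ ^ 2 = ∑ k, |p k| ^ 2 := by
    rw [EuclideanSpace.norm_sq_eq]; simp
  have hcs : (∑ k, |p k|) ^ 2 ≤ Fintype.card ι * ∑ k, |p k| ^ 2 := by
    simpa using sq_sum_le_card_mul_sum_sq (s := Finset.univ) (f := fun k => |p k|)
  have hτ0 : 0 ≤ τ := (norm_nonneg _).trans hτ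
  have key : ∑ k, ∑ l, (a k l y - a k l x) * (p k * p l) ≤ L * τ * (∑ k, |p k|) ^ 2 := by
    have : L * τ * (∑ k, |p k|) ^ 2 = ∑ k, ∑ l, L * τ * (|p k| * |p l|) := by
      rw [sq, Finset.sum_mul_sum, Finset.mul_sum]
      simp_rw [Finset.mul_sum]
    rw [this]
    refine Finset.sum_le_sum fun k _ => Finset.sum_le_sum fun l _ => ?_
    calc (a k l y - a k l x) * (p k * p l) ≤ |(a k l y - a k l x) * (p k * p l)| := le_abs_self _
      _ = |a k l x - a k l y| * (|p k| * |p l|) := by rw [abs_mul, abs_mul, abs_sub_comm]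
      _ ≤ L * τ * (|p k| * |p l|) := by
        refine mul_le_mul_of_nonneg_right ?_ (by positivity)
        exact (h.lipschitz k l x y).trans (mul_le_mul_of_nonneg_left hτ h.L_nonneg)
  have hsplit : ∑ k, ∑ l, (a k l y - a k l x) * (p k * p l) =
      β y w w - ∑ k, ∑ l, a k l x * (p k * p l) := by
    rw [← hq, ← Finset.sum_sub_distrib]
    refine Finset.sum_congr rfl fun k _ => ?_
    rw [← Finset.sum_sub_distrib]
    refine Finset.sum_congr rfl fun l _ => ?_
    simp only [hp]
    ring
  have h3 : L * τ * (∑ k, |p k|) ^ 2 ≤ L * Fintype.card ι / c * τ * β y w w := by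
    calc L * τ * (∑ k, |p k|) ^ 2 ≤ L * τ * (Fintype.card ι * ‖p‖ ^ 2) := by
          rw [hn]; exact mul_le_mul_of_nonneg_left hcs (mul_nonneg h.L_nonneg hτ0)
      _ = L * Fintype.card ι / c * τ * (c * ‖p‖ ^ 2) := by field_simp
      _ ≤ _ := mul_le_mul_of_nonneg_left hcp (by have := h.L_nonneg; positivity)
  change _ ≤ ∑ k, ∑ l, a k l x * (p k * p l)
  linarith

theorem EllipticPair.trace_le (h : EllipticPair a β c L B) (x y : EuclideanSpace ℝ ι) {τ : ℝ}
    (hτ : ‖x - y‖ ≤ τ) :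
    ∑ k, ∑ l, a k l x * β y (EuclideanSpace.single k 1) (EuclideanSpace.single l 1) ≤
      Fintype.card ι + L * Fintype.card ι ^ 2 * B * τ := by
  have key : ∑ k, ∑ l, (a k l x - a k l y) *
      β y (EuclideanSpace.single k 1) (EuclideanSpace.single l 1) ≤
      ∑ _k : ι, ∑ _l : ι, L * τ * B := by
    refine Finset.sum_le_sum fun k _ => Finset.sum_le_sum fun l _ => ?_
    refine (le_abs_self _).trans ?_
    rw [abs_mul]
    exact mul_le_mul ((h.lipschitz k l x y).trans (mul_le_mul_of_nonneg_left hτ h.L_nonneg))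
      (h.bdd y k l) (abs_nonneg _) (mul_nonneg h.L_nonneg ((norm_nonneg _).trans hτ))
  simp only [sub_mul, Finset.sum_sub_distrib, h.trace, Finset.sum_const, Finset.card_univ,
    nsmul_eq_mul] at key
  linarith

theorem EllipticPair.norm_le_of_lt_gaussKernel (h : EllipticPair a β c L B) (hA : 0 ≤ A)
    (hθ : 0 < θ) {s : ℝ}
    (hs : 2 * Fintype.card ι * Real.exp s + |Real.log θ| * Real.exp s ^ 2 ≤ c)
    {x y : EuclideanSpace ℝ ι} (hK : θ < gaussKernel β (Fintype.card ι) A s x y) :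
    ‖x - y‖ ≤ Real.exp s := by
  have hlog := (Real.log_lt_iff_lt_exp hθ).2 hK
  have hlow := h.lower y (x - y)
  have hc := h.c_pos
  set T := Real.exp s with hT
  have hT0 : 0 < T := Real.exp_pos s
  have e4 : Real.exp (-(4 * s)) = (T ^ 4)⁻¹ := by
    rw [Real.exp_neg, hT, ← Real.exp_nat_mul]; norm_num
  rw [e4] at hlog
  have hsT : -s ≤ T⁻¹ := by
    have := Real.add_one_le_exp (-s)
    rw [Real.exp_neg] at this
    linarith
  set q := β y (x - y) (x - y)
  set d : ℝ := (Fintype.card ι : ℝ)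
  have hd : 0 ≤ d := Nat.cast_nonneg _
  have h1 : (T ^ 4)⁻¹ * q ≤ 2 * d * T⁻¹ + |Real.log θ| := by
    have h2 : 2 * d * (-s) ≤ 2 * d * T⁻¹ := mul_le_mul_of_nonneg_left hsT (by positivity)
    have h3 := neg_abs_le (Real.log θ)
    have h4 : 0 ≤ A * T := by positivity
    linarith
  have h5 : q ≤ T ^ 2 * c := by
    calc q = T ^ 4 * ((T ^ 4)⁻¹ * q) := by field_simp
      _ ≤ T ^ 4 * (2 * d * T⁻¹ + |Real.log θ|) := mul_le_mul_of_nonneg_left h1 (by positivity)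
      _ = T ^ 2 * (2 * d * T + |Real.log θ| * T ^ 2) := by field_simp
      _ ≤ _ := mul_le_mul_of_nonneg_left hs (by positivity)
  have h6 : ‖x - y‖ ^ 2 ≤ T ^ 2 := by
    have : c * ‖x - y‖ ^ 2 ≤ c * T ^ 2 := by linarith
    exact le_of_mul_le_mul_left this hc
  exact (sq_le_sq₀ (norm_nonneg _) hT0.le).1 h6

/-- The truncated kernel is a subsolution of `∂ₛ K ≤ κ L K`. -/
theorem EllipticPair.truncKernelTime_le (h : EllipticPair a β c L B)
    (hΨ : IsConvexTruncation θ Ψ Ψ₁ Ψ₂) (hθ : 0 < θ)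
    (hA : 4 * (L * Fintype.card ι ^ 2 * B + Fintype.card ι * (L * Fintype.card ι / c)) ≤ A)
    {s : ℝ} (hs1 : L * Fintype.card ι / c * Real.exp s ≤ 1 / 2)
    (hs2 : 2 * Fintype.card ι * Real.exp s + |Real.log θ| * Real.exp s ^ 2 ≤ c)
    (x y : EuclideanSpace ℝ ι) :
    truncKernelTime Ψ₁ β (Fintype.card ι) A s x y ≤
      Real.exp s ^ 4 / (1 - L * Fintype.card ι / c * Real.exp s) *
        ∑ k, ∑ l, a k l x * truncKernelSnd Ψ₁ Ψ₂ β (Fintype.card ι) A s x y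
          (EuclideanSpace.single k 1) (EuclideanSpace.single l 1) := by
  have hc := h.c_pos
  have hL := h.L_nonneg
  have hB := h.B_nonneg
  set T := Real.exp s with hT
  have hT0 : 0 < T := Real.exp_pos s
  have e4 : Real.exp (-(4 * s)) = (T ^ 4)⁻¹ := by
    rw [Real.exp_neg, hT, ← Real.exp_nat_mul]; norm_num
  set d : ℝ := (Fintype.card ι : ℝ) with hd
  have hd0 : 0 ≤ d := Nat.cast_nonneg _
  set C1 := L * d / c with hC1
  set C2 := L * d ^ 2 * B with hC2
  have hC1' : 0 ≤ C1 := by positivity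
  have hC2' : 0 ≤ C2 := by positivity
  have hA0 : 0 ≤ A := le_trans (by positivity) hA
  set K := gaussKernel β d A s x y with hK
  have hK0 : 0 < K := gaussKernel_pos _ _ _ _ _ _
  set w := x - y with hw
  set S1 := ∑ k, ∑ l, a k l x *
      (β y w (EuclideanSpace.single k 1) * β y w (EuclideanSpace.single l 1)) with hS1
  set S2 := ∑ k, ∑ l, a k l x * β y (EuclideanSpace.single k 1) (EuclideanSpace.single l 1)
    with hS2
  have hsum : ∑ k, ∑ l, a k l x * truncKernelSnd Ψ₁ Ψ₂ β d A s x y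
          (EuclideanSpace.single k 1) (EuclideanSpace.single l 1) =
      (Ψ₁ K * (K * (-2 * (T ^ 4)⁻¹))) * S2 +
        ((Ψ₂ K * K + Ψ₁ K) * K * (-2 * (T ^ 4)⁻¹) ^ 2) * S1 := by
    rw [hS1, hS2, Finset.mul_sum, Finset.mul_sum, ← Finset.sum_add_distrib]
    refine Finset.sum_congr rfl fun k _ => ?_
    rw [Finset.mul_sum, Finset.mul_sum, ← Finset.sum_add_distrib]
    refine Finset.sum_congr rfl fun l _ => ?_
    rw [truncKernelSnd, ← hK, e4, ← hw]
    simp only [_root_.add_apply, _root_.smul_apply, ContinuousLinearMap.smulRight_apply,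
      smul_eq_mul]
    ring
  have hS1nn : 0 ≤ S1 :=
    le_trans (by positivity) (h.elliptic x
      (WithLp.toLp 2 fun k => β y w (EuclideanSpace.single k 1)))
  rw [hsum, truncKernelTime, ← hK, e4, ← hw, ← hT]
  have hden : 0 < 1 - C1 * T := by linarith
  have hΨ1 := hΨ.fst_nonneg K
  have hΨ2 := hΨ.snd_nonneg K
  rcases le_or_gt K θ with hKθ | hKθ
  · rw [hΨ.fst_eq_zero K hKθ]
    simp only [zero_mul, zero_add, add_zero]
    positivity
  · have hwT : ‖x - y‖ ≤ T := h.norm_le_of_lt_gaussKernel hA0 hθ hs2 hKθ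
    have i1 := h.sum_mul_ge x y w hwT
    have i2 := h.trace_le x y hwT
    rw [← hS1, ← hd, ← hC1] at i1
    rw [← hS2, ← hd, ← hC2] at i2
    set q := β y w w with hq
    have h3 : 2 * (d + C2 * T) / (1 - C1 * T) ≤ 2 * d + A * T := by
      rw [div_le_iff₀ hden]
      have t1 : A * T * (C1 * T) ≤ A * T * (1 / 2) :=
        mul_le_mul_of_nonneg_left hs1 (by positivity)
      have t2 : 4 * (C2 + d * C1) * T ≤ A * T := mul_le_mul_of_nonneg_right hA hT0.le
      nlinarith
    have h4 : Ψ₁ K * K * (4 * (T ^ 4)⁻¹ ^ 2 * ((1 - C1 * T) * q) - 2 * (T ^ 4)⁻¹ * (d + C2 * T)) ≤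
        (Ψ₁ K * (K * (-2 * (T ^ 4)⁻¹))) * S2 +
        ((Ψ₂ K * K + Ψ₁ K) * K * (-2 * (T ^ 4)⁻¹) ^ 2) * S1 := by
      have u1 : Ψ₁ K * K * (4 * (T ^ 4)⁻¹ ^ 2) * ((1 - C1 * T) * q) ≤
          Ψ₁ K * K * (4 * (T ^ 4)⁻¹ ^ 2) * S1 := mul_le_mul_of_nonneg_left i1 (by positivity)
      have u2 : Ψ₁ K * K * (2 * (T ^ 4)⁻¹) * S2 ≤ Ψ₁ K * K * (2 * (T ^ 4)⁻¹) * (d + C2 * T) :=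
        mul_le_mul_of_nonneg_left i2 (by positivity)
      have u3 : 0 ≤ Ψ₂ K * K * K * (4 * (T ^ 4)⁻¹ ^ 2) * S1 := by positivity
      linarith
    calc Ψ₁ K * (K * (-(2 * d) - A * T + 4 * (T ^ 4)⁻¹ * q))
        ≤ Ψ₁ K * K * (4 * (T ^ 4)⁻¹ * q - 2 * (d + C2 * T) / (1 - C1 * T)) := by
          rw [mul_assoc (Ψ₁ K) K]
          refine mul_le_mul_of_nonneg_left (mul_le_mul_of_nonneg_left ?_ hK0.le) hΨ1
          linarith
      _ = T ^ 4 / (1 - C1 * T) * (Ψ₁ K * K *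
          (4 * (T ^ 4)⁻¹ ^ 2 * ((1 - C1 * T) * q) - 2 * (T ^ 4)⁻¹ * (d + C2 * T))) := by
          have hne : 1 - C1 * T ≠ 0 := hden.ne'
          generalize 1 - C1 * T = e at hne ⊢
          field_simp
      _ ≤ _ := mul_le_mul_of_nonneg_left h4 (by positivity)

end EllipticPair

section HeatAverage

variable {ι : Type*} [Fintype ι] [DecidableEq ι]

/-- The average of `g` against the truncated kernel centred at `x`. -/
noncomputable def truncAverage (μ : Measure (EuclideanSpace ℝ ι)) (Ψ : ℝ → ℝ)
    (β : EuclideanSpace ℝ ι → EuclideanSpace ℝ ι →L[ℝ] EuclideanSpace ℝ ι →L[ℝ] ℝ) (A : ℝ)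
    (g : EuclideanSpace ℝ ι → ℝ) (s : ℝ) (x : EuclideanSpace ℝ ι) : ℝ :=
  ∫ y, g y * truncKernel Ψ β (Fintype.card ι) A s x y ∂μ

variable {a : ι → ι → EuclideanSpace ℝ ι → ℝ}
  {β : EuclideanSpace ℝ ι → EuclideanSpace ℝ ι →L[ℝ] EuclideanSpace ℝ ι →L[ℝ] ℝ}
  {c L B θ A : ℝ} {Ψ Ψ₁ Ψ₂ : ℝ → ℝ} {μ : Measure (EuclideanSpace ℝ ι)}
  [IsFiniteMeasureOnCompacts μ] {g : EuclideanSpace ℝ ι → ℝ}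

theorem EllipticPair.continuous_truncAverage (h : EllipticPair a β c L B)
    (hΨ : IsConvexTruncation θ Ψ Ψ₁ Ψ₂) (hg : Continuous g) (hgc : HasCompactSupport g) :
    Continuous fun p : ℝ × EuclideanSpace ℝ ι => truncAverage μ Ψ β A g p.1 p.2 := by
  refine continuous_integral_smul (μ := μ) hg hgc
    (Φ := fun (p : ℝ × EuclideanSpace ℝ ι) y =>
      truncKernel Ψ β (Fintype.card ι) A p.1 p.2 y) ?_
  exact (continuous_truncKernel hΨ h.continuous _ A).comp
    (f := fun q : (ℝ × EuclideanSpace ℝ ι) × EuclideanSpace ℝ ι => (q.1.1, q.1.2, q.2))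
    (by fun_prop)

theorem EllipticPair.hasFDerivAt_truncAverage (h : EllipticPair a β c L B)
    (hΨ : IsConvexTruncation θ Ψ Ψ₁ Ψ₂) (hg : Continuous g) (hgc : HasCompactSupport g)
    (s : ℝ) (x : EuclideanSpace ℝ ι) :
    HasFDerivAt (truncAverage μ Ψ β A g s)
      (∫ y, g y • truncKernelFst Ψ₁ β (Fintype.card ι) A s x y ∂μ) x :=
  hasFDerivAt_integral_smul (μ := μ) hg hgc
    (Φ := fun x y => truncKernel Ψ β (Fintype.card ι) A s x y)
    (Φ' := fun x y => truncKernelFst Ψ₁ β (Fintype.card ι) A s x y)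
    ((continuous_truncKernel hΨ h.continuous _ A).comp (Continuous.prodMk_right s))
    ((continuous_truncKernelFst hΨ h.continuous _ A).comp (Continuous.prodMk_right s))
    (fun x y => hasFDerivAt_truncKernel hΨ h.symm _ A s x y) x

set_option maxSynthPendingDepth 3 in
theorem EllipticPair.hasFDerivAt_fderiv_truncAverage (h : EllipticPair a β c L B)
    (hΨ : IsConvexTruncation θ Ψ Ψ₁ Ψ₂) (hg : Continuous g) (hgc : HasCompactSupport g)
    (s : ℝ) (x : EuclideanSpace ℝ ι) :
    HasFDerivAt (fderiv ℝ (truncAverage μ Ψ β A g s))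
      (∫ y, g y • truncKernelSnd Ψ₁ Ψ₂ β (Fintype.card ι) A s x y ∂μ) x := by
  have h1 : fderiv ℝ (truncAverage μ Ψ β A g s) =
      fun x => ∫ y, g y • truncKernelFst Ψ₁ β (Fintype.card ι) A s x y ∂μ :=
    funext fun x => (h.hasFDerivAt_truncAverage hΨ hg hgc s x).fderiv
  have hc1 := continuous_uncurry_truncKernelFst hΨ h.continuous (Fintype.card ι) A s
  have hc2 := continuous_uncurry_truncKernelSnd hΨ h.continuous (Fintype.card ι) A s
  rw [h1]
  exact hasFDerivAt_integral_smul (μ := μ) hg hgc hc1 hc2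
    (fun x y => hasFDerivAt_truncKernelFst hΨ h.symm _ A s x y) x

set_option maxSynthPendingDepth 3 in
theorem EllipticPair.contDiff_truncAverage (h : EllipticPair a β c L B)
    (hΨ : IsConvexTruncation θ Ψ Ψ₁ Ψ₂) (hg : Continuous g) (hgc : HasCompactSupport g)
    (s : ℝ) : ContDiff ℝ 2 (truncAverage μ Ψ β A g s) := by
  have h2 : ∀ x, HasFDerivAt (fderiv ℝ (truncAverage μ Ψ β A g s))
      (∫ y, g y • truncKernelSnd Ψ₁ Ψ₂ β (Fintype.card ι) A s x y ∂μ) x := fun x =>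
    h.hasFDerivAt_fderiv_truncAverage hΨ hg hgc s x
  have hc := continuous_uncurry_truncKernelSnd hΨ h.continuous (Fintype.card ι) A s
  have hc2 : Continuous fun x =>
      ∫ y, g y • truncKernelSnd Ψ₁ Ψ₂ β (Fintype.card ι) A s x y ∂μ :=
    continuous_integral_smul (μ := μ) hg hgc hc
  have h3 : ContDiff ℝ 1 (fderiv ℝ (truncAverage μ Ψ β A g s)) :=
    contDiff_one_iff_fderiv.2 ⟨fun x => (h2 x).differentiableAt, by
      rw [show fderiv ℝ (fderiv ℝ (truncAverage μ Ψ β A g s)) = _ from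
        funext fun x => (h2 x).fderiv]
      exact hc2⟩
  rw [show (2 : WithTop ℕ∞) = 1 + 1 by norm_num, contDiff_succ_iff_fderiv]
  exact ⟨fun x => (h.hasFDerivAt_truncAverage hΨ hg hgc s x).differentiableAt, by simp, h3⟩

theorem EllipticPair.hasDerivAt_truncAverage (h : EllipticPair a β c L B)
    (hΨ : IsConvexTruncation θ Ψ Ψ₁ Ψ₂) (hg : Continuous g) (hgc : HasCompactSupport g)
    (s : ℝ) (x : EuclideanSpace ℝ ι) :
    HasDerivAt (fun s => truncAverage μ Ψ β A g s x)
      (∫ y, g y * truncKernelTime Ψ₁ β (Fintype.card ι) A s x y ∂μ) s := by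
  have hj : Continuous fun p : ℝ × EuclideanSpace ℝ ι => (p.1, x, p.2) := by fun_prop
  have hcT := (continuous_truncKernelTime hΨ h.continuous (Fintype.card ι) A).comp hj
  have := hasFDerivAt_integral_smul (μ := μ) hg hgc
    (Φ := fun s y => truncKernel Ψ β (Fintype.card ι) A s x y)
    (Φ' := fun s y => ContinuousLinearMap.toSpanSingleton ℝ
      (truncKernelTime Ψ₁ β (Fintype.card ι) A s x y))
    ((continuous_truncKernel hΨ h.continuous _ A).comp hj)
    ((ContinuousLinearMap.toSpanSingletonCLE : ℝ ≃L[ℝ] ℝ →L[ℝ] ℝ).continuous.comp hcT)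
    (fun s y => (hasDerivAt_truncKernel hΨ β _ A s x y).hasFDerivAt) s
  have h2 := this.hasDerivAt
  refine h2.congr_deriv ?_
  rw [ContinuousLinearMap.integral_apply]
  · simp
  · refine Continuous.integrable_of_hasCompactSupport ?_ hgc.smul_right
    exact hg.smul ((ContinuousLinearMap.toSpanSingletonCLE : ℝ ≃L[ℝ] ℝ →L[ℝ] ℝ).continuous.comp
      (hcT.comp (Continuous.prodMk_right s)))

set_option maxSynthPendingDepth 3 in
theorem EllipticPair.nondivOp_truncAverage (h : EllipticPair a β c L B)
    (hΨ : IsConvexTruncation θ Ψ Ψ₁ Ψ₂) (hg : Continuous g) (hgc : HasCompactSupport g)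
    (s : ℝ) (x : EuclideanSpace ℝ ι) :
    nondivOp a (truncAverage μ Ψ β A g s) x =
      ∫ y, g y * ∑ k, ∑ l, a k l x * truncKernelSnd Ψ₁ Ψ₂ β (Fintype.card ι) A s x y
          (EuclideanSpace.single k 1) (EuclideanSpace.single l 1) ∂μ := by
  have hcS : Continuous fun y => truncKernelSnd Ψ₁ Ψ₂ β (Fintype.card ι) A s x y :=
    (continuous_truncKernelSnd hΨ h.continuous (Fintype.card ι) A).comp
      (f := fun y => (s, x, y)) (by fun_prop)
  have hi : Integrable (fun y => g y • truncKernelSnd Ψ₁ Ψ₂ β (Fintype.card ι) A s x y) μ :=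
    (hg.smul hcS).integrable_of_hasCompactSupport hgc.smul_right
  have hterm : ∀ k l, Integrable (fun y => a k l x * (g y *
      truncKernelSnd Ψ₁ Ψ₂ β (Fintype.card ι) A s x y
        (EuclideanSpace.single k 1) (EuclideanSpace.single l 1))) μ := by
    intro k l
    refine Integrable.const_mul (Continuous.integrable_of_hasCompactSupport ?_ hgc.mul_right) _
    fun_prop
  unfold nondivOp
  rw [(h.hasFDerivAt_fderiv_truncAverage hΨ hg hgc s x).fderiv]
  have e : ∀ k l, (∫ y, g y • truncKernelSnd Ψ₁ Ψ₂ β (Fintype.card ι) A s x y ∂μ)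
      (EuclideanSpace.single k 1) (EuclideanSpace.single l 1) =
      ∫ y, g y * truncKernelSnd Ψ₁ Ψ₂ β (Fintype.card ι) A s x y
        (EuclideanSpace.single k 1) (EuclideanSpace.single l 1) ∂μ := by
    intro k l
    rw [ContinuousLinearMap.integral_apply hi, ContinuousLinearMap.integral_apply]
    · rfl
    · exact hi.apply_continuousLinearMap _
  simp_rw [e, Finset.mul_sum, ← integral_const_mul]
  rw [integral_finsetSum]
  · refine Finset.sum_congr rfl fun k _ => ?_
    rw [integral_finsetSum]
    · refine Finset.sum_congr rfl fun l _ => integral_congr_ae (Eventually.of_forall fun y => ?_)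
      simp only []
      ring
    · intro l _
      refine (hterm k l).congr (Eventually.of_forall fun y => ?_)
      simp only []
      ring
  · intro k _
    refine integrable_finsetSum _ fun l _ => ?_
    refine (hterm k l).congr (Eventually.of_forall fun y => ?_)
    simp only []
    ring

set_option maxSynthPendingDepth 3 in
theorem EllipticPair.deriv_truncAverage_le (h : EllipticPair a β c L B)
    (hΨ : IsConvexTruncation θ Ψ Ψ₁ Ψ₂) (hθ : 0 < θ) (hg : Continuous g)
    (hgc : HasCompactSupport g) (hg0 : ∀ y, 0 ≤ g y)
    (hA : 4 * (L * Fintype.card ι ^ 2 * B + Fintype.card ι * (L * Fintype.card ι / c)) ≤ A)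
    {s : ℝ} (hs1 : L * Fintype.card ι / c * Real.exp s ≤ 1 / 2)
    (hs2 : 2 * Fintype.card ι * Real.exp s + |Real.log θ| * Real.exp s ^ 2 ≤ c)
    (x : EuclideanSpace ℝ ι) :
    deriv (fun s => truncAverage μ Ψ β A g s x) s ≤
      Real.exp s ^ 4 / (1 - L * Fintype.card ι / c * Real.exp s) *
        nondivOp a (truncAverage μ Ψ β A g s) x := by
  rw [(h.hasDerivAt_truncAverage hΨ hg hgc s x).deriv, h.nondivOp_truncAverage hΨ hg hgc s x,
    ← integral_const_mul]
  have hcS : Continuous fun y => truncKernelSnd Ψ₁ Ψ₂ β (Fintype.card ι) A s x y :=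
    (continuous_truncKernelSnd hΨ h.continuous (Fintype.card ι) A).comp
      (f := fun y => (s, x, y)) (by fun_prop)
  have hcT : Continuous fun y => truncKernelTime Ψ₁ β (Fintype.card ι) A s x y :=
    (continuous_truncKernelTime hΨ h.continuous (Fintype.card ι) A).comp
      (f := fun y => (s, x, y)) (by fun_prop)
  refine integral_mono ?_ ?_ fun y => ?_
  · exact (hg.mul hcT).integrable_of_hasCompactSupport hgc.mul_right
  · refine Integrable.const_mul (Continuous.integrable_of_hasCompactSupport ?_ hgc.mul_right) _
    fun_prop
  · have := mul_le_mul_of_nonneg_left (h.truncKernelTime_le hΨ hθ hA hs1 hs2 x y) (hg0 y)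
    dsimp only
    linarith

theorem EllipticPair.truncKernel_eq_zero (h : EllipticPair a β c L B)
    (hΨ : IsConvexTruncation θ Ψ Ψ₁ Ψ₂) (hθ : 0 < θ) (hA : 0 ≤ A) {s : ℝ}
    (hs2 : 2 * Fintype.card ι * Real.exp s + |Real.log θ| * Real.exp s ^ 2 ≤ c)
    {x y : EuclideanSpace ℝ ι} (hxy : Real.exp s < ‖x - y‖) :
    truncKernel Ψ β (Fintype.card ι) A s x y = 0 := by
  refine hΨ.eq_zero _ (not_lt.1 fun hlt => ?_)
  exact absurd (h.norm_le_of_lt_gaussKernel hA hθ hs2 hlt) (not_le.2 hxy)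

theorem EllipticPair.truncAverage_eq_zero (h : EllipticPair a β c L B)
    (hΨ : IsConvexTruncation θ Ψ Ψ₁ Ψ₂) (hθ : 0 < θ) (hA : 0 ≤ A) {s : ℝ}
    (hs2 : 2 * Fintype.card ι * Real.exp s + |Real.log θ| * Real.exp s ^ 2 ≤ c)
    {x : EuclideanSpace ℝ ι} (hx : ∀ y, g y ≠ 0 → Real.exp s < ‖x - y‖) :
    truncAverage μ Ψ β A g s x = 0 := by
  refine integral_eq_zero_of_ae (Eventually.of_forall fun y => ?_)
  by_cases hy : g y = 0
  · simp [hy]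
  · simp [h.truncKernel_eq_zero hΨ hθ hA hs2 (hx y hy)]

end HeatAverage

section GaussMass

variable {ι : Type*} [Fintype ι] [DecidableEq ι]

theorem integrable_exp_neg_mul_norm_sq (μ : Measure (EuclideanSpace ℝ ι)) [μ.IsAddHaarMeasure]
    {c : ℝ} (hc : 0 < c) : Integrable (fun w => Real.exp (-(c * ‖w‖ ^ 2))) μ := by
  have h := GaussianFourier.integrable_cexp_neg_mul_sq_norm_add (V := EuclideanSpace ℝ ι)
    (b := (c : ℂ)) (by simpa using hc) 0 0
  have h2 : Integrable (fun w : EuclideanSpace ℝ ι => Real.exp (-(c * ‖w‖ ^ 2))) volume := by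
    refine h.norm.congr (Eventually.of_forall fun w => ?_)
    simp only [Complex.norm_exp]
    congr 1
    have : (-(c : ℂ) * (‖w‖ : ℂ) ^ 2 + 0 * (inner ℝ (0 : EuclideanSpace ℝ ι) w : ℂ)) =
      ((-(c * ‖w‖ ^ 2) : ℝ) : ℂ) := by push_cast; ring
    rw [this, Complex.ofReal_re]
  rw [Measure.isAddLeftInvariant_eq_smul μ volume]
  exact h2.smul_measure_nnreal

/-- The total mass of the Gaussian `exp (-β y w w)`. -/
noncomputable def gaussMass (μ : Measure (EuclideanSpace ℝ ι))
    (β : EuclideanSpace ℝ ι → EuclideanSpace ℝ ι →L[ℝ] EuclideanSpace ℝ ι →L[ℝ] ℝ)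
    (y : EuclideanSpace ℝ ι) : ℝ :=
  ∫ w, Real.exp (-(β y w w)) ∂μ

/-- The rescaled Gaussian average of `g` at scale `τ ^ 2`. -/
noncomputable def gaussAverage (μ : Measure (EuclideanSpace ℝ ι))
    (β : EuclideanSpace ℝ ι → EuclideanSpace ℝ ι →L[ℝ] EuclideanSpace ℝ ι →L[ℝ] ℝ)
    (g : EuclideanSpace ℝ ι → ℝ) (τ : ℝ) (x : EuclideanSpace ℝ ι) : ℝ :=
  ∫ w, g (x + τ ^ 2 • w) * Real.exp (-(β (x + τ ^ 2 • w) w w)) ∂μ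

variable {a : ι → ι → EuclideanSpace ℝ ι → ℝ}
  {β : EuclideanSpace ℝ ι → EuclideanSpace ℝ ι →L[ℝ] EuclideanSpace ℝ ι →L[ℝ] ℝ}
  {c L B θ A : ℝ} {Ψ Ψ₁ Ψ₂ : ℝ → ℝ} {μ : Measure (EuclideanSpace ℝ ι)}
  [μ.IsAddHaarMeasure] {g : EuclideanSpace ℝ ι → ℝ}

theorem gaussAverage_zero (x : EuclideanSpace ℝ ι) :
    gaussAverage μ β g 0 x = g x * gaussMass μ β x := by
  simp [gaussAverage, gaussMass, integral_const_mul]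

theorem EllipticPair.continuous_gaussAverage (h : EllipticPair a β c L B) (hg : Continuous g)
    {C : ℝ} (hC : ∀ y, |g y| ≤ C) :
    Continuous fun p : ℝ × EuclideanSpace ℝ ι => gaussAverage μ β g p.1 p.2 := by
  have hβ := h.continuous
  have hj : Continuous fun q : (ℝ × EuclideanSpace ℝ ι) × EuclideanSpace ℝ ι =>
      g (q.1.2 + q.1.1 ^ 2 • q.2) * Real.exp (-(β (q.1.2 + q.1.1 ^ 2 • q.2) q.2 q.2)) := by
    have hb : Continuous fun q : (ℝ × EuclideanSpace ℝ ι) × EuclideanSpace ℝ ι =>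
      β (q.1.2 + q.1.1 ^ 2 • q.2) := hβ.comp (by fun_prop)
    have := (hb.clm_apply continuous_snd).clm_apply continuous_snd
    fun_prop
  refine continuous_of_dominated (bound := fun w => C * Real.exp (-(c * ‖w‖ ^ 2))) ?_ ?_ ?_ ?_
  · exact fun p => (hj.comp (Continuous.prodMk_right p)).aestronglyMeasurable
  · refine fun p => Eventually.of_forall fun w => ?_
    rw [norm_mul, Real.norm_eq_abs, Real.norm_eq_abs, Real.abs_exp]
    exact mul_le_mul (hC _) (Real.exp_le_exp.2 (neg_le_neg (h.lower _ w))) (Real.exp_nonneg _)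
      ((abs_nonneg _).trans (hC 0))
  · exact (integrable_exp_neg_mul_norm_sq μ h.c_pos).const_mul C
  · exact Eventually.of_forall fun w => hj.comp (Continuous.prodMk_left w)

theorem EllipticPair.continuous_gaussMass (h : EllipticPair a β c L B) :
    Continuous (gaussMass μ β) := by
  have h1 := h.continuous_gaussAverage (μ := μ) (g := fun _ => 1) continuous_const (C := 1)
    (by simp)
  have h2 := h1.comp (Continuous.prodMk_right (0:ℝ))
  refine h2.congr fun x => ?_
  simp [gaussAverage_zero]

theorem EllipticPair.integrable_exp_neg (h : EllipticPair a β c L B) (y : EuclideanSpace ℝ ι) :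
    Integrable (fun w => Real.exp (-(β y w w))) μ := by
  refine (integrable_exp_neg_mul_norm_sq μ h.c_pos).mono' ?_ (Eventually.of_forall fun w => ?_)
  · have : Continuous fun w => β y w w := by fun_prop
    exact (Real.continuous_exp.comp this.neg).aestronglyMeasurable
  · rw [Real.norm_eq_abs, Real.abs_exp]
    exact Real.exp_le_exp.2 (neg_le_neg (h.lower _ w))

theorem EllipticPair.gaussMass_pos (h : EllipticPair a β c L B) (y : EuclideanSpace ℝ ι) :
    0 < gaussMass μ β y :=
  integral_exp_pos (h.integrable_exp_neg y)

theorem integral_mul_gaussKernel (A s : ℝ) (x : EuclideanSpace ℝ ι) :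
    ∫ y, g y * gaussKernel β (Fintype.card ι) A s x y ∂μ =
      Real.exp (-(A * Real.exp s)) * gaussAverage μ β g (Real.exp s) x := by
  set R := Real.exp s ^ 2 with hR
  have hR0 : 0 < R := by positivity
  have h1 := integral_add_left_eq_self (μ := μ)
    (fun y => g y * gaussKernel β (Fintype.card ι) A s x y) x
  have h2 := Measure.integral_comp_smul μ
    (fun y => g (x + y) * gaussKernel β (Fintype.card ι) A s x (x + y)) R
  rw [h1, finrank_euclideanSpace, abs_of_pos (by positivity), smul_eq_mul] at h2
  have h3 : R ^ Fintype.card ι ≠ 0 := by positivity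
  rw [← mul_right_inj' (inv_ne_zero h3), ← h2, gaussAverage, ← integral_const_mul,
    ← integral_const_mul]
  refine integral_congr_ae (Eventually.of_forall fun w => ?_)
  have e1 : (R ^ Fintype.card ι)⁻¹ = Real.exp (-(2 * Fintype.card ι * s)) := by
    rw [hR, Real.exp_neg, ← pow_mul, ← Real.exp_nat_mul]
    push_cast
    ring_nf
  have e2 : β (x + R • w) (x - (x + R • w)) (x - (x + R • w)) =
      R ^ 2 * β (x + R • w) w w := by
    rw [sub_add_cancel_left]
    simp
    ring
  have e3 : Real.exp (-(4 * s)) * R ^ 2 = 1 := by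
    rw [hR, ← pow_mul, ← Real.exp_nat_mul, ← Real.exp_add]
    norm_num
  dsimp only
  rw [gaussKernel, e2, ← mul_assoc (Real.exp (-(4 * s))), e3, one_mul, sub_eq_add_neg,
    sub_eq_add_neg, Real.exp_add, Real.exp_add, e1]
  ring

end GaussMass

section Comparison

variable {ι : Type*} [Fintype ι] [DecidableEq ι]

theorem EReal.continuousAt_add_coe_right (x : EReal) (r : ℝ) :
    ContinuousAt (fun p : EReal × EReal => p.1 + p.2) (x, (r : EReal)) := by
  induction x with
  | bot => exact EReal.continuousAt_add_bot_coe r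
  | coe x => exact EReal.continuousAt_add_coe_coe x r
  | top => exact EReal.continuousAt_add_top_coe r

theorem EReal.le_coe_sub_of_add_coe_le {x : EReal} {p q : ℝ} (h : x + (p : EReal) ≤ (q : EReal)) :
    x ≤ ((q - p : ℝ) : EReal) := by
  induction x with
  | bot => exact bot_le
  | coe x =>
    norm_cast at h ⊢
    linarith
  | top => simp at h

theorem nondivOp_const_sub (a : ι → ι → EuclideanSpace ℝ ι → ℝ) (C : ℝ)
    (w : EuclideanSpace ℝ ι → ℝ) (x : EuclideanSpace ℝ ι) :
    nondivOp a (fun x => C - w x) x = -nondivOp a w x := by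
  have h1 : fderiv ℝ (fun x => C - w x) = fun x => -fderiv ℝ w x := by
    funext x
    rw [fderiv_const_sub]
  have h2 : fderiv ℝ (fun x => -fderiv ℝ w x) x = -fderiv ℝ (fderiv ℝ w) x := by
    rw [fderiv_fun_neg]
  unfold nondivOp
  rw [h1, h2]
  simp

/-- Comparison of a viscosity subsolution `u` of `L u ≥ 0` with a classical solution of
`∂ₛ W ≤ κ L W`. -/
theorem le_sub_of_parabolic_comparison {a : ι → ι → EuclideanSpace ℝ ι → ℝ}
    {z : EuclideanSpace ℝ ι} {r s₀ S M : ℝ} (hs : s₀ < S) {W : ℝ → EuclideanSpace ℝ ι → ℝ}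
    (hWc : Continuous fun p : ℝ × EuclideanSpace ℝ ι => W p.1 p.2)
    (hWx : ∀ s, ContDiff ℝ 2 (W s))
    (hWs : ∀ s x, DifferentiableAt ℝ (fun s => W s x) s)
    (hsub : ∀ s ≤ S, ∀ x, ∃ κ : ℝ, 0 ≤ κ ∧ deriv (fun s => W s x) s ≤ κ * nondivOp a (W s) x)
    {u : EuclideanSpace ℝ ι → EReal} (hut : ∀ x ∈ Metric.closedBall z r, u x ≠ ⊤)
    (husc : UpperSemicontinuousOn u (Metric.closedBall z r))
    (hvisc : ∀ p ∈ Metric.ball z r, ∀ ψ : EuclideanSpace ℝ ι → ℝ, ContDiff ℝ 2 ψ → u p = ψ p →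
      (∀ᶠ x in 𝓝 p, u x ≤ ψ x) → 0 ≤ nondivOp a ψ p)
    (hinit : ∀ x ∈ Metric.closedBall z r, u x ≤ ((M - W s₀ x : ℝ) : EReal))
    (hbdry : ∀ s ∈ Set.Icc s₀ S, ∀ x ∈ Metric.sphere z r, u x ≤ ((M - W s x : ℝ) : EReal))
    {x₁ : EuclideanSpace ℝ ι} (hx₁ : x₁ ∈ Metric.closedBall z r) :
    u x₁ ≤ ((M - W S x₁ : ℝ) : EReal) := by
  by_contra hlt
  obtain ⟨ρ, hρ1, hρ2⟩ := EReal.lt_iff_exists_real_btwn.1 (not_le.1 hlt)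
  have hρ1' : M - W S x₁ < ρ := by exact_mod_cast hρ1
  have hS0 : 0 < S - s₀ := sub_pos.2 hs
  obtain ⟨η, hη0, hη⟩ : ∃ η : ℝ, 0 < η ∧ η * (S - s₀) = ρ - M + W S x₁ :=
    ⟨(ρ - M + W S x₁) / (S - s₀), div_pos (by linarith) hS0, by field_simp⟩
  set D : Set (ℝ × EuclideanSpace ℝ ι) := Set.Icc s₀ S ×ˢ Metric.closedBall z r with hD
  set G : ℝ × EuclideanSpace ℝ ι → ℝ := fun p => W p.1 p.2 - M - η * (p.1 - s₀) with hG
  have hGc : Continuous G := by fun_prop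
  have hF : UpperSemicontinuousOn (fun p : ℝ × EuclideanSpace ℝ ι => u p.2 + (G p : EReal)) D := by
    refine UpperSemicontinuousOn.add' (husc.comp continuous_snd.continuousOn fun p hp => hp.2)
      ((continuous_coe_real_ereal.comp hGc).upperSemicontinuous.upperSemicontinuousOn _)
      fun p _ => EReal.continuousAt_add_coe_right _ _
  have hSx : (S, x₁) ∈ D := ⟨⟨hs.le, le_rfl⟩, hx₁⟩
  obtain ⟨⟨s, x⟩, hsx, hmax⟩ := hF.exists_isMaxOn
    ⟨(S, x₁), hSx⟩ (isCompact_Icc.prod (isCompact_closedBall z r))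
  have hmax1 : u x₁ + (G (S, x₁) : EReal) ≤ u x + (G (s, x) : EReal) :=
    hmax hSx
  have hpos : ((0 : ℝ) : EReal) < u x + (G (s, x) : EReal) := by
    refine lt_of_lt_of_le ?_ hmax1
    have : ((0:ℝ) : EReal) = (ρ : EReal) + (G (S, x₁) : EReal) := by
      norm_cast
      simp only [hG]
      linarith
    rw [this]
    exact EReal.add_lt_add_right_coe hρ2 _
  have hxt := hut x hsx.2
  obtain ⟨t, ht⟩ : ∃ t : ℝ, u x = t := by
    induction hux : u x with
    | bot => rw [hux] at hpos; simp at hpos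
    | coe t => exact ⟨t, rfl⟩
    | top => exact absurd hux hxt
  rw [ht] at hpos
  have hpos' : 0 < t + (W s x - M - η * (s - s₀)) := by exact_mod_cast hpos
  have hall : ∀ s' ∈ Set.Icc s₀ S, ∀ x' ∈ Metric.closedBall z r,
      u x' ≤ ((t + G (s, x) - G (s', x') : ℝ) : EReal) := by
    intro s' hs' x' hx'
    have := hmax (a := (s', x')) ⟨hs', hx'⟩
    simp only [Set.mem_ofPred_eq, ht] at this
    exact EReal.le_coe_sub_of_add_coe_le (by exact_mod_cast this)
  have hs0 : s₀ ≤ s := hsx.1.1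
  have hss0 : s₀ < s := by
    refine lt_of_le_of_ne hs0 fun he => ?_
    have h1 := hinit x hsx.2
    rw [ht, he] at h1
    have h2 : t ≤ M - W s x := by exact_mod_cast h1
    rw [he] at hpos'
    simp at hpos'
    linarith
  have hxb : x ∈ Metric.ball z r := by
    refine Metric.mem_ball.2 (lt_of_le_of_ne (Metric.mem_closedBall.1 hsx.2) fun he => ?_)
    have h1 := hbdry s hsx.1 x he
    rw [ht] at h1
    have h2 : t ≤ M - W s x := by exact_mod_cast h1
    have : 0 ≤ η * (s - s₀) := mul_nonneg hη0.le (by linarith)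
    linarith
  have hL : 0 ≤ nondivOp a (fun x' => (t + W s x) - W s x') x := by
    refine hvisc x hxb _ (contDiff_const.sub (hWx s)) ?_ ?_
    · rw [ht]; simp
    · filter_upwards [Metric.isOpen_ball.mem_nhds hxb] with x' hx'
      refine (hall s hsx.1 x' (Metric.ball_subset_closedBall hx')).trans ?_
      norm_cast
      simp only [hG]
      linarith
  rw [nondivOp_const_sub] at hL
  obtain ⟨κ, hκ0, hκ⟩ := hsub s hsx.1.2 x
  have hder : η ≤ deriv (fun s => W s x) s := by
    have hd := (hWs s x).hasDerivAt.hasDerivWithinAt (s := Set.Iio s)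
    rw [hasDerivWithinAt_iff_tendsto_slope' (by simp)] at hd
    refine ge_of_tendsto hd ?_
    have : Set.Ico s₀ s ∈ 𝓝[<] s := Ico_mem_nhdsLT hss0
    filter_upwards [this] with s' hs'
    have h1 := hall s' ⟨hs'.1, hs'.2.le.trans hsx.1.2⟩ x hsx.2
    rw [ht] at h1
    have h2 : t ≤ t + G (s, x) - G (s', x) := by exact_mod_cast h1
    simp only [hG] at h2
    rw [slope_comm, slope_def_field, le_div_iff₀ (by linarith [hs'.2])]
    linarith
  have : κ * nondivOp a (W s) x ≤ 0 := mul_nonpos_of_nonneg_of_nonpos hκ0 (by linarith)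
  linarith

variable {a : ι → ι → EuclideanSpace ℝ ι → ℝ}
  {β : EuclideanSpace ℝ ι → EuclideanSpace ℝ ι →L[ℝ] EuclideanSpace ℝ ι →L[ℝ] ℝ}
  {c L B θ A : ℝ} {Ψ Ψ₁ Ψ₂ : ℝ → ℝ} {μ : Measure (EuclideanSpace ℝ ι)}
  [μ.IsAddHaarMeasure]

theorem EllipticPair.continuous_div_gaussMass (h : EllipticPair a β c L B)
    {f : EuclideanSpace ℝ ι → ℝ} (hf : Continuous f) :
    Continuous fun y => f y / gaussMass μ β y :=
  hf.div h.continuous_gaussMass fun y => (h.gaussMass_pos y).ne'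

theorem EllipticPair.le_sub_truncAverage (h : EllipticPair a β c L B)
    (hΨ : IsConvexTruncation θ Ψ Ψ₁ Ψ₂) (hθ : 0 < θ)
    (hA : 4 * (L * Fintype.card ι ^ 2 * B + Fintype.card ι * (L * Fintype.card ι / c)) ≤ A)
    {S : ℝ} (hs1 : L * Fintype.card ι / c * Real.exp S ≤ 1 / 2)
    (hs2 : 2 * Fintype.card ι * Real.exp S + |Real.log θ| * Real.exp S ^ 2 ≤ c)
    {z : EuclideanSpace ℝ ι} {R M : ℝ} (hSR : Real.exp S < R)
    {u : EuclideanSpace ℝ ι → EReal}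
    (husc : UpperSemicontinuousOn u (Metric.closedBall z (2 * R)))
    (hvisc : ∀ p ∈ Metric.ball z (2 * R), ∀ ψ : EuclideanSpace ℝ ι → ℝ, ContDiff ℝ 2 ψ →
      u p = ψ p → (∀ᶠ x in 𝓝 p, u x ≤ ψ x) → 0 ≤ nondivOp a ψ p)
    {f : EuclideanSpace ℝ ι → ℝ} (hf : Continuous f) (hf0 : ∀ x, 0 ≤ f x)
    (hfs : ∀ x, f x ≠ 0 → x ∈ Metric.closedBall z R)
    (hfu : ∀ x ∈ Metric.closedBall z (2 * R), u x ≤ ((M - f x : ℝ) : EReal)) :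
    u z ≤ ((M - truncAverage μ Ψ β A (fun y => f y / gaussMass μ β y) S z : ℝ) : EReal) := by
  have hR : 0 < R := (Real.exp_pos S).trans hSR
  have hA0 : 0 ≤ A := le_trans (by
    have := h.c_pos; have := h.L_nonneg; have := h.B_nonneg; positivity) hA
  set g : EuclideanSpace ℝ ι → ℝ := fun y => f y / gaussMass μ β y with hgdef
  have hg : Continuous g := h.continuous_div_gaussMass hf
  have hg0 : ∀ y, 0 ≤ g y := fun y => div_nonneg (hf0 y) (h.gaussMass_pos y).le
  have hgf : ∀ y, g y ≠ 0 → f y ≠ 0 := fun y hy h0 => hy (by simp [hgdef, h0])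
  have hgc : HasCompactSupport g :=
    HasCompactSupport.intro (isCompact_closedBall z R) fun y hy => by
      by_contra h0
      exact hy (hfs y (hgf y h0))
  obtain ⟨C, hC⟩ := hg.bounded_above_of_compact_support hgc
  have hsmono : ∀ s ≤ S, L * Fintype.card ι / c * Real.exp s ≤ 1 / 2 ∧
      2 * Fintype.card ι * Real.exp s + |Real.log θ| * Real.exp s ^ 2 ≤ c := by
    intro s hs
    have he : Real.exp s ≤ Real.exp S := Real.exp_le_exp.2 hs
    have := h.c_pos
    have := h.L_nonneg
    refine ⟨le_trans (by gcongr) hs1, le_trans (by gcongr) hs2⟩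
  refine EReal.le_of_forall_lt_iff_le.1 fun ρ hρ => ?_
  have hρ' : M - truncAverage μ Ψ β A g S z < ρ := by exact_mod_cast hρ
  obtain ⟨ε, hε0, hε⟩ : ∃ ε : ℝ, 0 < ε ∧ M + ε - truncAverage μ Ψ β A g S z = ρ :=
    ⟨ρ - (M - truncAverage μ Ψ β A g S z), by linarith, by ring⟩
  have htube : ∀ᶠ τ in 𝓝 (0:ℝ), ∀ x ∈ Metric.closedBall z (2 * R),
      gaussAverage μ β g τ x < f x + ε := by
    refine (isCompact_closedBall z (2 * R)).eventually_forall_of_forall_eventually fun x _ => ?_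
    have hc1 := h.continuous_gaussAverage (μ := μ) hg (C := C) hC
    have hc2 : Continuous fun p : ℝ × EuclideanSpace ℝ ι => f p.2 + ε := by fun_prop
    refine (hc1.tendsto (0, x)).eventually_lt (hc2.tendsto (0, x)) ?_
    dsimp only
    rw [gaussAverage_zero, hgdef]
    dsimp only
    rw [div_mul_cancel₀ _ (h.gaussMass_pos x).ne']
    linarith
  obtain ⟨s₀, hs₀S, hs₀⟩ := ((eventually_lt_atBot S).and
    (Real.tendsto_exp_atBot.eventually htube)).exists
  have hcK : ∀ s x, Continuous fun y => gaussKernel β (Fintype.card ι) A s x y := fun s x =>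
    (continuous_gaussKernel h.continuous (Fintype.card ι) A).comp
      (f := fun y => (s, x, y)) (by fun_prop)
  have hcT : ∀ s x, Continuous fun y => truncKernel Ψ β (Fintype.card ι) A s x y := fun s x =>
    hΨ.continuous.comp (hcK s x)
  have hub : ∀ x ∈ Metric.closedBall z (2 * R), u x ≤ (M : EReal) := fun x hx =>
    (hfu x hx).trans (by exact_mod_cast sub_le_self M (hf0 x))
  have key := le_sub_of_parabolic_comparison (a := a) (z := z) (r := 2 * R) (M := M + ε) hs₀S
    (W := truncAverage μ Ψ β A g) (h.continuous_truncAverage hΨ hg hgc)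
    (h.contDiff_truncAverage hΨ hg hgc)
    (fun s x => (h.hasDerivAt_truncAverage hΨ hg hgc s x).differentiableAt)
    (fun s hs x => ⟨_, ?_, h.deriv_truncAverage_le hΨ hθ hg hgc hg0 hA (hsmono s hs).1
      (hsmono s hs).2 x⟩) (u := u) ?_ husc hvisc ?_ ?_
    (x₁ := z) (Metric.mem_closedBall_self (by positivity))
  · rw [hε] at key
    exact key
  · have := (hsmono s hs).1
    exact div_nonneg (by positivity) (by linarith)
  · exact fun x hx hx' => by
      have := hub x hx
      rw [hx'] at this
      simp at this
  · intro x hx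
    refine (hfu x hx).trans ?_
    have h1 : truncAverage μ Ψ β A g s₀ x ≤ gaussAverage μ β g (Real.exp s₀) x := by
      have h2 : truncAverage μ Ψ β A g s₀ x ≤
          ∫ y, g y * gaussKernel β (Fintype.card ι) A s₀ x y ∂μ := by
        refine integral_mono ?_ ?_ fun y => ?_
        · exact (hg.mul (hcT s₀ x)).integrable_of_hasCompactSupport hgc.mul_right
        · exact (hg.mul (hcK s₀ x)).integrable_of_hasCompactSupport hgc.mul_right
        · exact mul_le_mul_of_nonneg_left (hΨ.le_self _ (gaussKernel_pos _ _ _ _ _ _).le) (hg0 y)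
      rw [integral_mul_gaussKernel] at h2
      refine h2.trans (mul_le_of_le_one_left ?_ ?_)
      · exact integral_nonneg fun w => mul_nonneg (hg0 _) (Real.exp_nonneg _)
      · exact Real.exp_le_one_iff.2 (by have := Real.exp_pos s₀; nlinarith)
    have h3 := hs₀ x hx
    norm_cast
    linarith
  · intro s hs x hx
    rw [h.truncAverage_eq_zero hΨ hθ hA0 (hsmono s hs.2).2]
    · refine (hub x (Metric.sphere_subset_closedBall hx)).trans ?_
      norm_cast
      linarith
    · intro y hy
      have h1 := hfs y (hgf y hy)
      rw [Metric.mem_closedBall] at h1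
      rw [Metric.mem_sphere] at hx
      have h2 := dist_triangle x y z
      have h3 : Real.exp s ≤ Real.exp S := Real.exp_le_exp.2 hs.2
      rw [← dist_eq_norm]
      linarith

end Comparison

section Approximation

/-- An upper semicontinuous function bounded above by `M` on a compact set is the limit of
`M - f k` for continuous nonnegative `f k`. -/
theorem UpperSemicontinuousOn.exists_seq_continuous_le {X : Type*} [PseudoMetricSpace X]
    {K : Set X} (hK : K.Nonempty) {u : X → EReal} (hu : UpperSemicontinuousOn u K)
    {M : ℝ} (hM : ∀ x ∈ K, u x ≤ M) :
    ∃ f : ℕ → X → ℝ, (∀ k, Continuous (f k)) ∧ (∀ k x, 0 ≤ f k x) ∧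
      (∀ k, ∀ x ∈ K, u x ≤ ((M - f k x : ℝ) : EReal)) ∧
      ∀ x ∈ K, u x ≠ ⊥ → Tendsto (fun k => f k x) atTop (𝓝 (M - (u x).toReal)) := by
  have : Nonempty K := hK.to_subtype
  set m : ℕ → X → ℝ := fun k y => M - (max (u y) ((M - k : ℝ) : EReal)).toReal with hm
  have hreal : ∀ k : ℕ, ∀ y ∈ K, ((M - m k y : ℝ) : EReal) = max (u y) ((M - k : ℝ) : EReal) := by
    intro k y hy
    simp only [hm, sub_sub_cancel]
    refine EReal.coe_toReal ?_ ?_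
    · refine ne_top_of_le_ne_top (EReal.coe_ne_top M) (max_le (hM y hy) ?_)
      exact_mod_cast sub_le_self M (Nat.cast_nonneg k)
    · exact ne_bot_of_le_ne_bot (EReal.coe_ne_bot _) (le_max_right _ _)
  have hm0 : ∀ k : ℕ, ∀ y ∈ K, 0 ≤ m k y := by
    intro k y hy
    have h1 : ((M - m k y : ℝ) : EReal) ≤ M := by
      rw [hreal k y hy]
      refine max_le (hM y hy) ?_
      exact_mod_cast sub_le_self M (Nat.cast_nonneg k)
    have h2 : M - m k y ≤ M := by exact_mod_cast h1
    linarith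
  set f : ℕ → X → ℝ := fun k x => ⨅ y : K, (m k y + k * dist x y) with hf
  have hpos : ∀ (k : ℕ) (x : X) (y : K), 0 ≤ m k y + k * dist x y := fun k x y =>
    add_nonneg (hm0 k y y.2) (by positivity)
  have hbdd : ∀ (k : ℕ) (x : X), BddBelow (Set.range fun y : K => m k y + k * dist x (y : X)) :=
    fun k x =>
    ⟨0, by rintro _ ⟨y, rfl⟩; exact hpos k x y⟩
  have hfm : ∀ k, ∀ x ∈ K, f k x ≤ m k x := by
    intro k x hx
    refine (ciInf_le (hbdd k x) ⟨x, hx⟩).trans ?_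
    simp
  refine ⟨f, fun k => ?_, fun k x => le_ciInf (hpos k x), ?_, ?_⟩
  · refine (LipschitzWith.of_le_add_mul (k : NNReal) fun x x' => ?_).continuous
    rw [← sub_le_iff_le_add]
    refine le_ciInf fun y => ?_
    rw [sub_le_iff_le_add]
    refine (ciInf_le (hbdd k x) y).trans ?_
    have h1 := mul_le_mul_of_nonneg_left (dist_triangle x x' y) (Nat.cast_nonneg (α := ℝ) k)
    simp only [NNReal.coe_natCast]
    linarith
  · intro k x hx
    have h1 : ((M - m k x : ℝ) : EReal) ≤ ((M - f k x : ℝ) : EReal) := by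
      exact_mod_cast sub_le_sub_left (hfm k x hx) M
    refine le_trans ?_ h1
    rw [hreal k x hx]
    exact le_max_left _ _
  · intro x hx hxb
    have hxt : u x ≠ ⊤ := ne_top_of_le_ne_top (EReal.coe_ne_top M) (hM x hx)
    obtain ⟨t, ht⟩ : ∃ t : ℝ, u x = t := ⟨(u x).toReal, (EReal.coe_toReal hxt hxb).symm⟩
    have htM : t ≤ M := by
      have := hM x hx
      rw [ht] at this
      exact_mod_cast this
    rw [ht, EReal.toReal_coe]
    refine tendsto_order.2 ⟨fun b hb => ?_, fun b hb => ?_⟩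
    · obtain ⟨b', hb1, hb2⟩ := exists_between hb
      have h1 : ∀ᶠ y in 𝓝[K] x, u y < ((M - b' : ℝ) : EReal) := by
        refine hu x hx _ ?_
        change u x < _
        rw [ht]
        exact_mod_cast (by linarith : t < M - b')
      obtain ⟨r, hr, hball⟩ := Metric.mem_nhdsWithin_iff.1 h1
      obtain ⟨N, hN⟩ := exists_nat_gt ((M - t) / r)
      obtain ⟨N', hN'⟩ := exists_nat_gt (M - t)
      filter_upwards [eventually_ge_atTop (max N N')] with k hk
      have hk1 : (N : ℝ) ≤ k := by exact_mod_cast (le_max_left _ _).trans hk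
      have hk2 : (N' : ℝ) ≤ k := by exact_mod_cast (le_max_right _ _).trans hk
      refine lt_of_lt_of_le hb1 (le_ciInf fun y => ?_)
      by_cases hy : dist (y : X) x < r
      · have h2 : u y < ((M - b' : ℝ) : EReal) := hball ⟨hy, y.2⟩
        have h3 : ((M - m k y : ℝ) : EReal) ≤ ((M - b' : ℝ) : EReal) := by
          rw [hreal k y y.2]
          refine max_le h2.le ?_
          exact_mod_cast (by linarith : M - k ≤ M - b')
        have h4 : M - m k y ≤ M - b' := by exact_mod_cast h3
        have : 0 ≤ (k : ℝ) * dist x y := by positivity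
        linarith
      · have h2 : (M - t) < k * r := by
          rw [div_lt_iff₀ hr] at hN
          exact hN.trans_le (by gcongr)
        have h3 : (k : ℝ) * r ≤ k * dist x y := by
          rw [dist_comm]
          exact mul_le_mul_of_nonneg_left (not_lt.1 hy) (Nat.cast_nonneg _)
        have := hm0 k y y.2
        linarith
    · refine Eventually.of_forall fun k => lt_of_le_of_lt (hfm k x hx) ?_
      have h3 : (t : EReal) ≤ ((M - m k x : ℝ) : EReal) := by
        rw [hreal k x hx, ← ht]
        exact le_max_left _ _
      have h4 : t ≤ M - m k x := by exact_mod_cast h3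
      linarith

/-- A nonnegative continuous function is uniformly approximated from below by nonnegative smooth
functions. -/
theorem Continuous.exists_contDiff_between {E : Type*} [NormedAddCommGroup E] [NormedSpace ℝ E]
    [FiniteDimensional ℝ E] {k : E → ℝ} (hk : Continuous k) (hk0 : ∀ x, 0 ≤ k x) {ε : ℝ}
    (hε : 0 < ε) :
    ∃ φ : E → ℝ, ContDiff ℝ ((⊤ : ℕ∞) : WithTop ℕ∞) φ ∧
      ∀ x, 0 ≤ φ x ∧ φ x ≤ k x ∧ k x - ε ≤ φ x := by
  obtain ⟨φ, hφ⟩ := exists_contMDiffMap_forall_mem_convex_of_local_const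
    (n := ⊤) (I := modelWithCornersSelf ℝ E) (M := E) (F := ℝ)
    (t := fun x => Set.Icc (max (k x - ε) 0) (k x)) (fun x => convex_Icc _ _) (fun x => by
      have hlt : ∀ᶠ y in 𝓝 x, |k y - k x| < ε / 2 := by
        have := (hk.tendsto x).eventually (Metric.ball_mem_nhds (k x) (half_pos hε))
        simpa [Real.dist_eq] using this
      rcases le_or_gt (k x) (ε / 2) with hx | hx
      · refine ⟨0, hlt.mono fun y hy => ⟨max_le ?_ le_rfl, hk0 y⟩⟩
        linarith [(abs_lt.1 hy).2]
      · refine ⟨k x - ε / 2, hlt.mono fun y hy => ⟨max_le ?_ ?_, ?_⟩⟩ <;>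
        linarith [(abs_lt.1 hy).2, (abs_lt.1 hy).1])
  refine ⟨φ, φ.contMDiff.contDiff, fun x => ?_⟩
  have := hφ x
  exact ⟨(le_max_right _ _).trans this.1, this.2, (le_max_left _ _).trans this.1⟩

end Approximation

section SubAverage

theorem continuous_gaussKernel_right {E : Type*} [NormedAddCommGroup E] [NormedSpace ℝ E]
    {β : E → E →L[ℝ] E →L[ℝ] ℝ} (hβ : Continuous β) (d A s : ℝ) (x : E) :
    Continuous (gaussKernel β d A s x) :=
  (continuous_gaussKernel hβ d A).comp (f := fun y => (s, x, y)) (by fun_prop)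

theorem continuous_truncKernel_right {E : Type*} [NormedAddCommGroup E] [NormedSpace ℝ E]
    {θ : ℝ} {Ψ Ψ₁ Ψ₂ : ℝ → ℝ} (hΨ : IsConvexTruncation θ Ψ Ψ₁ Ψ₂)
    {β : E → E →L[ℝ] E →L[ℝ] ℝ} (hβ : Continuous β) (d A s : ℝ) (x : E) :
    Continuous (truncKernel Ψ β d A s x) :=
  (continuous_truncKernel hΨ hβ d A).comp (f := fun y => (s, x, y)) (by fun_prop)

variable {ι : Type*} [Fintype ι] [DecidableEq ι]
  {a : ι → ι → EuclideanSpace ℝ ι → ℝ}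
  {β : EuclideanSpace ℝ ι → EuclideanSpace ℝ ι →L[ℝ] EuclideanSpace ℝ ι →L[ℝ] ℝ}
  {c L B : ℝ} {μ : Measure (EuclideanSpace ℝ ι)} [μ.IsAddHaarMeasure]

set_option maxHeartbeats 800000 in
/-- A continuous kernel of mass almost one, concentrated near `z`, against which every viscosity
subsolution satisfies a sub-mean value inequality at `z`. -/
theorem EllipticPair.exists_averaging_kernel (h : EllipticPair a β c L B)
    (z : EuclideanSpace ℝ ι) {R δ : ℝ} (hR : 0 < R) (hδ : 0 < δ) :
    ∃ k : EuclideanSpace ℝ ι → ℝ, Continuous k ∧ (∀ y, 0 ≤ k y) ∧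
      (∀ y, k y ≠ 0 → y ∈ Metric.closedBall z (R / 2)) ∧ 1 - δ ≤ ∫ y, k y ∂μ ∧
      ∀ (u : EuclideanSpace ℝ ι → EReal) (M : ℝ) (f : EuclideanSpace ℝ ι → ℝ),
        UpperSemicontinuousOn u (Metric.closedBall z (2 * R)) →
        (∀ p ∈ Metric.ball z (2 * R), ∀ ψ : EuclideanSpace ℝ ι → ℝ, ContDiff ℝ 2 ψ →
          u p = ψ p → (∀ᶠ x in 𝓝 p, u x ≤ ψ x) → 0 ≤ nondivOp a ψ p) →
        Continuous f → (∀ x, 0 ≤ f x) → (∀ x, f x ≠ 0 → x ∈ Metric.closedBall z R) →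
        (∀ x ∈ Metric.closedBall z (2 * R), u x ≤ ((M - f x : ℝ) : EReal)) →
        u z ≤ ((M - ∫ y, k y * f y ∂μ : ℝ) : EReal) := by
  have hc := h.c_pos
  have hL := h.L_nonneg
  have hB := h.B_nonneg
  set f₀ : EuclideanSpace ℝ ι → ℝ := fun y => max 0 (1 - dist y z / R) with hf₀
  have hf₀c : Continuous f₀ := by fun_prop
  have hf₀0 : ∀ y, 0 ≤ f₀ y := fun y => le_max_left _ _
  have hf₀1 : ∀ y, f₀ y ≤ 1 := fun y => max_le zero_le_one (by
    have : 0 ≤ dist y z / R := by positivity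
    linarith)
  have hf₀z : f₀ z = 1 := by simp [hf₀]
  set g₀ : EuclideanSpace ℝ ι → ℝ := fun y => f₀ y / gaussMass μ β y with hg₀
  have hg₀c : Continuous g₀ := h.continuous_div_gaussMass hf₀c
  have hg₀0 : ∀ y, 0 ≤ g₀ y := fun y => div_nonneg (hf₀0 y) (h.gaussMass_pos y).le
  have hg₀s : HasCompactSupport g₀ :=
    HasCompactSupport.intro (isCompact_closedBall z R) fun y hy => by
      rw [Metric.mem_closedBall, not_le] at hy
      have : 1 ≤ dist y z / R := by rw [le_div_iff₀ hR]; linarith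
      have h0 : f₀ y = 0 := max_eq_left (by linarith)
      simp [hg₀, h0]
  have hg₀i : Integrable g₀ μ := hg₀c.integrable_of_hasCompactSupport hg₀s
  obtain ⟨C, hC⟩ := hg₀s.exists_bound_of_continuous hg₀c
  have hI : 0 ≤ ∫ y, g₀ y ∂μ := integral_nonneg hg₀0
  obtain ⟨θ, hθdef⟩ : ∃ θ, θ = δ / (4 * ((∫ y, g₀ y ∂μ) + 1)) := ⟨_, rfl⟩
  have hθ : 0 < θ := by rw [hθdef]; exact div_pos hδ (by linarith)
  obtain ⟨Ψ, Ψ₁, Ψ₂, hΨ⟩ := exists_isConvexTruncation hθ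
  obtain ⟨A, hA⟩ : ∃ A, A = 4 * (L * Fintype.card ι ^ 2 * B +
      Fintype.card ι * (L * Fintype.card ι / c)) := ⟨_, rfl⟩
  have hA0 : 0 ≤ A := by rw [hA]; positivity
  have hexp := Real.tendsto_exp_atBot
  have hlim : ∀ F : ℝ → ℝ, Continuous F → Tendsto (fun S => F (Real.exp S)) atBot (𝓝 (F 0)) :=
    fun F hF => (hF.tendsto 0).comp hexp
  have h1 : ∀ᶠ S in atBot, L * Fintype.card ι / c * Real.exp S < 1 / 2 :=
    (hlim (fun t => L * Fintype.card ι / c * t) (by fun_prop)).eventually_lt_const (by simp)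
  have h2 : ∀ᶠ S in atBot, 2 * Fintype.card ι * Real.exp S + |Real.log θ| * Real.exp S ^ 2 < c :=
    (hlim (fun t => 2 * Fintype.card ι * t + |Real.log θ| * t ^ 2)
      (by fun_prop)).eventually_lt_const (by simpa using hc)
  have h3 : ∀ᶠ S in atBot, Real.exp S < R / 2 := hexp.eventually_lt_const (by positivity)
  have h4 : ∀ᶠ S in atBot, 1 - δ / 2 <
      Real.exp (-(A * Real.exp S)) * gaussAverage μ β g₀ (Real.exp S) z := by
    have hga : Continuous fun t => gaussAverage μ β g₀ t z :=
      (h.continuous_gaussAverage (μ := μ) hg₀c hC).along_fst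
    refine (hlim (fun t => Real.exp (-(A * t)) * gaussAverage μ β g₀ t z)
      (by fun_prop)).eventually_const_lt ?_
    simp only [mul_zero, neg_zero, Real.exp_zero, one_mul, gaussAverage_zero, hg₀, hf₀z]
    rw [one_div, inv_mul_cancel₀ (h.gaussMass_pos z).ne']
    linarith
  obtain ⟨S, hs1, hs2, hSR, hmass⟩ := (h1.and (h2.and (h3.and h4))).exists
  obtain ⟨κ, hκ⟩ : ∃ κ, κ = truncKernel Ψ β (Fintype.card ι) A S z := ⟨_, rfl⟩
  have hκc : Continuous κ := hκ ▸
    continuous_truncKernel_right hΨ h.continuous (Fintype.card ι) A S z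
  have hκ0 : ∀ y, 0 ≤ κ y := fun y => hκ ▸ hΨ.nonneg _
  have hκs : ∀ y, κ y ≠ 0 → y ∈ Metric.closedBall z (R / 2) := by
    intro y hy
    by_contra hcon
    rw [Metric.mem_closedBall, not_le, dist_comm, dist_eq_norm] at hcon
    exact hy (hκ ▸ h.truncKernel_eq_zero hΨ hθ hA0 hs2.le (hSR.trans hcon))
  have hks : ∀ y, κ y / gaussMass μ β y ≠ 0 → y ∈ Metric.closedBall z (R / 2) := fun y hy =>
    hκs y fun h0 => hy (by simp [h0])
  have hkc : Continuous fun y => κ y / gaussMass μ β y := h.continuous_div_gaussMass hκc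
  have hki : Integrable (fun y => κ y / gaussMass μ β y) μ :=
    hkc.integrable_of_hasCompactSupport
      (HasCompactSupport.intro (isCompact_closedBall z (R / 2)) fun y hy =>
        not_not.1 fun h0 => hy (hks y h0))
  refine ⟨fun y => κ y / gaussMass μ β y, hkc, fun y => div_nonneg (hκ0 y) (h.gaussMass_pos y).le,
    hks, ?_, ?_⟩
  · have hGi : Integrable (fun y => g₀ y * gaussKernel β (Fintype.card ι) A S z y) μ := by
      refine Continuous.integrable_of_hasCompactSupport (hg₀c.mul ?_) hg₀s.mul_right
      exact continuous_gaussKernel_right h.continuous (Fintype.card ι) A S z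
    have h5 : ∫ y, (g₀ y * gaussKernel β (Fintype.card ι) A S z y - 2 * θ * g₀ y) ∂μ ≤
        ∫ y, κ y / gaussMass μ β y ∂μ := by
      refine integral_mono (hGi.sub (hg₀i.const_mul _)) hki fun y => ?_
      have hm := h.gaussMass_pos (μ := μ) y
      have h6 := mul_le_mul_of_nonneg_left
        (hΨ.sub_le (gaussKernel β (Fintype.card ι) A S z y)) (hg₀0 y)
      have h7 : g₀ y * κ y ≤ κ y / gaussMass μ β y := by
        simp only [hg₀]
        rw [div_mul_eq_mul_div]
        gcongr
        exact mul_le_of_le_one_left (hκ0 y) (hf₀1 y)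
      have h8 : κ y = Ψ (gaussKernel β (Fintype.card ι) A S z y) := by rw [hκ]; rfl
      rw [← h8] at h6
      dsimp only
      linarith
    rw [integral_sub hGi (hg₀i.const_mul _), integral_mul_gaussKernel, integral_const_mul] at h5
    have h9 : 2 * θ * ∫ y, g₀ y ∂μ ≤ δ / 2 := by
      have : θ * (4 * ((∫ y, g₀ y ∂μ) + 1)) = δ := by
        rw [hθdef]; exact div_mul_cancel₀ _ (by linarith)
      linarith
    linarith
  · intro u M f husc hvisc hf hf0 hfs hfu
    have h10 := h.le_sub_truncAverage (μ := μ) hΨ hθ hA.ge hs1.le hs2.le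
      (by linarith : Real.exp S < R) husc hvisc hf hf0 hfs hfu
    have h11 : truncAverage μ Ψ β A (fun y => f y / gaussMass μ β y) S z =
        ∫ y, κ y / gaussMass μ β y * f y ∂μ := by
      unfold truncAverage
      refine integral_congr_ae (Eventually.of_forall fun y => ?_)
      simp only [hκ]
      ring
    rwa [h11] at h10

/-- A smooth kernel of mass almost one, concentrated near `z`, against which every viscosity
subsolution bounded by `M` satisfies a sub-mean value inequality at `z`. -/
theorem EllipticPair.exists_subaverage (h : EllipticPair a β c L B)
    (z : EuclideanSpace ℝ ι) {R δ : ℝ} (hR : 0 < R) (hδ : 0 < δ) :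
    ∃ φ : EuclideanSpace ℝ ι → ℝ, ContDiff ℝ ((⊤ : ℕ∞) : WithTop ℕ∞) φ ∧ (∀ y, 0 ≤ φ y) ∧
      tsupport φ ⊆ Metric.closedBall z R ∧ 1 - δ ≤ ∫ y, φ y ∂μ ∧
      ∀ (u : EuclideanSpace ℝ ι → EReal) (M : ℝ),
        UpperSemicontinuousOn u (Metric.closedBall z (2 * R)) →
        (∀ x ∈ Metric.closedBall z (2 * R), u x ≤ M) →
        (∀ p ∈ Metric.ball z (2 * R), ∀ ψ : EuclideanSpace ℝ ι → ℝ, ContDiff ℝ 2 ψ →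
          u p = ψ p → (∀ᶠ x in 𝓝 p, u x ≤ ψ x) → 0 ≤ nondivOp a ψ p) →
        IntegrableOn (fun y => (u y).toReal) (Metric.closedBall z (2 * R)) μ →
        (∀ᵐ y ∂μ.restrict (Metric.closedBall z (2 * R)), u y ≠ ⊥) →
        u z ≤ ((M - ∫ y, φ y * (M - (u y).toReal) ∂μ : ℝ) : EReal) := by
  obtain ⟨k, hkc, hk0, hks, hk1, hku⟩ := h.exists_averaging_kernel (μ := μ) z hR (half_pos hδ)
  set m := μ.real (Metric.closedBall z (R / 2)) with hm
  have hm0 : 0 ≤ m := measureReal_nonneg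
  obtain ⟨φ, hφ, hφk⟩ := hkc.exists_contDiff_between hk0
    (ε := δ / (2 * (m + 1))) (by positivity)
  have hφs : ∀ y, φ y ≠ 0 → y ∈ Metric.closedBall z (R / 2) := fun y hy => hks y fun h0 =>
    hy (le_antisymm (by simpa [h0] using (hφk y).2.1) (hφk y).1)
  have hkcs : HasCompactSupport k := HasCompactSupport.intro (isCompact_closedBall z (R / 2))
    fun y hy => not_not.1 fun h0 => hy (hks y h0)
  have hφcs : HasCompactSupport φ := HasCompactSupport.intro (isCompact_closedBall z (R / 2))
    fun y hy => not_not.1 fun h0 => hy (hφs y h0)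
  have hki : Integrable k μ := hkc.integrable_of_hasCompactSupport hkcs
  have hφi : Integrable φ μ := hφ.continuous.integrable_of_hasCompactSupport hφcs
  have hsub : Metric.closedBall z (R / 2) ⊆ Metric.closedBall z (2 * R) :=
    Metric.closedBall_subset_closedBall (by linarith)
  refine ⟨φ, hφ, fun y => (hφk y).1, ?_, ?_, ?_⟩
  · refine closure_minimal (fun y hy => ?_) Metric.isClosed_closedBall
    exact Metric.closedBall_subset_closedBall (by linarith) (hφs y hy)
  · have h1 : ∫ y, (k y - φ y) ∂μ ≤
        ∫ y, (Metric.closedBall z (R / 2)).indicator (fun _ => δ / (2 * (m + 1))) y ∂μ := by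
      refine integral_mono (hki.sub hφi) ?_ fun y => ?_
      · exact (integrable_indicator_iff measurableSet_closedBall).2
          (integrableOn_const (isCompact_closedBall z (R / 2)).measure_lt_top.ne)
      · by_cases hy : y ∈ Metric.closedBall z (R / 2)
        · simp only [Set.indicator_of_mem hy]
          linarith [(hφk y).2.2]
        · have h2 : k y = 0 := not_not.1 fun h0 => hy (hks y h0)
          simp only [Set.indicator_of_notMem hy]
          linarith [(hφk y).1]
    rw [integral_sub hki hφi, integral_indicator measurableSet_closedBall, setIntegral_const,
      smul_eq_mul, ← hm] at h1
    have h3 : m * (δ / (2 * (m + 1))) ≤ δ / 2 := by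
      rw [← mul_div_assoc, div_le_div_iff₀ (by positivity) (by positivity)]
      nlinarith
    linarith
  · intro u M husc hM hvisc hint hbot
    obtain ⟨f, hfc, hf0, hfu, hflim⟩ := husc.exists_seq_continuous_le
      ⟨z, Metric.mem_closedBall_self (by positivity)⟩ hM
    set χ : EuclideanSpace ℝ ι → ℝ := fun y => max 0 (min 1 (2 - 2 * (dist y z / R))) with hχ
    have hχc : Continuous χ := by fun_prop
    have hχ0 : ∀ y, 0 ≤ χ y := fun y => le_max_left _ _
    have hχ1 : ∀ y, χ y ≤ 1 := fun y => max_le zero_le_one (min_le_left _ _)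
    have hχs : ∀ y, χ y ≠ 0 → y ∈ Metric.closedBall z R := by
      intro y hy
      by_contra hcon
      rw [Metric.mem_closedBall, not_le] at hcon
      have : 1 ≤ dist y z / R := by rw [le_div_iff₀ hR]; linarith
      exact hy (max_eq_left ((min_le_right _ _).trans (by linarith)))
    have hχe : ∀ y ∈ Metric.closedBall z (R / 2), χ y = 1 := by
      intro y hy
      rw [Metric.mem_closedBall] at hy
      have : dist y z / R ≤ 1 / 2 := by rw [div_le_iff₀ hR]; linarith
      simp only [hχ]
      rw [min_eq_left (by linarith), max_eq_right zero_le_one]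
    have hk : ∀ j, u z ≤ ((M - ∫ y, k y * (f j y * χ y) ∂μ : ℝ) : EReal) := by
      intro j
      refine hku u M (fun y => f j y * χ y) husc hvisc ((hfc j).mul hχc)
        (fun y => mul_nonneg (hf0 j y) (hχ0 y)) (fun y hy => hχs y (right_ne_zero_of_mul hy)) ?_
      intro x hx
      refine (hfu j x hx).trans ?_
      exact_mod_cast sub_le_sub_left (mul_le_of_le_one_right (hf0 j x) (hχ1 x)) M
    have hk' : ∀ j, u z ≤ ((M - ∫ y, φ y * f j y ∂μ : ℝ) : EReal) := by
      intro j
      refine (hk j).trans ?_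
      have : ∫ y, φ y * f j y ∂μ ≤ ∫ y, k y * (f j y * χ y) ∂μ := by
        refine integral_mono ?_ ?_ fun y => ?_
        · exact (hφ.continuous.mul (hfc j)).integrable_of_hasCompactSupport hφcs.mul_right
        · exact (hkc.mul ((hfc j).mul hχc)).integrable_of_hasCompactSupport hkcs.mul_right
        · by_cases hy : y ∈ Metric.closedBall z (R / 2)
          · simp only [hχe y hy, mul_one]
            exact mul_le_mul_of_nonneg_right (hφk y).2.1 (hf0 j y)
          · have h2 : k y = 0 := not_not.1 fun h0 => hy (hks y h0)
            have h3 : φ y = 0 := not_not.1 fun h0 => hy (hφs y h0)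
            simp [h2, h3]
      exact_mod_cast sub_le_sub_left this M
    have hball : ∀ᵐ y ∂μ, y ∈ Metric.closedBall z (2 * R) → u y ≠ ⊥ :=
      (ae_restrict_iff' measurableSet_closedBall).1 hbot
    have hle : ∀ j, ∀ y ∈ Metric.closedBall z (2 * R), u y ≠ ⊥ → f j y ≤ M - (u y).toReal := by
      intro j y hy hyb
      have h1 := hfu j y hy
      have h2 : u y ≠ ⊤ := ne_top_of_le_ne_top (EReal.coe_ne_top M) (hM y hy)
      rw [← EReal.coe_toReal h2 hyb] at h1
      have h3 : (u y).toReal ≤ M - f j y := by exact_mod_cast h1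
      linarith
    have hdom : Integrable (fun y => φ y * (M - (u y).toReal)) μ := by
      have h1 : IntegrableOn (fun y => φ y * (M - (u y).toReal))
          (Metric.closedBall z (2 * R)) μ := by
        have h2 : IntegrableOn (fun y => M - (u y).toReal) (Metric.closedBall z (2 * R)) μ :=
          (integrableOn_const (isCompact_closedBall z (2 * R)).measure_lt_top.ne).sub hint
        exact h2.continuousOn_mul hφ.continuous.continuousOn (isCompact_closedBall z (2 * R))
      refine (integrableOn_iff_integrable_of_support_subset fun y hy => ?_).1 h1
      exact hsub (hφs y (left_ne_zero_of_mul hy))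
    have hlim : Tendsto (fun j => ∫ y, φ y * f j y ∂μ) atTop
        (𝓝 (∫ y, φ y * (M - (u y).toReal) ∂μ)) := by
      refine tendsto_integral_of_dominated_convergence _
        (fun j => (hφ.continuous.mul (hfc j)).aestronglyMeasurable) hdom (fun j => ?_) ?_
      · filter_upwards [hball] with y hy
        rw [Real.norm_eq_abs, abs_of_nonneg (mul_nonneg (hφk y).1 (hf0 j y))]
        by_cases h0 : φ y = 0
        · simp [h0]
        · exact mul_le_mul_of_nonneg_left (hle j y (hsub (hφs y h0)) (hy (hsub (hφs y h0))))
            (hφk y).1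
      · filter_upwards [hball] with y hy
        by_cases h0 : φ y = 0
        · simp [h0]
        · exact (hflim y (hsub (hφs y h0)) (hy (hsub (hφs y h0)))).const_mul _
    refine ge_of_tendsto' (x := atTop) (f := fun j => ((M - ∫ y, φ y * f j y ∂μ : ℝ) : EReal)) ?_ hk'
    exact (continuous_coe_real_ereal.tendsto _).comp (hlim.const_sub M)

end SubAverage

section Localization

open scoped Matrix

variable {ι : Type*} [Fintype ι] [DecidableEq ι]

theorem Matrix.PosDef.sum_mul_pos {Q : Matrix ι ι ℝ} (hQ : Q.PosDef) {ξ : ι → ℝ} (hξ : ξ ≠ 0) :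
    0 < ∑ k, ∑ l, Q k l * (ξ k * ξ l) := by
  have h := hQ.dotProduct_mulVec_pos hξ
  simp only [dotProduct, Matrix.mulVec, star_trivial, Finset.mul_sum] at h
  refine h.trans_eq (Finset.sum_congr rfl fun k _ => Finset.sum_congr rfl fun l _ => by ring)

/-- A continuous family of positive definite matrices with compact range is uniformly positive
definite. -/
theorem exists_pos_forall_mul_norm_sq_le {X : Type*} [TopologicalSpace X] {Q : X → Matrix ι ι ℝ}
    (hQ : Continuous Q) (hpos : ∀ x, (Q x).PosDef) {K : Set X} (hK : IsCompact K)
    (hQK : ∀ x, ∃ y ∈ K, Q x = Q y) :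
    ∃ c : ℝ, 0 < c ∧ ∀ x, ∀ ξ : EuclideanSpace ℝ ι,
      c * ‖ξ‖ ^ 2 ≤ ∑ k, ∑ l, Q x k l * (ξ k * ξ l) := by
  set q : X × EuclideanSpace ℝ ι → ℝ := fun p => ∑ k, ∑ l, Q p.1 k l * (p.2 k * p.2 l) with hq
  have hqc : Continuous q := by
    refine continuous_finsetSum _ fun k _ => continuous_finsetSum _ fun l _ => ?_
    have h1 : Continuous fun p : X × EuclideanSpace ℝ ι => Q p.1 k l :=
      (hQ.comp continuous_fst).matrix_elem k l
    have h2 : ∀ i, Continuous fun p : X × EuclideanSpace ℝ ι => p.2 i := fun i =>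
      (EuclideanSpace.proj (𝕜 := ℝ) i).continuous.comp continuous_snd
    exact h1.mul ((h2 k).mul (h2 l))
  have hq0 : ∀ p ∈ K ×ˢ Metric.sphere (0 : EuclideanSpace ℝ ι) 1, 0 < q p := by
    rintro ⟨x, ξ⟩ ⟨-, hξ⟩
    refine (hpos x).sum_mul_pos (ξ := fun k => ξ k) fun h0 => ?_
    have : ξ = 0 := by ext k; exact congrFun h0 k
    simp [this] at hξ
  have hc : ∃ c : ℝ, 0 < c ∧ ∀ p ∈ K ×ˢ Metric.sphere (0 : EuclideanSpace ℝ ι) 1, c ≤ q p := by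
    rcases (K ×ˢ Metric.sphere (0 : EuclideanSpace ℝ ι) 1).eq_empty_or_nonempty with he | hne
    · exact ⟨1, one_pos, by simp [he]⟩
    · obtain ⟨p, hp, hmin⟩ := (hK.prod (isCompact_sphere _ _)).exists_isMinOn hne hqc.continuousOn
      exact ⟨q p, hq0 p hp, fun p' hp' => hmin hp'⟩
  obtain ⟨c, hc0, hc⟩ := hc
  refine ⟨c, hc0, fun x ξ => ?_⟩
  obtain ⟨y, hy, hxy⟩ := hQK x
  rw [hxy]
  rcases eq_or_ne ξ 0 with rfl | hξ
  · simp
  · have hn : 0 < ‖ξ‖ := norm_pos_iff.2 hξ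
    have h1 := hc (y, ‖ξ‖⁻¹ • ξ) ⟨hy, by simp [norm_smul, hn.ne']⟩
    have h2 : q (y, ‖ξ‖⁻¹ • ξ) = (‖ξ‖ ^ 2)⁻¹ * ∑ k, ∑ l, Q y k l * (ξ k * ξ l) := by
      simp only [hq, Finset.mul_sum, PiLp.smul_apply, smul_eq_mul]
      refine Finset.sum_congr rfl fun k _ => Finset.sum_congr rfl fun l _ => ?_
      field_simp
    rw [h2, inv_mul_eq_div, le_div_iff₀ (by positivity)] at h1
    exact h1

/-- The bilinear form with matrix `P`. -/
noncomputable def matrixForm (P : Matrix ι ι ℝ) :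
    EuclideanSpace ℝ ι →L[ℝ] EuclideanSpace ℝ ι →L[ℝ] ℝ :=
  ∑ k, ∑ l, P k l • ContinuousLinearMap.smulRight (EuclideanSpace.proj (𝕜 := ℝ) k)
    (EuclideanSpace.proj (𝕜 := ℝ) l)

theorem matrixForm_apply (P : Matrix ι ι ℝ) (v w : EuclideanSpace ℝ ι) :
    matrixForm P v w = ∑ k, ∑ l, P k l * (v k * w l) := by
  simp [matrixForm]

set_option maxSynthPendingDepth 3 in
theorem continuous_matrixForm : Continuous (matrixForm : Matrix ι ι ℝ → _) := by
  unfold matrixForm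
  refine continuous_finsetSum _ fun k _ => continuous_finsetSum _ fun l _ => ?_
  exact (continuous_id.matrix_elem k l).smul continuous_const

theorem matrixForm_single_right (P : Matrix ι ι ℝ) (v : EuclideanSpace ℝ ι) (l : ι) :
    matrixForm P v (EuclideanSpace.single l 1) = ∑ k, P k l * v k := by
  simp [matrixForm_apply]

theorem matrixForm_single (P : Matrix ι ι ℝ) (k l : ι) :
    matrixForm P (EuclideanSpace.single k 1) (EuclideanSpace.single l 1) = P k l := by
  simp [matrixForm_single_right]

/-- Coefficients smooth and positive definite near a point agree near that point with the
coefficients of an elliptic pair. -/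
theorem exists_ellipticPair_of_posDef {a : ι → ι → EuclideanSpace ℝ ι → ℝ}
    {U : Set (EuclideanSpace ℝ ι)} (hU : IsOpen U) {z : EuclideanSpace ℝ ι} (hz : z ∈ U)
    (ha : ∀ k l, ContDiffOn ℝ ((⊤ : ℕ∞) : WithTop ℕ∞) (a k l) U)
    (hpos : ∀ x ∈ U, (Matrix.of fun k l => a k l x).PosDef) :
    ∃ (a' : ι → ι → EuclideanSpace ℝ ι → ℝ) (β : EuclideanSpace ℝ ι →
        EuclideanSpace ℝ ι →L[ℝ] EuclideanSpace ℝ ι →L[ℝ] ℝ) (c L B r : ℝ),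
      0 < r ∧ Metric.ball z r ⊆ U ∧ (∀ k l, ContDiff ℝ ((⊤ : ℕ∞) : WithTop ℕ∞) (a' k l)) ∧
      (∀ x ∈ Metric.ball z r, ∀ k l, a' k l x = a k l x) ∧ EllipticPair a' β c L B := by
  obtain ⟨R, hR, hRU⟩ := Metric.nhds_basis_closedBall.mem_iff.1 (hU.mem_nhds hz)
  let χ : ContDiffBump z := ⟨R / 2, R, by positivity, by linarith⟩
  have hχs : tsupport χ ⊆ U := by rw [χ.tsupport_eq]; exact hRU
  set b : ι → ι → EuclideanSpace ℝ ι → ℝ := fun k l x => χ x * (a k l x - a k l z) with hb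
  have hbc : ∀ k l, ContDiff ℝ ((⊤ : ℕ∞) : WithTop ℕ∞) (b k l) := fun k l => by
    refine contDiff_iff_contDiffAt.2 fun x => ?_
    by_cases hx : x ∈ tsupport (b k l)
    swap
    · exact contDiffAt_const.congr_of_eventuallyEq (notMem_tsupport_iff_eventuallyEq.1 hx)
    have hxU : x ∈ U := hχs (closure_mono (Function.support_mul_subset_left _ _) hx)
    exact χ.contDiff.contDiffAt.mul
      (((ha k l).contDiffAt (hU.mem_nhds hxU)).sub contDiffAt_const)
  have hbs : ∀ k l, HasCompactSupport (b k l) := fun k l => χ.hasCompactSupport.mul_right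
  set a' : ι → ι → EuclideanSpace ℝ ι → ℝ := fun k l x => a k l z + b k l x with ha'
  have ha'c : ∀ k l, ContDiff ℝ ((⊤ : ℕ∞) : WithTop ℕ∞) (a' k l) := fun k l =>
    contDiff_const.add (hbc k l)
  set Q : EuclideanSpace ℝ ι → Matrix ι ι ℝ := fun x => Matrix.of fun k l => a' k l x with hQ
  have hQc : Continuous Q := continuous_matrix fun k l => (ha'c k l).continuous
  have hQz : ∀ x, x ∉ tsupport χ → Q x = Q z := fun x hx => by
    ext k l
    simp [hQ, ha', hb, image_eq_zero_of_notMem_tsupport hx]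
  have hQpos : ∀ x, (Q x).PosDef := by
    have hQzz : Q z = Matrix.of fun k l => a k l z := by
      ext k l
      simp [hQ, ha', hb]
    intro x
    by_cases hx : x ∈ tsupport χ
    · have h1 : Q x = (1 - χ x) • (Matrix.of fun k l => a k l z) +
          χ x • (Matrix.of fun k l => a k l x) := by
        ext k l
        simp only [hQ, ha', hb, Matrix.of_apply, Matrix.add_apply, Matrix.smul_apply, smul_eq_mul]
        ring
      rw [h1]
      rcases (χ.nonneg (x := x)).eq_or_lt with h0 | h0
      · rw [← h0]
        simpa using hpos z hz
      · exact Matrix.PosDef.posSemidef_add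
          ((hpos z hz).posSemidef.smul (sub_nonneg.2 χ.le_one)) ((hpos x (hχs hx)).smul h0)
    · rw [hQz x hx, hQzz]
      exact hpos z hz
  have hdet : ∀ x, (Q x).det ≠ 0 := fun x => (hQpos x).det_pos.ne'
  set P : EuclideanSpace ℝ ι → Matrix ι ι ℝ := fun x => (Q x)⁻¹ with hP
  have hPc : Continuous P := by
    have h1 : P = fun x => (Q x).det⁻¹ • (Q x).adjugate := by
      funext x
      simp only [hP]
      rw [Matrix.inv_def, Ring.inverse_eq_inv']
    rw [h1]
    exact (hQc.matrix_det.inv₀ hdet).smul hQc.matrix_adjugate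
  have hPpos : ∀ x, (P x).PosDef := fun x => (hQpos x).inv
  set K : Set (EuclideanSpace ℝ ι) := insert z (tsupport χ) with hK
  have hKc : IsCompact K := χ.hasCompactSupport.insert z
  have hQK : ∀ x, ∃ y ∈ K, Q x = Q y := fun x => by
    by_cases hx : x ∈ tsupport χ
    · exact ⟨x, Set.mem_insert_of_mem _ hx, rfl⟩
    · exact ⟨z, Set.mem_insert _ _, hQz x hx⟩
  have hPK : ∀ x, ∃ y ∈ K, P x = P y := fun x =>
    (hQK x).imp fun y hy => ⟨hy.1, congrArg (·⁻¹) hy.2⟩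
  obtain ⟨c₁, hc₁, hell⟩ := exists_pos_forall_mul_norm_sq_le hQc hQpos hKc hQK
  obtain ⟨c₂, hc₂, hlow⟩ := exists_pos_forall_mul_norm_sq_le hPc hPpos hKc hPK
  have hlip : ∀ k l, ∃ C : NNReal, LipschitzWith C (b k l) := fun k l =>
    (hbc k l).lipschitzWith_of_hasCompactSupport (hbs k l) (by simp)
  choose C hC using hlip
  have hbdd : ∀ k l, ∃ B : ℝ, 0 ≤ B ∧ ∀ x, |P x k l| ≤ B := fun k l => by
    obtain ⟨B, hB⟩ := hKc.exists_bound_of_continuousOn (hPc.matrix_elem k l).continuousOn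
    refine ⟨B, (norm_nonneg _).trans (hB z (Set.mem_insert _ _)), fun x => ?_⟩
    obtain ⟨y, hy, hxy⟩ := hPK x
    rw [hxy]
    exact hB y hy
  choose B hB0 hB using hbdd
  have hsymm : ∀ x k l, P x k l = P x l k := fun x k l => by
    have := (hPpos x).isHermitian.apply l k
    simpa using this
  have hmul : ∀ x, Q x * P x = 1 := fun x => Matrix.mul_nonsing_inv _ (hdet x).isUnit
  refine ⟨a', fun x => matrixForm (P x), min c₁ c₂, ∑ k, ∑ l, (C k l : ℝ), ∑ k, ∑ l, B k l, R / 2,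
    by positivity, (Metric.ball_subset_closedBall.trans
      (Metric.closedBall_subset_closedBall (by linarith))).trans hRU, ha'c, ?_, ?_⟩
  · intro x hx k l
    have : χ x = 1 := χ.one_of_mem_closedBall (Metric.ball_subset_closedBall hx)
    simp [ha', hb, this]
  · refine ⟨lt_min hc₁ hc₂, by positivity,
      Finset.sum_nonneg fun k _ => Finset.sum_nonneg fun l _ => hB0 k l,
      continuous_matrixForm.comp hPc, ?_, ?_, ?_, ?_, ?_, ?_, ?_⟩
    · intro y v w
      rw [matrixForm_apply, matrixForm_apply, Finset.sum_comm]
      refine Finset.sum_congr rfl fun k _ => Finset.sum_congr rfl fun l _ => ?_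
      rw [hsymm y l k]
      ring
    · intro x ξ
      refine le_trans ?_ (hell x ξ)
      gcongr
      exact min_le_left _ _
    · intro k l x y
      have h1 := (hC k l).dist_le_mul x y
      rw [Real.dist_eq, dist_eq_norm] at h1
      have h2 : a' k l x - a' k l y = b k l x - b k l y := by simp [ha']
      rw [h2]
      refine h1.trans ?_
      gcongr
      exact (Finset.single_le_sum (f := fun l => (C k l : ℝ)) (fun _ _ => NNReal.coe_nonneg _)
        (Finset.mem_univ l)).trans (Finset.single_le_sum (f := fun k => ∑ l, (C k l : ℝ))
          (fun _ _ => by positivity) (Finset.mem_univ k))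
    · intro y w
      rw [matrixForm_apply]
      refine le_trans ?_ (hlow y w)
      gcongr
      exact min_le_right _ _
    · intro y k l
      rw [matrixForm_single]
      refine (hB k l y).trans ?_
      exact (Finset.single_le_sum (f := fun l => B k l) (fun l _ => hB0 k l)
        (Finset.mem_univ l)).trans (Finset.single_le_sum (f := fun k => ∑ l, B k l)
          (fun k _ => Finset.sum_nonneg fun l _ => hB0 k l) (Finset.mem_univ k))
    · intro y w
      set q : ι → ℝ := P y *ᵥ (fun k => w k) with hq
      have h1 : ∀ l, matrixForm (P y) w (EuclideanSpace.single l 1) = q l := fun l => by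
        rw [matrixForm_single_right, hq, Matrix.mulVec, dotProduct]
        exact Finset.sum_congr rfl fun k _ => by rw [hsymm y k l]
      have h2 : Q y *ᵥ q = fun k => w k := by
        rw [hq, Matrix.mulVec_mulVec, hmul, Matrix.one_mulVec]
      have h3 : ∀ k, ∑ l, a' k l y * q l = w k := fun k => congrFun h2 k
      simp only [h1]
      rw [matrixForm_apply]
      refine Finset.sum_congr rfl fun k _ => ?_
      have h4 : ∑ l, a' k l y * (q k * q l) = q k * w k := by
        rw [← h3 k, Finset.mul_sum]
        exact Finset.sum_congr rfl fun l _ => by ring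
      rw [h4, hq, Matrix.mulVec, dotProduct, Finset.sum_mul]
      exact Finset.sum_congr rfl fun l _ => by ring
    · intro y
      simp only [matrixForm_single]
      have h1 := congrArg Matrix.trace (hmul y)
      rw [Matrix.trace_one] at h1
      rw [← h1, Matrix.trace]
      refine Finset.sum_congr rfl fun k _ => ?_
      rw [Matrix.diag_apply, Matrix.mul_apply]
      exact Finset.sum_congr rfl fun l _ => by rw [hsymm y k l]; rfl

end Localization

section RealCoordinates

open scoped Matrix

/-- Index set of the real coordinates of `ℂ^n`. -/
abbrev CzIdx (n : ℕ) := Σ _ : Fin n, Fin 2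

/-- The real basis of `ℂ^n` formed by the vectors `e_i` and `I e_i`. -/
def czBasis (n : ℕ) : Module.Basis (CzIdx n) ℝ (Cz n) :=
  Pi.basis fun _ => Complex.basisOneI

theorem czBasis_apply {n : ℕ} (k : CzIdx n) :
    czBasis n k = Pi.single k.1 (Complex.basisOneI k.2) :=
  Pi.basis_apply _ _

/-- Real Euclidean coordinates on `ℂ^n`. -/
def czCoord (n : ℕ) : Cz n ≃L[ℝ] EuclideanSpace ℝ (CzIdx n) :=
  (czBasis n).equivFun.toContinuousLinearEquiv.trans (EuclideanSpace.equiv (CzIdx n) ℝ).symm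

theorem czCoord_czBasis {n : ℕ} (k : CzIdx n) :
    czCoord n (czBasis n k) = EuclideanSpace.single k 1 := by
  ext l
  change (czBasis n).equivFun (czBasis n k) l = _
  rw [Module.Basis.equivFun_self]
  simp [eq_comm]

/-- The coefficients of `∑ g_{ij} ∂²/∂z_i∂z̄_j` in real coordinates, before taking real parts. -/
def czCoeff {n : ℕ} (g : Matrix (Fin n) (Fin n) ℂ) (k l : CzIdx n) : ℂ :=
  g k.1 l.1 * (star (Complex.basisOneI k.2) * Complex.basisOneI l.2) / 4

theorem star_czCoeff {n : ℕ} {g : Matrix (Fin n) (Fin n) ℂ} (hg : g.IsHermitian)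
    (k l : CzIdx n) : star (czCoeff g k l) = czCoeff g l k := by
  unfold czCoeff
  rw [← hg.apply l.1 k.1]
  simp only [star_div₀, star_mul', star_star]
  have : star (4 : ℂ) = 4 := by simp
  rw [this]
  ring

theorem sum_mul_ofReal_eq_ofReal_sum_re {ι : Type*} [Fintype ι] {α : ι → ι → ℂ}
    (hα : ∀ k l, star (α k l) = α l k) {S : ι → ι → ℝ} (hS : ∀ k l, S k l = S l k) :
    ∑ k, ∑ l, α k l * (S k l : ℂ) = ((∑ k, ∑ l, (α k l).re * S k l : ℝ) : ℂ) := by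
  apply Complex.ext
  · simp
  · have h1 : ∑ k, ∑ l, (α k l).im * S k l = -∑ k, ∑ l, (α k l).im * S k l := by
      conv_lhs => rw [Finset.sum_comm]
      simp only [← Finset.sum_neg_distrib]
      refine Finset.sum_congr rfl fun k _ => Finset.sum_congr rfl fun l _ => ?_
      rw [← hα k l, hS l k]
      simp
    have h2 : ∑ k, ∑ l, (α k l).im * S k l = 0 := by linarith
    simpa using h2

theorem fderiv_ofReal_comp {E : Type*} [NormedAddCommGroup E] [NormedSpace ℝ E] {f : E → ℝ}
    {x : E} (hf : DifferentiableAt ℝ f x) (v : E) :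
    fderiv ℝ (fun y => (f y : ℂ)) x v = (fderiv ℝ f x v : ℂ) := by
  have h : HasFDerivAt (fun y => (f y : ℂ)) (Complex.ofRealCLM.comp (fderiv ℝ f x)) x :=
    Complex.ofRealCLM.hasFDerivAt.comp x hf.hasFDerivAt
  rw [h.fderiv]
  rfl

theorem fderiv_fderiv_apply {E : Type*} [NormedAddCommGroup E] [NormedSpace ℝ E] {f : E → ℝ}
    {x : E} (hf : DifferentiableAt ℝ (fderiv ℝ f) x) (v w : E) :
    fderiv ℝ (fun y => fderiv ℝ f y w) x v = fderiv ℝ (fderiv ℝ f) x v w := by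
  have h := (ContinuousLinearMap.apply ℝ ℝ w).hasFDerivAt.comp x hf.hasFDerivAt
  exact congrArg (fun F => F v) h.fderiv

theorem cHess_eq_sum {n : ℕ} {H : Cz n → ℝ} (hH : ContDiff ℝ 2 H) (i j : Fin n) (z : Cz n) :
    cHess H i j z = ∑ s, ∑ t, star (Complex.basisOneI s) * Complex.basisOneI t / 4 *
      (fderiv ℝ (fderiv ℝ H) z (czBasis n ⟨i, s⟩) (czBasis n ⟨j, t⟩) : ℂ) := by
  have hd : Differentiable ℝ H := hH.differentiable (by norm_num)
  have hd2 : Differentiable ℝ (fderiv ℝ H) :=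
    (hH.fderiv_right (m := 1) (by norm_num)).differentiable (by norm_num)
  have h1 : wderBar j (fun w => (H w : ℂ)) = fun w =>
      (1 / 2 : ℂ) * ((fderiv ℝ H w (Pi.single j 1) : ℝ) : ℂ) +
        (Complex.I / 2) * ((fderiv ℝ H w (Pi.single j Complex.I) : ℝ) : ℂ) := by
    funext w
    unfold wderBar
    rw [fderiv_ofReal_comp (hd w), fderiv_ofReal_comp (hd w)]
    ring
  have hda : ∀ w : Cz n, DifferentiableAt ℝ (fun y => fderiv ℝ H y w) z := fun w =>
    (hd2 z).clm_apply (differentiableAt_const w)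
  have hdc : ∀ w : Cz n, DifferentiableAt ℝ (fun y => ((fderiv ℝ H y w : ℝ) : ℂ)) z := fun w =>
    Complex.ofRealCLM.differentiableAt.comp z (hda w)
  have h2 : ∀ v, fderiv ℝ (wderBar j (fun w => (H w : ℂ))) z v =
      (1 / 2 : ℂ) * ((fderiv ℝ (fderiv ℝ H) z v (Pi.single j 1) : ℝ) : ℂ) +
        (Complex.I / 2) * ((fderiv ℝ (fderiv ℝ H) z v (Pi.single j Complex.I) : ℝ) : ℂ) := by
    intro v
    rw [h1, fderiv_fun_add ((hdc _).const_mul _) ((hdc _).const_mul _),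
      fderiv_const_mul (hdc _), fderiv_const_mul (hdc _)]
    simp only [_root_.add_apply, _root_.smul_apply, smul_eq_mul]
    rw [fderiv_ofReal_comp (hda _), fderiv_ofReal_comp (hda _), fderiv_fderiv_apply (hd2 z),
      fderiv_fderiv_apply (hd2 z)]
  unfold cHess cHessC wder
  rw [h2, h2]
  simp only [Fin.sum_univ_two, czBasis_apply, Complex.coe_basisOneI, Matrix.cons_val_zero,
    Matrix.cons_val_one, Complex.star_def, Complex.conj_I, map_one]
  ring_nf

theorem wLap_eq_ofReal_sum {n : ℕ} {ω : Cz n → Matrix (Fin n) (Fin n) ℂ} {H : Cz n → ℝ}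
    (hH : ContDiff ℝ 2 H) {z : Cz n} (hz : (ω z)⁻¹.IsHermitian) :
    wLap ω H z = ((∑ k, ∑ l, (czCoeff (ω z)⁻¹ k l).re *
      fderiv ℝ (fderiv ℝ H) z (czBasis n k) (czBasis n l) : ℝ) : ℂ) := by
  have hsymm : IsSymmSndFDerivAt ℝ H z :=
    hH.contDiffAt.isSymmSndFDerivAt (by simp)
  rw [← sum_mul_ofReal_eq_ofReal_sum_re (star_czCoeff hz) fun k l => hsymm _ _]
  unfold wLap
  simp only [Fintype.sum_sigma]
  refine Finset.sum_congr rfl fun i _ => ?_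
  rw [Finset.sum_comm (s := (Finset.univ : Finset (Fin 2)))]
  refine Finset.sum_congr rfl fun j _ => ?_
  rw [cHess_eq_sum hH, Finset.mul_sum]
  refine Finset.sum_congr rfl fun s _ => ?_
  rw [Finset.mul_sum]
  refine Finset.sum_congr rfl fun t _ => ?_
  unfold czCoeff
  ring

theorem posDef_re_czCoeff {n : ℕ} {g : Matrix (Fin n) (Fin n) ℂ} (hg : g.PosDef) :
    (Matrix.of fun k l : CzIdx n => (czCoeff g k l).re).PosDef := by
  refine Matrix.PosDef.of_dotProduct_mulVec_pos ?_ fun ξ hξ => ?_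
  · ext k l
    simp only [Matrix.conjTranspose_apply, Matrix.of_apply, star_trivial]
    rw [← star_czCoeff hg.isHermitian k l]
    simp
  · set ζ : Cz n := (czBasis n).equivFun.symm ξ with hζ
    have hζ0 : ζ ≠ 0 := (LinearEquiv.map_ne_zero_iff _).2 hξ
    have hζi : ∀ i, ζ i = ∑ s, Complex.basisOneI s * (ξ ⟨i, s⟩ : ℂ) := by
      intro i
      rw [hζ, Module.Basis.equivFun_symm_apply]
      simp only [Fintype.sum_sigma, Finset.sum_apply, Pi.smul_apply, czBasis_apply]
      rw [Finset.sum_eq_single i]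
      · simp [mul_comm]
      · intro j _ hj
        simp [hj.symm]
      · simp
    have h1 := (Complex.pos_iff.1 (hg.dotProduct_mulVec_pos hζ0)).1
    have h2 : star ζ ⬝ᵥ g *ᵥ ζ = 4 * ∑ k, ∑ l, czCoeff g k l * ((ξ k * ξ l : ℝ) : ℂ) := by
      simp only [dotProduct, Matrix.mulVec, Fintype.sum_sigma, Finset.mul_sum, Pi.star_apply]
      refine Finset.sum_congr rfl fun i _ => ?_
      rw [Finset.sum_comm (s := (Finset.univ : Finset (Fin 2)))]
      refine Finset.sum_congr rfl fun j _ => ?_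
      rw [hζi i, hζi j, star_sum, Finset.sum_mul]
      refine Finset.sum_congr rfl fun s _ => ?_
      rw [Finset.mul_sum, Finset.mul_sum]
      refine Finset.sum_congr rfl fun t _ => ?_
      have : star (ξ ⟨i, s⟩ : ℂ) = ξ ⟨i, s⟩ := Complex.conj_ofReal _
      rw [star_mul', this]
      unfold czCoeff
      push_cast
      ring
    rw [h2, sum_mul_ofReal_eq_ofReal_sum_re (star_czCoeff hg.isHermitian) fun k l => mul_comm _ _,
      Complex.mul_re, Complex.ofReal_re, Complex.ofReal_im] at h1
    have h3 : star ξ ⬝ᵥ (Matrix.of fun k l : CzIdx n => (czCoeff g k l).re) *ᵥ ξ =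
        ∑ k, ∑ l, (czCoeff g k l).re * (ξ k * ξ l) := by
      simp only [dotProduct, Matrix.mulVec, star_trivial, Finset.mul_sum, Matrix.of_apply]
      exact Finset.sum_congr rfl fun k _ => Finset.sum_congr rfl fun l _ => by ring
    rw [h3]
    norm_num at h1
    exact h1

theorem contDiffOn_re_czCoeff {n : ℕ} {ω : Cz n → Matrix (Fin n) (Fin n) ℂ} {Ω : Set (Cz n)}
    (hω : IsHermitianMetricOn ω Ω) (k l : CzIdx n) :
    ContDiffOn ℝ ((⊤ : ℕ∞) : WithTop ℕ∞) (fun z => (czCoeff (ω z)⁻¹ k l).re) Ω := by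
  have hentry := hω.1
  have hdet : ∀ A : Cz n → Matrix (Fin n) (Fin n) ℂ,
      (∀ i j, ContDiffOn ℝ ((⊤ : ℕ∞) : WithTop ℕ∞) (fun z => A z i j) Ω) →
      ContDiffOn ℝ ((⊤ : ℕ∞) : WithTop ℕ∞) (fun z => (A z).det) Ω := by
    intro A hA
    simp only [Matrix.det_apply]
    refine ContDiffOn.sum fun σ _ => ?_
    have : ContDiffOn ℝ ((⊤ : ℕ∞) : WithTop ℕ∞) (fun z => ∏ i, A z (σ i) i) Ω :=
      contDiffOn_prod fun i _ => hA _ _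
    exact this.const_smul _
  have hinv : ∀ i j, ContDiffOn ℝ ((⊤ : ℕ∞) : WithTop ℕ∞) (fun z => (ω z)⁻¹ i j) Ω := by
    intro i j
    have h1 : ContDiffOn ℝ ((⊤ : ℕ∞) : WithTop ℕ∞)
        (fun z => (ω z).det⁻¹ * (ω z).adjugate i j) Ω := by
      refine ((hdet ω hentry).inv fun z hz => (hω.2 z hz).det_pos.ne').mul ?_
      simp only [Matrix.adjugate_apply]
      refine hdet _ fun p q => ?_
      by_cases hp : p = j
      · subst hp
        simpa [Matrix.updateRow_self] using contDiffOn_const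
      · simpa [Matrix.updateRow_ne hp] using hentry p q
    refine h1.congr fun z _ => ?_
    rw [Matrix.inv_def, Ring.inverse_eq_inv', Matrix.smul_apply, smul_eq_mul]
  unfold czCoeff
  have h2 := ((hinv k.1 l.1).mul (contDiffOn_const
    (c := star (Complex.basisOneI k.2) * Complex.basisOneI l.2))).div_const (4 : ℂ)
  exact Complex.reCLM.contDiff.comp_contDiffOn h2

theorem fderiv_fderiv_comp_czCoord {n : ℕ} {h : EuclideanSpace ℝ (CzIdx n) → ℝ}
    (hh : ContDiff ℝ 2 h) (z : Cz n) (k l : CzIdx n) :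
    fderiv ℝ (fderiv ℝ (h ∘ czCoord n)) z (czBasis n k) (czBasis n l) =
      fderiv ℝ (fderiv ℝ h) (czCoord n z) (EuclideanSpace.single k 1)
        (EuclideanSpace.single l 1) := by
  have hc : ContDiff ℝ 2 (h ∘ czCoord n) := hh.comp (czCoord n).contDiff
  have hd : Differentiable ℝ (fderiv ℝ (h ∘ czCoord n)) :=
    (hc.fderiv_right (m := 1) (by norm_num)).differentiable (by norm_num)
  have hd' : Differentiable ℝ (fderiv ℝ h) :=
    (hh.fderiv_right (m := 1) (by norm_num)).differentiable (by norm_num)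
  rw [← fderiv_fderiv_apply (hd z), ← fderiv_fderiv_apply (hd' _)]
  have h1 : (fun y => fderiv ℝ (h ∘ czCoord n) y (czBasis n l)) =
      (fun x => fderiv ℝ h x (EuclideanSpace.single l 1)) ∘ czCoord n := by
    funext y
    rw [ContinuousLinearEquiv.comp_right_fderiv]
    simp [czCoord_czBasis]
  rw [h1, ContinuousLinearEquiv.comp_right_fderiv]
  simp [czCoord_czBasis]

theorem wLap_comp_czCoord {n : ℕ} {ω : Cz n → Matrix (Fin n) (Fin n) ℂ}
    {h : EuclideanSpace ℝ (CzIdx n) → ℝ} (hh : ContDiff ℝ 2 h) {z : Cz n}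
    (hz : (ω z).PosDef) :
    wLap ω (h ∘ czCoord n) z =
      (nondivOp (fun k l x => (czCoeff (ω ((czCoord n).symm x))⁻¹ k l).re) h (czCoord n z) : ℂ) := by
  rw [wLap_eq_ofReal_sum (hh.comp (czCoord n).contDiff) hz.inv.isHermitian]
  unfold nondivOp
  simp only [fderiv_fderiv_comp_czCoord hh, ContinuousLinearEquiv.symm_apply_apply]

end RealCoordinates

section SubMeanValue

open scoped Matrix

variable {n : ℕ} {Ω : Set (Cz n)} {ω : Cz n → Matrix (Fin n) (Fin n) ℂ}

/-- `ω`-subharmonic functions are viscosity subsolutions in real coordinates. -/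
theorem OmegaSH.nondivOp_nonneg {u : Cz n → EReal} (hu : OmegaSH ω Ω u)
    (hω : IsHermitianMetricOn ω Ω)
    {a : CzIdx n → CzIdx n → EuclideanSpace ℝ (CzIdx n) → ℝ}
    (ha : ∀ k l, ContDiff ℝ ((⊤ : ℕ∞) : WithTop ℕ∞) (a k l)) {c : ℝ} (hc : 0 < c)
    (hell : ∀ x, ∀ ξ : EuclideanSpace ℝ (CzIdx n),
      c * ‖ξ‖ ^ 2 ≤ ∑ k, ∑ l, a k l x * (ξ k * ξ l))
    {W : Set (EuclideanSpace ℝ (CzIdx n))} (hW : IsOpen W)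
    (hWΩ : ∀ x ∈ W, (czCoord n).symm x ∈ Ω)
    (haW : ∀ x ∈ W, ∀ k l, a k l x = (czCoeff (ω ((czCoord n).symm x))⁻¹ k l).re)
    {p : EuclideanSpace ℝ (CzIdx n)} (hp : p ∈ W) {ψ : EuclideanSpace ℝ (CzIdx n) → ℝ}
    (hψ : ContDiff ℝ 2 ψ) (hpψ : u ((czCoord n).symm p) = ψ p)
    (hle : ∀ᶠ x in 𝓝 p, u ((czCoord n).symm x) ≤ ψ x) : 0 ≤ nondivOp a ψ p := by
  refine nondivOp_nonneg_of_touching ha hc hW (u := fun x => u ((czCoord n).symm x)) ?_ hp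
    (hell p) hψ hpψ hle
  intro q r hr hqW h hh hLap hbdry
  set T := (czCoord n).toHomeomorph with hT
  have hTa : ∀ y, T y = czCoord n y := fun y => rfl
  have hclos : closure (T ⁻¹' Metric.ball q r) = T ⁻¹' Metric.closedBall q r := by
    rw [← T.preimage_closure, closure_ball q hr.ne']
  have hfron : frontier (T ⁻¹' Metric.ball q r) = T ⁻¹' Metric.sphere q r := by
    rw [← T.preimage_frontier, frontier_ball q hr.ne']
  have hΩ : ∀ y, T y ∈ W → y ∈ Ω := fun y hy => by
    have := hWΩ _ hy
    rwa [hTa, ContinuousLinearEquiv.symm_apply_apply] at this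
  have hmain := hu.maxPrinciple (T ⁻¹' Metric.ball q r) (Metric.isOpen_ball.preimage T.continuous)
    (by rw [hclos]; exact T.isCompact_preimage.2 (isCompact_closedBall q r))
    (by rw [hclos]; exact fun y hy => hΩ y (hqW hy)) (h ∘ czCoord n)
    (hh.continuous.comp (czCoord n).continuous).continuousOn
    (hh.comp (czCoord n).contDiff).contDiffOn ?_ ?_ ((czCoord n).symm q) ?_
  · simpa using hmain
  · intro y hy
    have hyW : T y ∈ W := hqW (Metric.ball_subset_closedBall hy)
    rw [wLap_comp_czCoord hh (hω.2 y (hΩ y hyW))]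
    have h1 := hLap _ hy
    unfold nondivOp at h1 ⊢
    simp only [haW _ hyW] at h1
    exact_mod_cast h1
  · intro y hy
    rw [hfron] at hy
    have := hbdry _ hy
    simpa [hTa] using this
  · rw [hclos]
    simp [hTa, hr.le]

/-- Near every point there is a smooth kernel of mass almost one, with respect to which all
`ω`-subharmonic functions satisfy a sub-mean value inequality. -/
theorem exists_subaverage_omegaSH (hΩ : IsOpen Ω) (hω : IsHermitianMetricOn ω Ω) {z : Cz n}
    (hz : z ∈ Ω) {U : Set (Cz n)} (hU : U ∈ 𝓝 z) {δ : ℝ} (hδ : 0 < δ) :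
    ∃ φ : Cz n → ℝ, ContDiff ℝ ((⊤ : ℕ∞) : WithTop ℕ∞) φ ∧ (∀ y, 0 ≤ φ y) ∧
      HasCompactSupport φ ∧ tsupport φ ⊆ U ∩ Ω ∧ 1 - δ ≤ ∫ y, φ y ∧
      ∀ (u : Cz n → EReal) (M : ℝ), OmegaSH ω Ω u → (∀ y ∈ Ω, u y ≤ M) →
        u z ≤ ((M - ∫ y, φ y * (M - (u y).toReal) : ℝ) : EReal) := by
  set T := (czCoord n).toHomeomorph with hT
  have hTa : ∀ y, T y = czCoord n y := fun y => rfl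
  have hemb : MeasurableEmbedding (czCoord n) := T.measurableEmbedding
  obtain ⟨a, β, c, L, B, r, hr, hrΩ, hac, haeq, hpair⟩ := exists_ellipticPair_of_posDef
    (a := fun k l x => (czCoeff (ω ((czCoord n).symm x))⁻¹ k l).re)
    (U := (czCoord n).symm ⁻¹' Ω) (hΩ.preimage (czCoord n).symm.continuous)
    (z := czCoord n z) (by simpa using hz)
    (fun k l => (contDiffOn_re_czCoeff hω k l).comp (czCoord n).symm.contDiff.contDiffOn
      fun x hx => hx)
    (fun x hx => posDef_re_czCoeff (hω.2 _ hx).inv)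
  have hU' : (czCoord n).symm ⁻¹' U ∩ Metric.ball (czCoord n z) r ∈ 𝓝 (czCoord n z) := by
    refine inter_mem ((czCoord n).symm.continuous.continuousAt ?_) (Metric.ball_mem_nhds _ hr)
    simpa using hU
  obtain ⟨R₂, hR₂, hR₂U⟩ := Metric.nhds_basis_closedBall.mem_iff.1 hU'
  obtain ⟨R, hR, rfl⟩ : ∃ R, 0 < R ∧ R₂ = 2 * R := ⟨R₂ / 2, by positivity, by ring⟩
  have : (volume.map (czCoord n) : Measure (EuclideanSpace ℝ (CzIdx n))).IsAddHaarMeasure :=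
    (czCoord n).isAddHaarMeasure_map volume
  obtain ⟨φ, hφ, hφ0, hφs, hφ1, hφu⟩ := hpair.exists_subaverage
    (μ := volume.map (czCoord n)) (czCoord n z) hR hδ
  have hsub : Metric.closedBall (czCoord n z) R ⊆ Metric.closedBall (czCoord n z) (2 * R) :=
    Metric.closedBall_subset_closedBall (by linarith)
  have hts : tsupport (φ ∘ czCoord n) ⊆ T ⁻¹' Metric.closedBall (czCoord n z) R := by
    refine closure_minimal (fun y hy => ?_) (Metric.isClosed_closedBall.preimage T.continuous)
    exact hφs (subset_tsupport _ hy)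
  have hball : ∀ y, czCoord n y ∈ Metric.closedBall (czCoord n z) (2 * R) → y ∈ U ∩ Ω := by
    intro y hy
    have h1 := hR₂U hy
    have h2 := hrΩ h1.2
    simp only [Set.mem_preimage, ContinuousLinearEquiv.symm_apply_apply] at h1 h2
    exact ⟨by simpa using h1.1, h2⟩
  refine ⟨φ ∘ czCoord n, hφ.comp (czCoord n).contDiff, fun y => hφ0 _, ?_, ?_, ?_, ?_⟩
  · exact (T.isCompact_preimage.2 (isCompact_closedBall _ _)).of_isClosed_subset
      (isClosed_tsupport _) hts
  · exact fun y hy => hball y (hsub (hts hy))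
  · rw [hemb.integral_map] at hφ1
    exact hφ1
  · intro u M hu hM
    have hmaps : ∀ x ∈ Metric.closedBall (czCoord n z) (2 * R), (czCoord n).symm x ∈ Ω :=
      fun x hx => (hball _ (by simpa using hx)).2
    have h1 := hφu (fun x => u ((czCoord n).symm x)) M ?_ (fun x hx => hM _ (hmaps x hx)) ?_ ?_ ?_
    · rw [hemb.integral_map] at h1
      simpa using h1
    · intro x hx b hb
      have h2 := hu.usc _ (hmaps x hx) b hb
      exact ((czCoord n).symm.continuous.continuousWithinAt.tendsto_nhdsWithin
        (fun y hy => hmaps y hy)).eventually h2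
    · intro p hp ψ hψ hpψ hle
      have hpr : p ∈ Metric.ball (czCoord n z) r :=
        (hR₂U (Metric.ball_subset_closedBall hp)).2
      exact hu.nondivOp_nonneg hω hac hpair.c_pos hpair.elliptic Metric.isOpen_ball
        (fun x hx => hrΩ hx) haeq hpr hψ hpψ hle
    · rw [hemb.integrableOn_map_iff]
      have h2 := hu.locInt.integrableOn_compact_subset (fun y hy => (hball y hy).2)
        (T.isCompact_preimage.2 (isCompact_closedBall (czCoord n z) (2 * R)))
      refine h2.congr (Eventually.of_forall fun y => ?_)
      simp
    · rw [hemb.restrict_map, hemb.ae_map_iff]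
      have h2 := ae_restrict_of_ae_restrict_of_subset (s := czCoord n ⁻¹'
        Metric.closedBall (czCoord n z) (2 * R)) (fun y hy => (hball y hy).2) hu.ae_ne_bot
      simpa using h2

end SubMeanValue

section Convergence

open scoped Matrix

variable {n : ℕ} {Ω : Set (Cz n)} {ω : Cz n → Matrix (Fin n) (Fin n) ℂ}

theorem OmegaSH.integrable_mul {u : Cz n → EReal} (hu : OmegaSH ω Ω u) {φ : Cz n → ℝ}
    (hφ : Continuous φ) (hφc : HasCompactSupport φ) (hφΩ : tsupport φ ⊆ Ω) :
    Integrable (fun z => φ z * (u z).toReal) := by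
  have h1 : IntegrableOn (fun z => φ z * (u z).toReal) (tsupport φ) :=
    (hu.locInt.integrableOn_compact_subset hφΩ hφc).continuousOn_mul hφ.continuousOn hφc
  refine (integrableOn_iff_integrable_of_support_subset fun y hy => ?_).1 h1
  exact subset_tsupport _ (left_ne_zero_of_mul hy)

theorem setIntegral_toReal_mul_eq {u : Cz n → EReal} {φ : Cz n → ℝ} (hφΩ : tsupport φ ⊆ Ω) :
    ∫ z in Ω, (u z).toReal * φ z = ∫ z, φ z * (u z).toReal := by
  rw [setIntegral_eq_integral_of_forall_compl_eq_zero]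
  · simp only [mul_comm]
  · intro z hz
    rw [image_eq_zero_of_notMem_tsupport fun h => hz (hφΩ h), mul_zero]

theorem OmegaSH.coe_toReal_ae {u : Cz n → EReal} (hu : OmegaSH ω Ω u) (hΩ : IsOpen Ω) :
    ∀ᵐ z, z ∈ Ω → ((u z).toReal : EReal) = u z := by
  filter_upwards [(ae_restrict_iff' hΩ.measurableSet).1 hu.ae_ne_bot] with z hz hzΩ
  exact EReal.coe_toReal (hu.ne_top z hzΩ) (hz hzΩ)

theorem limsup_le_of_tendsto_distrib (hΩ : IsOpen Ω) (hω : IsHermitianMetricOn ω Ω)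
    {u : ℕ → Cz n → EReal} (hu : ∀ j, OmegaSH ω Ω (u j))
    {M : ℝ} (hbd : ∀ j, ∀ z ∈ Ω, u j z ≤ (M : EReal))
    {v : Cz n → EReal} (hv : OmegaSH ω Ω v)
    (hconv : ∀ φ : Cz n → ℝ, ContDiff ℝ ((⊤ : ℕ∞) : WithTop ℕ∞) φ → HasCompactSupport φ →
      tsupport φ ⊆ Ω →
      Tendsto (fun j => ∫ z in Ω, (u j z).toReal * φ z) atTop
        (𝓝 (∫ z in Ω, (v z).toReal * φ z))) {z : Cz n} (hz : z ∈ Ω) :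
    limsup (fun j => u j z) atTop ≤ v z := by
  refine EReal.le_of_forall_lt_iff_le.1 fun t ht => ?_
  rcases le_or_gt M t with hMt | hMt
  · refine limsup_le_of_le (by isBoundedDefault) (Eventually.of_forall fun j => ?_)
    exact (hbd j z hz).trans (by exact_mod_cast hMt)
  obtain ⟨t', ht1, ht2⟩ := EReal.lt_iff_exists_real_btwn.1 ht
  have ht2 : t' < t := by exact_mod_cast ht2
  have hU : {y | v y < (t' : EReal)} ∈ 𝓝 z := by
    have := hv.usc z hz _ ht1
    rwa [hΩ.nhdsWithin_eq hz] at this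
  have hMt' : 0 < M - t' := by linarith
  obtain ⟨φ, hφ, hφ0, hφc, hφs, hφ1, hφu⟩ := exists_subaverage_omegaSH hΩ hω hz hU
    (δ := (t - t') / (M - t')) (div_pos (by linarith) hMt')
  have hφΩ : tsupport φ ⊆ Ω := hφs.trans Set.inter_subset_right
  have hφi : Integrable φ := hφ.continuous.integrable_of_hasCompactSupport hφc
  have hsplit : ∀ w : Cz n → EReal, OmegaSH ω Ω w →
      M - ∫ y, φ y * (M - (w y).toReal) =
        M - ((∫ y, φ y) * M - ∫ y in Ω, (w y).toReal * φ y) := by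
    intro w hw
    rw [setIntegral_toReal_mul_eq hφΩ, ← integral_mul_const,
      ← integral_sub (hφi.mul_const M) (hw.integrable_mul hφ.continuous hφc hφΩ)]
    simp only [mul_sub]
  have hlim : Tendsto (fun j => ((M - ∫ y, φ y * (M - (u j y).toReal) : ℝ) : EReal)) atTop
      (𝓝 ((M - ∫ y, φ y * (M - (v y).toReal) : ℝ) : EReal)) := by
    refine (continuous_coe_real_ereal.tendsto _).comp ?_
    simp only [hsplit _ hv, fun j => hsplit _ (hu j)]
    exact ((hconv φ hφ hφc hφΩ).const_sub _).const_sub _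
  have h1 : limsup (fun j => u j z) atTop ≤
      ((M - ∫ y, φ y * (M - (v y).toReal) : ℝ) : EReal) := by
    rw [← hlim.limsup_eq]
    exact limsup_le_limsup (Eventually.of_forall fun j => hφu _ M (hu j) (hbd j))
  refine h1.trans ?_
  have h2 : ∫ y, φ y * (M - t') ≤ ∫ y, φ y * (M - (v y).toReal) := by
    refine integral_mono_ae (hφi.mul_const _) ?_ ?_
    · have := (hφi.mul_const M).sub (hv.integrable_mul hφ.continuous hφc hφΩ)
      refine this.congr (Eventually.of_forall fun y => ?_)
      simp only [Pi.sub_apply]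
      ring
    · filter_upwards [hv.coe_toReal_ae hΩ] with y hy
      by_cases h0 : φ y = 0
      · simp [h0]
      · have hyU := hφs (subset_tsupport _ h0)
        have h3 : v y < (t' : EReal) := hyU.1
        rw [← hy hyU.2] at h3
        have h4 : (v y).toReal < t' := by exact_mod_cast h3
        exact mul_le_mul_of_nonneg_left (by linarith) (hφ0 y)
  rw [integral_mul_const] at h2
  have h5 := mul_le_mul_of_nonneg_right hφ1 hMt'.le
  rw [sub_mul, div_mul_cancel₀ _ hMt'.ne'] at h5
  exact_mod_cast (by linarith : M - ∫ y, φ y * (M - (v y).toReal) ≤ t)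

theorem exists_contDiff_one_on_compact {E : Type*} [NormedAddCommGroup E] [NormedSpace ℝ E]
    [FiniteDimensional ℝ E] {K U : Set E} (hK : IsCompact K) (hU : IsOpen U) (hKU : K ⊆ U) :
    ∃ φ : E → ℝ, ContDiff ℝ ((⊤ : ℕ∞) : WithTop ℕ∞) φ ∧ HasCompactSupport φ ∧
      tsupport φ ⊆ U ∧ (∀ x, 0 ≤ φ x) ∧ ∀ x ∈ K, φ x = 1 := by
  have : ProperSpace E := FiniteDimensional.proper_real E
  obtain ⟨L, hL, hKL, hLU⟩ := exists_compact_between hK hU hKU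
  obtain ⟨f, hf1, hf0, hf⟩ := exists_contMDiffMap_one_nhds_of_subset_interior (n := ⊤)
    (modelWithCornersSelf ℝ E) hK.isClosed hKL
  have hsub : tsupport f ⊆ L := closure_minimal
    (fun x hx => not_not.1 fun h => hx (hf0 x h)) hL.isClosed
  exact ⟨f, f.contMDiff.contDiff, hL.of_isClosed_subset (isClosed_tsupport _) hsub,
    hsub.trans hLU, fun x => (hf x).1, fun x hx => hf1.self_of_nhdsSet x hx⟩

theorem tendsto_integral_abs_sub_of_limsup_le (hΩ : IsOpen Ω)
    {u : ℕ → Cz n → EReal} (hu : ∀ j, OmegaSH ω Ω (u j))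
    {M : ℝ} (hbd : ∀ j, ∀ z ∈ Ω, u j z ≤ (M : EReal))
    {v : Cz n → EReal} (hv : OmegaSH ω Ω v)
    (hconv : ∀ φ : Cz n → ℝ, ContDiff ℝ ((⊤ : ℕ∞) : WithTop ℕ∞) φ → HasCompactSupport φ →
      tsupport φ ⊆ Ω →
      Tendsto (fun j => ∫ z in Ω, (u j z).toReal * φ z) atTop
        (𝓝 (∫ z in Ω, (v z).toReal * φ z)))
    (hlimsup : ∀ z ∈ Ω, limsup (fun j => u j z) atTop ≤ v z) {K : Set (Cz n)}
    (hK : IsCompact K) (hKΩ : K ⊆ Ω) :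
    Tendsto (fun j => ∫ z in K, |(u j z).toReal - (v z).toReal|) atTop (𝓝 0) := by
  obtain ⟨φ, hφ, hφc, hφΩ, hφ0, hφ1⟩ := exists_contDiff_one_on_compact hK hΩ hKΩ
  have hφi : Integrable φ := hφ.continuous.integrable_of_hasCompactSupport hφc
  have hui := fun j => (hu j).integrable_mul hφ.continuous hφc hφΩ
  have hvi := hv.integrable_mul hφ.continuous hφc hφΩ
  have hae : ∀ᵐ z, ∀ j, z ∈ Ω → ((u j z).toReal : EReal) = u j z :=
    ae_all_iff.2 fun j => (hu j).coe_toReal_ae hΩ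
  have hdi : ∀ j, Integrable fun z => φ z * ((u j z).toReal - (v z).toReal) := fun j => by
    refine ((hui j).sub hvi).congr (Eventually.of_forall fun z => ?_)
    simp only [Pi.sub_apply]
    ring
  have hai : ∀ j, Integrable fun z => φ z * |(u j z).toReal - (v z).toReal| := fun j => by
    refine (hdi j).abs.congr (Eventually.of_forall fun z => ?_)
    simp only [abs_mul, abs_of_nonneg (hφ0 z)]
  have hpi : ∀ j, Integrable fun z => φ z * max ((u j z).toReal - (v z).toReal) 0 := fun j => by
    refine (((hai j).add (hdi j)).div_const 2).congr (Eventually.of_forall fun z => ?_)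
    simp only [Pi.add_apply]
    rcases le_total 0 ((u j z).toReal - (v z).toReal) with h | h
    · rw [abs_of_nonneg h, max_eq_left h]; ring
    · rw [abs_of_nonpos h, max_eq_right h]; ring
  have hpos : Tendsto (fun j => ∫ z, φ z * max ((u j z).toReal - (v z).toReal) 0) atTop (𝓝 0) := by
    have hbi : Integrable fun z => |φ z * (M - (v z).toReal)| := by
      refine (((hφi.mul_const M).sub hvi).congr (Eventually.of_forall fun z => ?_)).abs
      simp only [Pi.sub_apply]
      ring
    have := tendsto_integral_of_dominated_convergence (f := fun _ : Cz n => (0 : ℝ)) _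
      (fun j => (hpi j).aestronglyMeasurable) hbi (fun j => ?_) ?_
    · simpa using this
    · filter_upwards [hae] with z hz
      by_cases h0 : φ z = 0
      · simp [h0]
      · have hzΩ : z ∈ Ω := hφΩ (subset_tsupport _ h0)
        have h1 := hbd j z hzΩ
        rw [← hz j hzΩ] at h1
        have h2 : (u j z).toReal ≤ M := by exact_mod_cast h1
        rw [Real.norm_eq_abs, abs_mul, abs_mul,
          abs_of_nonneg (le_max_right ((u j z).toReal - (v z).toReal) 0)]
        gcongr
        exact max_le ((by linarith : (u j z).toReal - (v z).toReal ≤ M - (v z).toReal).trans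
          (le_abs_self _)) (abs_nonneg _)
    · filter_upwards [hae, hv.coe_toReal_ae hΩ] with z hz hzv
      by_cases h0 : φ z = 0
      · simp [h0]
      · have hzΩ : z ∈ Ω := hφΩ (subset_tsupport _ h0)
        have hmax : Tendsto (fun j => max ((u j z).toReal - (v z).toReal) 0) atTop (𝓝 0) := by
          refine tendsto_order.2 ⟨fun b hb => Eventually.of_forall fun j =>
            hb.trans_le (le_max_right _ _), fun b hb => ?_⟩
          have h1 : limsup (fun j => u j z) atTop < (((v z).toReal + b : ℝ) : EReal) := by
            refine (hlimsup z hzΩ).trans_lt ?_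
            rw [← hzv hzΩ]
            exact_mod_cast (by simpa using hb : (v z).toReal < (v z).toReal + b)
          filter_upwards [eventually_lt_of_limsup_lt h1] with j hj
          rw [← hz j hzΩ] at hj
          have h2 : (u j z).toReal < (v z).toReal + b := by exact_mod_cast hj
          exact max_lt (by linarith) hb
        simpa using hmax.const_mul (φ z)
  have hdiff : Tendsto (fun j => ∫ z, φ z * ((u j z).toReal - (v z).toReal)) atTop (𝓝 0) := by
    have h1 := (hconv φ hφ hφc hφΩ).sub_const (∫ z in Ω, (v z).toReal * φ z)
    rw [sub_self] at h1
    refine h1.congr fun j => ?_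
    rw [setIntegral_toReal_mul_eq hφΩ, setIntegral_toReal_mul_eq hφΩ, ← integral_sub (hui j) hvi]
    simp only [mul_sub]
  have hall : Tendsto (fun j => ∫ z, φ z * |(u j z).toReal - (v z).toReal|) atTop (𝓝 0) := by
    have h1 := (hpos.const_mul 2).sub hdiff
    rw [mul_zero, sub_zero] at h1
    refine h1.congr fun j => ?_
    rw [← integral_const_mul, ← integral_sub ((hpi j).const_mul 2) (hdi j)]
    refine integral_congr_ae (Eventually.of_forall fun z => ?_)
    rcases le_total 0 ((u j z).toReal - (v z).toReal) with h | h
    · simp only [abs_of_nonneg h, max_eq_left h]; ring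
    · simp only [abs_of_nonpos h, max_eq_right h]; ring
  refine squeeze_zero (fun j => integral_nonneg fun z => abs_nonneg _) (fun j => ?_) hall
  calc ∫ z in K, |(u j z).toReal - (v z).toReal|
      = ∫ z in K, φ z * |(u j z).toReal - (v z).toReal| :=
        setIntegral_congr_fun hK.measurableSet fun z hz => by simp only [hφ1 z hz, one_mul]
    _ ≤ ∫ z, φ z * |(u j z).toReal - (v z).toReal| :=
        setIntegral_le_integral (hai j)
          (Eventually.of_forall fun z => mul_nonneg (hφ0 z) (abs_nonneg _))

theorem ae_limsup_eq_of_tendsto_integral_abs (hΩ : IsOpen Ω)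
    {u : ℕ → Cz n → EReal} (hu : ∀ j, OmegaSH ω Ω (u j))
    {v : Cz n → EReal} (hv : OmegaSH ω Ω v)
    (hlimsup : ∀ z ∈ Ω, limsup (fun j => u j z) atTop ≤ v z)
    (hL1 : ∀ K : Set (Cz n), IsCompact K → K ⊆ Ω →
      Tendsto (fun j => ∫ z in K, |(u j z).toReal - (v z).toReal|) atTop (𝓝 0)) :
    ∀ᵐ z ∂(volume.restrict Ω), limsup (fun j => u j z) atTop = v z := by
  have hcomp : ∀ K : Set (Cz n), IsCompact K → K ⊆ Ω →
      ∀ᵐ z ∂(volume.restrict K), limsup (fun j => u j z) atTop = v z := by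
    intro K hK hKΩ
    have hui := fun j => (hu j).locInt.integrableOn_compact_subset hKΩ hK
    have hvi := hv.locInt.integrableOn_compact_subset hKΩ hK
    have hmeas : TendstoInMeasure (volume.restrict K) (fun j z => (u j z).toReal) atTop
        (fun z => (v z).toReal) := by
      refine tendstoInMeasure_of_tendsto_eLpNorm (p := 1) one_ne_zero
        (fun j => (hui j).aestronglyMeasurable) hvi.aestronglyMeasurable ?_
      have h1 := ENNReal.tendsto_ofReal (hL1 K hK hKΩ)
      rw [ENNReal.ofReal_zero] at h1
      refine h1.congr fun j => ?_
      rw [eLpNorm_one_eq_lintegral_enorm,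
        ← ofReal_integral_norm_eq_lintegral_enorm ((hui j).sub hvi)]
      rfl
    obtain ⟨ns, hns, hlim⟩ := hmeas.exists_seq_tendsto_ae
    have hae : ∀ᵐ z, ∀ j, z ∈ Ω → ((u j z).toReal : EReal) = u j z :=
      ae_all_iff.2 fun j => (hu j).coe_toReal_ae hΩ
    filter_upwards [hlim, ae_restrict_of_ae hae, ae_restrict_of_ae (hv.coe_toReal_ae hΩ),
      ae_restrict_mem hK.measurableSet] with z hz hzu hzv hzK
    refine le_antisymm (hlimsup z (hKΩ hzK)) ?_
    have h2 : Tendsto (fun i => u (ns i) z) atTop (𝓝 (v z)) := by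
      have h3 := (continuous_coe_real_ereal.tendsto _).comp hz
      rw [hzv (hKΩ hzK)] at h3
      exact h3.congr fun i => hzu _ (hKΩ hzK)
    rw [← h2.limsup_eq]
    exact limsup_le_limsup_of_le (u := fun j => u j z) hns.tendsto_atTop
  rw [ae_restrict_iff' hΩ.measurableSet]
  refine measure_null_of_locally_null _ fun x hx => ?_
  have hx' : ¬(x ∈ Ω → limsup (fun j => u j x) atTop = v x) := hx
  have hxΩ : x ∈ Ω := by
    by_contra h
    exact hx' fun h' => absurd h' h
  obtain ⟨r, hr, hrΩ⟩ := Metric.nhds_basis_closedBall.mem_iff.1 (hΩ.mem_nhds hxΩ)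
  have h1 := (ae_restrict_iff' measurableSet_closedBall).1
    (hcomp _ (isCompact_closedBall x r) hrΩ)
  refine ⟨_, inter_mem_nhdsWithin _ (Metric.closedBall_mem_nhds x hr),
    measure_mono_null (fun y hy => ?_) (ae_iff.1 h1)⟩
  exact fun hcon => hy.1 fun _ => hcon hy.2

end Convergence

/-- If a sequence of `ω`-subharmonic functions, uniformly bounded
above, converges to an `ω`-subharmonic `u` in the sense of distributions, then it
converges in `L¹` on compact subsets, `limsup u_j ≤ u` everywhere in `Ω`, and
`limsup u_j = u` almost everywhere. -/
theorem stmt18 (n : ℕ) (Ω : Set (Cz n)) (hΩo : IsOpen Ω) (hΩb : Bornology.IsBounded Ω)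
    (ω : Cz n → Matrix (Fin n) (Fin n) ℂ) (hω : IsHermitianMetricOn ω Ω)
    (u : ℕ → Cz n → EReal) (hu : ∀ j, OmegaSH ω Ω (u j))
    (M : ℝ) (hbd : ∀ j, ∀ z ∈ Ω, u j z ≤ (M : EReal))
    (v : Cz n → EReal) (hv : OmegaSH ω Ω v)
    (hconv : ∀ φ : Cz n → ℝ, ContDiff ℝ ((⊤ : ℕ∞) : WithTop ℕ∞) φ → HasCompactSupport φ →
      tsupport φ ⊆ Ω →
      Tendsto (fun j => ∫ z in Ω, (u j z).toReal * φ z) atTop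
        (𝓝 (∫ z in Ω, (v z).toReal * φ z))) :
    (∀ K : Set (Cz n), IsCompact K → K ⊆ Ω →
      Tendsto (fun j => ∫ z in K, |(u j z).toReal - (v z).toReal|) atTop (𝓝 0)) ∧
    (∀ z ∈ Ω, limsup (fun j => u j z) atTop ≤ v z) ∧
    (∀ᵐ z ∂(volume.restrict Ω), limsup (fun j => u j z) atTop = v z) := by
  have hlimsup : ∀ z ∈ Ω, limsup (fun j => u j z) atTop ≤ v z := fun z hz =>
    limsup_le_of_tendsto_distrib hΩo hω hu hbd hv hconv hz
  have hL1 : ∀ K : Set (Cz n), IsCompact K → K ⊆ Ω →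
      Tendsto (fun j => ∫ z in K, |(u j z).toReal - (v z).toReal|) atTop (𝓝 0) := fun K hK hKΩ =>
    tendsto_integral_abs_sub_of_limsup_le hΩo hu hbd hv hconv hlimsup hK hKΩ
  exact ⟨hL1, hlimsup, ae_limsup_eq_of_tendsto_integral_abs hΩo hu hv hlimsup hL1⟩
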